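/- Let p be a prime and K a field containing a primitive p-th root of unity. If there exists a group homomorphism θ : ℤ/p²ℤ → Aut(ℤ/p²ℤ) such that Gal(K''/K) is isomorphic to the semidirect product (ℤ/p²ℤ) ⋊_θ (ℤ/p²ℤ), then K admits a p-henselian valuation tamely branching at p. -/

import Mathlib

noncomputable section

/-- The maximal `p`-extension of `K` inside an ambient field extension `Ω`:
the compositum of all finite Galois subextensions of `Ω/K` of `p`-power degree. -/
def maxPExt (p : ℕ) (K Ω : Type*) [Field K] [Field Ω] [Algebra K Ω] :
    IntermediateField K Ω :=
  ⨆ L : {L : IntermediateField K Ω //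
      FiniteDimensional K ↥L ∧ IsGalois K ↥L ∧ ∃ n : ℕ, Module.finrank K ↥L = p ^ n}, L.1

/-- A valuation (subring) of `K` is `p`-henselian if it extends uniquely to `K(p)`. -/
def IsPHenselian (p : ℕ) {K : Type*} [Field K] (O : ValuationSubring K) : Prop :=
  ∃! O' : ValuationSubring ↥(maxPExt p K (AlgebraicClosure K)),
    O'.comap (algebraMap K ↥(maxPExt p K (AlgebraicClosure K))) = O

/-- The maximal elementary abelian exponent-`r` extension of `E` inside `Ω`: the compositum
of all Galois subextensions of `Ω/E` whose Galois group is abelian of exponent dividing `r`. -/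
def elemAbExt (r : ℕ) (E Ω : Type*) [Field E] [Field Ω] [Algebra E Ω] :
    IntermediateField E Ω :=
  ⨆ L : {L : IntermediateField E Ω // IsGalois E ↥L ∧
      (∀ σ τ : ↥L ≃ₐ[E] ↥L, σ * τ = τ * σ) ∧ ∀ σ : ↥L ≃ₐ[E] ↥L, σ ^ r = 1}, L.1

/-- `K''`, the maximal elementary `ℤ/p` meta-abelian extension of `K`: the maximal elementary
abelian exponent-`p` extension of `K' `, the maximal elementary abelian exponent-`p`
extension of `K`. -/
def metaAbExt (p : ℕ) (K : Type*) [Field K] :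
    IntermediateField K (AlgebraicClosure K) :=
  (elemAbExt p (↥(elemAbExt p K (AlgebraicClosure K))) (AlgebraicClosure K)).restrictScalars K

/-- `K^{pq}`, the maximal `(p,q)`-meta-abelian extension of `K`: the compositum of all
elementary abelian exponent-`q` extensions of `K''`. -/
def pqMetaAbExt (p q : ℕ) (K : Type*) [Field K] :
    IntermediateField K (AlgebraicClosure K) :=
  (elemAbExt q (↥(metaAbExt p K)) (AlgebraicClosure K)).restrictScalars K

/-- A valuation (subring) `O` of `K` is tamely branching at the prime `p`:
the residue field has characteristic `≠ p`; the value group `Γ_v = Kˣ/Oˣ` satisfies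
`Γ_v ≠ pΓ_v` (expressed as: the subgroup of `Kˣ` generated by `p`-th powers and units of `O`
is proper); and if `[Γ_v : pΓ_v] = p` then the residue field admits a finite separable
extension of degree divisible by `p²`. -/
def IsTamelyBranching (p : ℕ) {K : Type*} [Field K] (O : ValuationSubring K) : Prop :=
  ringChar (IsLocalRing.ResidueField ↥O) ≠ p ∧
  ((powMonoidHom p : Kˣ →* Kˣ).range ⊔ O.unitGroup) ≠ ⊤ ∧
  (((powMonoidHom p : Kˣ →* Kˣ).range ⊔ O.unitGroup).index = p →
    ∃ L : IntermediateField (IsLocalRing.ResidueField ↥O)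
        (AlgebraicClosure (IsLocalRing.ResidueField ↥O)),
      FiniteDimensional (IsLocalRing.ResidueField ↥O) ↥L ∧
      Algebra.IsSeparable (IsLocalRing.ResidueField ↥O) ↥L ∧
      p ^ 2 ∣ Module.finrank (IsLocalRing.ResidueField ↥O) ↥L)

/-- A subset of a field that is a subgroup of its multiplicative group. -/
structure IsMulSubgroup {K : Type*} [Field K] (T : Set K) : Prop where
  one_mem : (1 : K) ∈ T
  mul_mem : ∀ {x y}, x ∈ T → y ∈ T → x * y ∈ T
  inv_mem : ∀ {x}, x ∈ T → x⁻¹ ∈ T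
  zero_notMem : (0 : K) ∉ T

namespace IsMulSubgroup

variable {K : Type*} [Field K] {T : Set K}

theorem ne_zero (hT : IsMulSubgroup T) {x : K} (hx : x ∈ T) : x ≠ 0 :=
  fun h => hT.zero_notMem (h ▸ hx)

theorem div_mem (hT : IsMulSubgroup T) {x y : K} (hx : x ∈ T) (hy : y ∈ T) : x / y ∈ T := by
  rw [div_eq_mul_inv]; exact hT.mul_mem hx (hT.inv_mem hy)

theorem pow_mem (hT : IsMulSubgroup T) {x : K} (hx : x ∈ T) (n : ℕ) : x ^ n ∈ T := by
  induction n with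
  | zero => simpa using hT.one_mem
  | succ n ih => rw [pow_succ]; exact hT.mul_mem ih hx

theorem zpow_mem (hT : IsMulSubgroup T) {x : K} (hx : x ∈ T) (n : ℤ) : x ^ n ∈ T := by
  cases n with
  | ofNat n => simpa using hT.pow_mem hx n
  | negSucc n => rw [zpow_negSucc]; exact hT.inv_mem (hT.pow_mem hx _)

theorem inv_mem_iff (hT : IsMulSubgroup T) {x : K} : x⁻¹ ∈ T ↔ x ∈ T :=
  ⟨fun h => by simpa using hT.inv_mem h, hT.inv_mem⟩

theorem mul_mem_iff_left (hT : IsMulSubgroup T) {x y : K} (hx : x ∈ T) : x * y ∈ T ↔ y ∈ T := by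
  refine ⟨fun h => ?_, hT.mul_mem hx⟩
  have := hT.mul_mem (hT.inv_mem hx) h
  rwa [inv_mul_cancel_left₀ (hT.ne_zero hx)] at this

theorem mul_mem_iff_right (hT : IsMulSubgroup T) {x y : K} (hy : y ∈ T) : x * y ∈ T ↔ x ∈ T := by
  rw [mul_comm, hT.mul_mem_iff_left hy]

end IsMulSubgroup

/-- The elements outside `H` that are small in the sense that `1 - z` lies in `T`. -/
def smallSet {K : Type*} [Field K] (T H : Set K) : Set K := {z | z ≠ 0 ∧ z ∉ H ∧ 1 - z ∈ T}

/-- The conditions on subgroups `T ⊆ H` of the multiplicative group of a field under which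
`smallSet T H` is the part outside `H` of the maximal ideal of a valuation ring. -/
structure IsRigidPair {K : Type*} [Field K] (T H : Set K) : Prop where
  left : IsMulSubgroup T
  right : IsMulSubgroup H
  le : T ⊆ H
  neg_one_mem : (-1 : K) ∈ H
  mem_or_inv_mem : ∀ {z}, z ≠ 0 → z ∉ H → z ∈ smallSet T H ∨ z⁻¹ ∈ smallSet T H
  neg_mem : ∀ {z}, z ∈ smallSet T H → -z ∈ smallSet T H
  one_sub_mul_mem : ∀ {x y}, x ∈ smallSet T H → y ∈ smallSet T H → 1 - x * y ∈ T
  mul_mul_mem : ∀ {x y z}, x ∈ smallSet T H → y ∈ smallSet T H → z ∈ smallSet T H →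
    x * y * z ∉ H → x * y * z ∈ smallSet T H

namespace IsRigidPair

variable {K : Type*} [Field K] {T H : Set K}

/-- The valuation ring attached to a rigid pair, as a set. -/
def integers (T H : Set K) : Set K :=
  {x | x = 0 ∨ x ∈ smallSet T H ∨ (x ∈ H ∧ ∀ a ∈ smallSet T H, x * a ∈ smallSet T H)}

theorem inv_notMem (h : IsRigidPair T H) {z : K} (hz : z ∈ smallSet T H) :
    z⁻¹ ∉ smallSet T H := fun hz' => by
  have := h.one_sub_mul_mem hz hz'
  rw [mul_inv_cancel₀ hz.1, sub_self] at this
  exact h.left.zero_notMem this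

theorem mul_mem (h : IsRigidPair T H) {x y : K} (hx : x ∈ smallSet T H) (hy : y ∈ smallSet T H)
    (hxy : x * y ∉ H) : x * y ∈ smallSet T H :=
  ⟨mul_ne_zero hx.1 hy.1, hxy, h.one_sub_mul_mem hx hy⟩

theorem div_one_sub_mem (h : IsRigidPair T H) {u : K} (hu : u ∈ smallSet T H) :
    u / (1 - u) ∈ smallSet T H := by
  have h1 : 1 - u ≠ 0 := h.left.ne_zero hu.2.2
  have hn : -(u / (1 - u)) ∈ smallSet T H := by
    refine ⟨neg_ne_zero.2 (div_ne_zero hu.1 h1), fun hH => hu.2.1 ?_, ?_⟩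
    · have h2 := h.right.mul_mem (h.right.mul_mem h.neg_one_mem hH) (h.le hu.2.2)
      have : -1 * -(u / (1 - u)) * (1 - u) = u := by field_simp
      rwa [this] at h2
    · have : 1 - -(u / (1 - u)) = (1 - u)⁻¹ := by field_simp; ring
      rw [this]; exact h.left.inv_mem hu.2.2
  simpa using h.neg_mem hn

/-- If `1 - x * a` lies in `T` for all small `a`, then so does `1 - (u + x * u)` for small `u`. -/
theorem one_sub_add_mem (h : IsRigidPair T H) {u x : K} (hu : u ∈ smallSet T H)
    (hx : ∀ a ∈ smallSet T H, 1 - x * a ∈ T) : 1 - (u + x * u) ∈ T := by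
  have h1 : 1 - u ≠ 0 := h.left.ne_zero hu.2.2
  have : 1 - (u + x * u) = (1 - u) * (1 - x * (u / (1 - u))) := by field_simp; ring
  rw [this]
  exact h.left.mul_mem hu.2.2 (hx _ (h.div_one_sub_mem hu))

theorem mul_one_add_mem (h : IsRigidPair T H) {x y : K} (hx : ∀ a ∈ smallSet T H, 1 - x * a ∈ T)
    (h1 : 1 + x ∈ H) (hy : y ∈ smallSet T H) : (1 + x) * y ∈ smallSet T H := by
  have hne := h.right.ne_zero h1
  have hnH : (1 + x) * y ∉ H := fun hh => hy.2.1 ((h.right.mul_mem_iff_left h1).1 hh)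
  refine (h.mem_or_inv_mem (mul_ne_zero hne hy.1) hnH).resolve_right fun hu => ?_
  refine h.inv_notMem hy ⟨inv_ne_zero hy.1, fun hh => hy.2.1 (h.right.inv_mem_iff.1 hh), ?_⟩
  have h2 := h.one_sub_add_mem hu hx
  have hy0 := hy.1
  have : ((1 + x) * y)⁻¹ + x * ((1 + x) * y)⁻¹ = y⁻¹ := by field_simp
  rwa [this] at h2

theorem one_add_mem_integers (h : IsRigidPair T H) {x : K} (hx : x ∈ integers T H) :
    1 + x ∈ integers T H := by
  rcases hx with rfl | hx | ⟨hxH, hx⟩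
  · exact Or.inr (Or.inr ⟨by simpa using h.right.one_mem, by simp⟩)
  · have h1 : 1 + x ∈ H := h.le (by simpa using (h.neg_mem hx).2.2)
    exact Or.inr (Or.inr ⟨h1, fun a ha =>
      h.mul_one_add_mem (fun b hb => h.one_sub_mul_mem hx hb) h1 ha⟩)
  · by_cases h0 : 1 + x = 0
    · exact Or.inl h0
    by_cases h1 : 1 + x ∈ H
    · exact Or.inr (Or.inr ⟨h1, fun a ha => h.mul_one_add_mem (fun b hb => (hx b hb).2.2) h1 ha⟩)
    · refine Or.inr (Or.inl ((h.mem_or_inv_mem h0 h1).resolve_right fun hy => ?_))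
      have := hx _ hy
      have e : x * (1 + x)⁻¹ = 1 - (1 + x)⁻¹ := by field_simp; ring
      rw [e] at this
      exact this.2.1 (h.le hy.2.2)

theorem mul_mem_integers (h : IsRigidPair T H) {x y : K} (hx : x ∈ integers T H)
    (hy : y ∈ integers T H) : x * y ∈ integers T H := by
  rcases hx with rfl | hx | ⟨hxH, hx⟩
  · left; simp
  · rcases hy with rfl | hy | ⟨hyH, hy⟩
    · left; simp
    · by_cases hxy : x * y ∈ H
      · refine Or.inr (Or.inr ⟨hxy, fun a ha => h.mul_mul_mem hx hy ha fun hh => ?_⟩)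
        exact ha.2.1 ((h.right.mul_mem_iff_left hxy).1 hh)
      · exact Or.inr (Or.inl (h.mul_mem hx hy hxy))
    · right; left; rw [mul_comm]; exact hy _ hx
  · rcases hy with rfl | hy | ⟨hyH, hy⟩
    · left; simp
    · exact Or.inr (Or.inl (hx _ hy))
    · exact Or.inr (Or.inr ⟨h.right.mul_mem hxH hyH, fun a ha => by
        rw [mul_assoc]; exact hx _ (hy _ ha)⟩)

theorem integers_mem_or_inv_mem (h : IsRigidPair T H) (x : K) :
    x ∈ integers T H ∨ x⁻¹ ∈ integers T H := by
  by_cases h0 : x = 0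
  · exact Or.inl (Or.inl h0)
  by_cases hxH : x ∈ H
  · by_contra hcon
    rw [not_or] at hcon
    obtain ⟨h1, h2⟩ := hcon
    have h1' : ∃ a ∈ smallSet T H, x * a ∉ smallSet T H := by
      by_contra hc; push Not at hc; exact h1 (Or.inr (Or.inr ⟨hxH, hc⟩))
    have h2' : ∃ b ∈ smallSet T H, x⁻¹ * b ∉ smallSet T H := by
      by_contra hc; push Not at hc
      exact h2 (Or.inr (Or.inr ⟨h.right.inv_mem hxH, hc⟩))
    obtain ⟨a, ha, hxa⟩ := h1'
    obtain ⟨b, hb, hxb⟩ := h2'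
    have hu := (h.mem_or_inv_mem (mul_ne_zero h0 ha.1) fun hh =>
      ha.2.1 ((h.right.mul_mem_iff_left hxH).1 hh)).resolve_left hxa
    have hv := (h.mem_or_inv_mem (mul_ne_zero (inv_ne_zero h0) hb.1) fun hh =>
      hb.2.1 ((h.right.mul_mem_iff_left (h.right.inv_mem hxH)).1 hh)).resolve_left hxb
    have hb0 := hb.1
    have ha0 := ha.1
    have e : (x * a)⁻¹ * (x⁻¹ * b)⁻¹ * b = a⁻¹ := by field_simp
    have := h.mul_mul_mem hu hv hb (by
      rw [e]; exact fun hh => ha.2.1 (h.right.inv_mem_iff.1 hh))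
    rw [e] at this
    exact h.inv_notMem ha this
  · rcases h.mem_or_inv_mem h0 hxH with h1 | h1
    · exact Or.inl (Or.inr (Or.inl h1))
    · exact Or.inr (Or.inr (Or.inl h1))

theorem neg_one_mem_integers (h : IsRigidPair T H) : (-1 : K) ∈ integers T H :=
  Or.inr (Or.inr ⟨h.neg_one_mem, fun a ha => by simpa using h.neg_mem ha⟩)

theorem add_mem_integers (h : IsRigidPair T H) {x y : K} (hx : x ∈ integers T H)
    (hy : y ∈ integers T H) : x + y ∈ integers T H := by
  by_cases hx0 : x = 0
  · simpa [hx0] using hy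
  by_cases hy0 : y = 0
  · simpa [hy0] using hx
  rcases h.integers_mem_or_inv_mem (x / y) with h1 | h1
  · have : x + y = y * (1 + x / y) := by field_simp; ring
    rw [this]; exact h.mul_mem_integers hy (h.one_add_mem_integers h1)
  · have : x + y = x * (1 + (x / y)⁻¹) := by field_simp
    rw [this]; exact h.mul_mem_integers hx (h.one_add_mem_integers h1)

/-- The valuation ring attached to a rigid pair. -/
def valuationSubring (h : IsRigidPair T H) : ValuationSubring K where
  carrier := integers T H
  mul_mem' := h.mul_mem_integers
  one_mem' := Or.inr (Or.inr ⟨h.right.one_mem, by simp⟩)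
  add_mem' := h.add_mem_integers
  zero_mem' := Or.inl rfl
  neg_mem' := fun {x} hx => by
    have := h.mul_mem_integers h.neg_one_mem_integers hx
    simpa using this
  mem_or_inv_mem' := h.integers_mem_or_inv_mem

theorem mem_right_of_unit (h : IsRigidPair T H) {x : K} (h0 : x ≠ 0)
    (hx : x ∈ h.valuationSubring) (hx' : x⁻¹ ∈ h.valuationSubring) : x ∈ H := by
  rcases hx with hx | hx | hx
  · exact absurd hx h0
  · rcases hx' with hx' | hx' | hx'
    · exact absurd hx' (inv_ne_zero h0)
    · exact absurd hx' (h.inv_notMem hx)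
    · exact h.right.inv_mem_iff.1 hx'.1
  · exact hx.1

theorem one_sub_mem (h : IsRigidPair T H) {x : K} (hx : x ∈ h.valuationSubring)
    (hx' : x⁻¹ ∉ h.valuationSubring) : 1 - x ∈ T := by
  rcases hx with rfl | hx | hx
  · simpa using h.left.one_mem
  · exact hx.2.2
  · have h2' : ∃ b ∈ smallSet T H, x⁻¹ * b ∉ smallSet T H := by
      by_contra hc; push Not at hc
      exact hx' (Or.inr (Or.inr ⟨h.right.inv_mem hx.1, hc⟩))
    obtain ⟨b, hb, hxb⟩ := h2'
    have h0 := h.right.ne_zero hx.1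
    have hv := (h.mem_or_inv_mem (mul_ne_zero (inv_ne_zero h0) hb.1) fun hh =>
      hb.2.1 ((h.right.mul_mem_iff_left (h.right.inv_mem hx.1)).1 hh)).resolve_left hxb
    have hb0 := hb.1
    have e : (x⁻¹ * b)⁻¹ * b = x := by field_simp
    have := h.one_sub_mul_mem hv hb
    rwa [e] at this

theorem smallSet_subset (h : IsRigidPair T H) {x : K} (hx : x ∈ smallSet T H) :
    x ∈ h.valuationSubring ∧ x⁻¹ ∉ h.valuationSubring := by
  refine ⟨Or.inr (Or.inl hx), ?_⟩
  rintro (h1 | h1 | h1)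
  · exact inv_ne_zero hx.1 h1
  · exact h.inv_notMem hx h1
  · exact hx.2.1 (h.right.inv_mem_iff.1 h1.1)

/-- If every element of `T` is a `p`-th power and every `p`-th power lies in `H`, then `p` is a
unit for the valuation ring attached to the rigid pair `T`, `H`. -/
theorem inv_prime_mem (h : IsRigidPair T H) {p : ℕ} (hp : p.Prime) (hp0 : (p : K) ≠ 0)
    (hTp : ∀ x ∈ T, ∃ y, y ^ p = x) (hpH : ∀ y : K, y ≠ 0 → y ^ p ∈ H) :
    (p : K)⁻¹ ∈ h.valuationSubring := by
  set O := h.valuationSubring with hO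
  by_contra hcon
  have hpO : (p : K) ∈ O := natCast_mem O p
  have hvp : O.valuation (p : K) < 1 := by
    rw [← O.mem_nonunits_iff, O.mem_nonunits_iff_or]; exact Or.inr hcon
  have key : ∀ t, t ∈ smallSet T H → (p : K) / t ∉ O := by
    intro t ht hpt
    have ht0 := ht.1
    obtain ⟨y, hy⟩ := hTp _ (h.neg_mem ht).2.2
    have hvt : O.valuation t < 1 := by
      rw [← O.mem_nonunits_iff, O.mem_nonunits_iff_or]; exact Or.inr (h.smallSet_subset ht).2
    have hyO : y ∈ O := by
      rw [← O.valuation_le_one_iff, ← pow_le_one_iff hp.ne_zero, ← map_pow, hy,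
        O.valuation_le_one_iff]
      exact O.sub_mem O.one_mem (O.neg_mem _ ((O.valuation_le_one_iff _).1 hvt.le))
    obtain ⟨r, hr⟩ := exists_add_pow_prime_eq hp
      (⟨y, hyO⟩ - 1 : O) (1 : O)
    have hr' : y ^ p = (y - 1) ^ p + 1 + p * (y - 1) * r := by
      have := congrArg (fun a : O => (a : K)) hr
      simpa using this
    set z := y - 1 with hz
    have hzO : z ∈ O := O.sub_mem hyO O.one_mem
    have e1 : t = z ^ p + p * z * r := by linear_combination hr' - hy
    have hvz : O.valuation z < 1 := by
      rw [← pow_lt_one_iff hp.ne_zero, ← map_pow]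
      have e2 : z ^ p = t - p * (z * r) := by linear_combination -e1
      rw [e2]
      refine lt_of_le_of_lt (Valuation.map_sub _ _ _) (max_lt hvt ?_)
      rw [map_mul]
      exact (mul_le_of_le_one_right'
        ((O.valuation_le_one_iff _).2 (O.mul_mem _ _ hzO r.2))).trans_lt hvp
    have e3 : t * (1 - (p : K) / t * r * z) = z ^ p := by field_simp; linear_combination e1
    have hw : 1 - (p : K) / t * r * z ∈ T := by
      have : (p : K) / t * r * z ∈ O.nonunits := by
        rw [O.mem_nonunits_iff, map_mul]
        exact (mul_le_of_le_one_left'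
          ((O.valuation_le_one_iff _).2 (O.mul_mem _ _ hpt r.2))).trans_lt hvz
      have h3 := O.nonunits_subset this
      rw [O.mem_nonunits_iff_or] at this
      rcases this with h4 | h4
      · rw [h4]; simpa using h.left.one_mem
      · exact h.one_sub_mem h3 h4
    have hz0 : z ≠ 0 := by
      intro h0
      have e4 : t * (1 - (p : K) / t * r * z) = 0 := by rw [e3, h0, zero_pow hp.ne_zero]
      exact mul_ne_zero ht0 (h.left.ne_zero hw) e4
    have := hpH z hz0
    rw [← e3, h.right.mul_mem_iff_right (h.le hw)] at this
    exact ht.2.1 this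
  rcases hpO with h1 | h1 | h1
  · exact hp0 h1
  · exact key _ h1 (by rw [div_self hp0]; exact O.one_mem)
  · have h2' : ∃ b ∈ smallSet T H, (p : K)⁻¹ * b ∉ smallSet T H := by
      by_contra hc; push Not at hc
      exact hcon (Or.inr (Or.inr ⟨h.right.inv_mem h1.1, hc⟩))
    obtain ⟨b, hb, hxb⟩ := h2'
    have hv := (h.mem_or_inv_mem (mul_ne_zero (inv_ne_zero hp0) hb.1) fun hh =>
      hb.2.1 ((h.right.mul_mem_iff_left (h.right.inv_mem h1.1)).1 hh)).resolve_left hxb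
    have hb0 := hb.1
    refine key b hb ?_
    have e : (p : K) / b = ((p : K)⁻¹ * b)⁻¹ := by field_simp
    rw [e]
    exact (h.smallSet_subset hv).1

end IsRigidPair

section Rigidity

variable {K : Type*} [Field K] {T H : Set K}

/-- For a subgroup `T` contained in `H`, every element outside `H` is rigid over `T`. -/
def IsRigidOutside (T H : Set K) : Prop :=
  ∀ z, z ≠ 0 → z ∉ H → 1 + z ∈ T ∨ (1 + z) / z ∈ T

theorem one_sub_mul_mem_or (hT : IsMulSubgroup T) (hH : IsMulSubgroup H) (hTH : T ⊆ H)
    (hr : IsRigidOutside T H) {x y : K} (hx : x ∈ smallSet T H) (hy : y ∈ smallSet T H) :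
    1 - x * y ∈ T ∨ (1 - x * y) / x ∈ T := by
  obtain ⟨hx0, hxH, hx1⟩ := hx
  obtain ⟨hy0, hyH, hy1⟩ := hy
  have hx1' := hT.ne_zero hx1
  have hy1' := hT.ne_zero hy1
  have e : (1 - x) * (1 + x * ((1 - y) / (1 - x))) = 1 - x * y := by field_simp; ring
  have hq : (1 - y) / (1 - x) ∈ T := hT.div_mem hy1 hx1
  rcases hr (x * ((1 - y) / (1 - x))) (mul_ne_zero hx0 (hT.ne_zero hq))
    (fun h => hxH ((hH.mul_mem_iff_right (hTH hq)).1 h)) with h | h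
  · left; rw [← e]; exact hT.mul_mem hx1 h
  · right
    have e2 : (1 - x * y) / x = (1 - y) *
        ((1 + x * ((1 - y) / (1 - x))) / (x * ((1 - y) / (1 - x)))) := by
      rw [← e]; field_simp
    rw [e2]; exact hT.mul_mem hy1 h

theorem mem_smallSet_or_inv_mem (hH : IsMulSubgroup H)
    (h1 : (-1 : K) ∈ H) (hr : IsRigidOutside T H) {z : K} (hz : z ≠ 0) (hzH : z ∉ H) :
    z ∈ smallSet T H ∨ z⁻¹ ∈ smallSet T H := by
  have hzH' : -z ∉ H := fun h => hzH (by simpa using hH.mul_mem h1 h)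
  rcases hr (-z) (neg_ne_zero.2 hz) hzH' with h | h
  · left; exact ⟨hz, hzH, by simpa [sub_eq_add_neg] using h⟩
  · right
    refine ⟨inv_ne_zero hz, fun h => hzH (hH.inv_mem_iff.1 h), ?_⟩
    have : 1 - z⁻¹ = (1 + -z) / -z := by field_simp; ring
    rwa [this]

/-- If `x * y * z` fails to be small for small `x`, `y`, `z`, then `-(y * z)` lies in `T`. -/
theorem neg_mul_mem_of_notMem (hT : IsMulSubgroup T)
    (hR : ∀ {z}, z ≠ 0 → z ∉ H → z ∈ smallSet T H ∨ z⁻¹ ∈ smallSet T H)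
    (hP : ∀ {x y}, x ∈ smallSet T H → y ∈ smallSet T H → 1 - x * y ∈ T)
    {x y z : K} (hx : x ∈ smallSet T H) (hy : y ∈ smallSet T H) (hz : z ∈ smallSet T H)
    (hH : x * y * z ∉ H) (hn : x * y * z ∉ smallSet T H) : -(y * z) ∈ T := by
  have hx0 := hx.1
  have hy0 := hy.1
  have hz0 := hz.1
  have hu := (hR (mul_ne_zero (mul_ne_zero hx0 hy0) hz0) hH).resolve_left hn
  have h1 := hP hx hu
  have h2 := hP hy hz
  have hne := hT.ne_zero h1
  have e1 : 1 - x * (x * y * z)⁻¹ = -(1 - y * z) / (y * z) := by field_simp; ring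
  have h3 : -(y * z) = (1 - y * z) / (1 - x * (x * y * z)⁻¹) := by
    have := hT.ne_zero h2
    rw [e1]; field_simp
  rw [h3]; exact hT.div_mem h2 h1

/-- Over a field whose multiplicative group modulo `T` has odd exponent `p`, strong rigidity
outside `H` gives a rigid pair. -/
theorem isRigidPair_of_odd {p : ℕ} (hp : Odd p) (hT : IsMulSubgroup T) (hH : IsMulSubgroup H)
    (hTH : T ⊆ H) (hTp : ∀ x : K, x ≠ 0 → x ^ p ∈ T) (hr : IsRigidOutside T H) :
    IsRigidPair T H := by
  have h1 : (-1 : K) ∈ T := by simpa [hp.neg_one_pow] using hTp (-1) (by simp)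
  have hneg : ∀ {x}, -x ∈ T ↔ x ∈ T := fun {x} => by
    rw [← neg_one_mul]; exact hT.mul_mem_iff_left h1
  have hsq : ∀ {x}, x ≠ 0 → x ^ 2 ∈ H → x ∈ H := fun {x} hx h => by
    obtain ⟨k, hk⟩ := hp
    have h2 := hTH (hTp x hx)
    rw [hk, pow_succ, pow_mul] at h2
    exact (hH.mul_mem_iff_left (hH.pow_mem h k)).1 h2
  have hP : ∀ {x y}, x ∈ smallSet T H → y ∈ smallSet T H → 1 - x * y ∈ T := by
    intro x y hx hy
    have hx0 := hx.1
    have hy0 := hy.1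
    by_contra hn
    have hx' := (one_sub_mul_mem_or hT hH hTH hr hx hy).resolve_left hn
    have hy' := (one_sub_mul_mem_or hT hH hTH hr hy hx).resolve_left (by rwa [mul_comm])
    rw [mul_comm y x] at hy'
    have hne : 1 - x * y ≠ 0 := fun h0 => hT.zero_notMem (by rwa [h0, zero_div] at hx')
    have hyx : y / x ∈ T := by
      have := hT.div_mem hx' hy'
      have e : (1 - x * y) / x / ((1 - x * y) / y) = y / x := by field_simp
      rwa [e] at this
    by_cases hxy : x * y ∈ H
    · refine hx.2.1 (hsq hx0 ?_)
      have := hH.div_mem hxy (hTH hyx)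
      have e : x * y / (y / x) = x ^ 2 := by field_simp
      rwa [e] at this
    · rcases hr (-(x * y)) (neg_ne_zero.2 (mul_ne_zero hx0 hy0))
        (fun h => hxy (by simpa using hH.mul_mem (hTH h1) h)) with h | h
      · exact hn (by simpa [sub_eq_add_neg] using h)
      · have := hT.div_mem hx' h
        have e : (1 - x * y) / x / ((1 + -(x * y)) / -(x * y)) = -y := by
          rw [← sub_eq_add_neg]; field_simp
        rw [e, hneg] at this
        exact hy.2.1 (hTH this)
  have hR : ∀ {z}, z ≠ 0 → z ∉ H → z ∈ smallSet T H ∨ z⁻¹ ∈ smallSet T H := fun h h' =>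
    mem_smallSet_or_inv_mem hH (hTH h1) hr h h'
  refine ⟨hT, hH, hTH, hTH h1, hR, ?_, hP, ?_⟩
  · intro z hz
    refine ⟨neg_ne_zero.2 hz.1, fun h => hz.2.1 (by simpa using hH.mul_mem (hTH h1) h), ?_⟩
    have := hP hz hz
    have e : 1 - z * z = (1 - z) * (1 - -z) := by ring
    rwa [e, hT.mul_mem_iff_left hz.2.2] at this
  · intro x y z hx hy hz hxyz
    by_contra hn
    have hx0 := hx.1
    have hy0 := hy.1
    have hz0 := hz.1
    have h1 := hneg.1 (neg_mul_mem_of_notMem hT hR hP hx hy hz hxyz hn)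
    have e2 : y * x * z = x * y * z := by ring
    have h2 := hneg.1 (neg_mul_mem_of_notMem hT hR hP hy hx hz (by rwa [e2]) (by rwa [e2]))
    have e3 : z * x * y = x * y * z := by ring
    have h3 := hneg.1 (neg_mul_mem_of_notMem hT hR hP hz hx hy (by rwa [e3]) (by rwa [e3]))
    have := hT.div_mem (hT.mul_mem h3 h2) h1
    have e : x * y * (x * z) / (y * z) = x ^ 2 := by field_simp
    rw [e] at this
    exact hx.2.1 (hsq hx0 (hTH this))

/-- The subgroup generated by `T` and `a`. -/
def lineSpan (T : Set K) (a : K) : Set K := {x | x ≠ 0 ∧ ∃ n : ℤ, x / a ^ n ∈ T}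

theorem isMulSubgroup_lineSpan (hT : IsMulSubgroup T) {a : K} (ha : a ≠ 0) :
    IsMulSubgroup (lineSpan T a) where
  one_mem := ⟨one_ne_zero, 0, by simpa using hT.one_mem⟩
  mul_mem := by
    rintro x y ⟨hx, n, hn⟩ ⟨hy, m, hm⟩
    refine ⟨mul_ne_zero hx hy, n + m, ?_⟩
    have := hT.mul_mem hn hm
    rwa [zpow_add₀ ha, ← div_mul_div_comm]
  inv_mem := by
    rintro x ⟨hx, n, hn⟩
    refine ⟨inv_ne_zero hx, -n, ?_⟩
    have e : x⁻¹ / a ^ (-n) = (x / a ^ n)⁻¹ := by rw [zpow_neg]; field_simp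
    rw [e]; exact hT.inv_mem hn
  zero_notMem := fun h => h.1 rfl

theorem subset_lineSpan (hT : IsMulSubgroup T) (a : K) : T ⊆ lineSpan T a :=
  fun x hx => ⟨hT.ne_zero hx, 0, by simpa using hx⟩

theorem self_mem_lineSpan (hT : IsMulSubgroup T) {a : K} (ha : a ≠ 0) : a ∈ lineSpan T a :=
  ⟨ha, 1, by simpa [div_self ha] using hT.one_mem⟩

end Rigidity

section WeakRigidity

variable {K : Type*} [Field K] {T : Set K} {p : ℕ}

/-- `x` and `z` are independent in the multiplicative group modulo `T`, of exponent `p`. -/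
def IndepMod (p : ℕ) (T : Set K) (x z : K) : Prop :=
  x ≠ 0 ∧ z ≠ 0 ∧ ∀ m n : ℤ, x ^ m * z ^ n ∈ T → (p : ℤ) ∣ m ∧ (p : ℤ) ∣ n

theorem IndepMod.symm {x z : K} (h : IndepMod p T x z) : IndepMod p T z x :=
  ⟨h.2.1, h.1, fun m n hmn => (h.2.2 n m (by rwa [mul_comm])).symm⟩

theorem IndepMod.inv_left {x z : K} (h : IndepMod p T x z) : IndepMod p T x⁻¹ z :=
  ⟨inv_ne_zero h.1, h.2.1, fun m n hmn => by
    have := h.2.2 (-m) n (by rwa [zpow_neg, ← inv_zpow])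
    simpa using this⟩

theorem IndepMod.mul_right {x z : K} (h : IndepMod p T x z) : IndepMod p T x (x⁻¹ * z) :=
  ⟨h.1, mul_ne_zero (inv_ne_zero h.1) h.2.1, fun m n hmn => by
    have := h.2.2 (m - n) n (by
      have e : x ^ m * (x⁻¹ * z) ^ n = x ^ (m - n) * z ^ n := by
        rw [mul_zpow, inv_zpow, zpow_sub₀ h.1]; field_simp
      rwa [e] at hmn)
    refine ⟨?_, this.2⟩
    have h2 := dvd_add this.1 this.2
    simpa using h2⟩

theorem zpow_mem_of_dvd (hT : IsMulSubgroup T) (hTp : ∀ x : K, x ≠ 0 → x ^ p ∈ T) {x : K}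
    (hx : x ≠ 0) {n : ℤ} (hn : (p : ℤ) ∣ n) : x ^ n ∈ T := by
  obtain ⟨k, rfl⟩ := hn
  rw [zpow_mul]; exact hT.zpow_mem (by simpa using hTp x hx) k

theorem mem_of_zpow_mem (hp : p.Prime) (hT : IsMulSubgroup T)
    (hTp : ∀ x : K, x ≠ 0 → x ^ p ∈ T) {x : K}
    (hx : x ≠ 0) {n : ℤ} (hn : x ^ n ∈ T) (hpn : ¬ (p : ℤ) ∣ n) : x ∈ T := by
  obtain ⟨a, b, hab⟩ := ((Nat.prime_iff_prime_int.1 hp).coprime_iff_not_dvd.2 hpn)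
  have : x = (x ^ (p : ℤ)) ^ a * (x ^ n) ^ b := by
    rw [← zpow_mul, ← zpow_mul, ← zpow_add₀ hx, mul_comm (p : ℤ), mul_comm n, hab, zpow_one]
  rw [this]
  exact hT.mul_mem (hT.zpow_mem (by simpa using hTp x hx) _) (hT.zpow_mem hn _)

theorem indepMod_of_notMem_lineSpan (hp : p.Prime) (hT : IsMulSubgroup T)
    (hTp : ∀ x : K, x ≠ 0 → x ^ p ∈ T) {x z : K} (hx : x ≠ 0) (hxT : x ∉ T) (hz : z ≠ 0)
    (hzx : z ∉ lineSpan T x) : IndepMod p T x z := by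
  refine ⟨hx, hz, fun m n hmn => ?_⟩
  have hn : (p : ℤ) ∣ n := by
    by_contra hpn
    have hL := isMulSubgroup_lineSpan hT hx
    have h1 : z ^ n ∈ lineSpan T x := by
      refine (hL.mul_mem_iff_left (hL.zpow_mem (self_mem_lineSpan hT hx) m)).1 ?_
      exact subset_lineSpan hT x hmn
    exact hzx (mem_of_zpow_mem hp hL (fun y hy => subset_lineSpan hT x (hTp y hy)) hz h1 hpn)
  refine ⟨?_, hn⟩
  by_contra hpm
  have := (hT.mul_mem_iff_right (zpow_mem_of_dvd hT hTp hz hn)).1 hmn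
  exact hxT (mem_of_zpow_mem hp hT hTp hx this hpm)

/-- Weak rigidity: `1 - x` lies in the subgroup generated by `T` and `x`, for all `x ∉ T`. -/
def IsWeaklyRigid (T : Set K) : Prop :=
  ∀ x, x ≠ 0 → x ∉ T → ∃ n : ℤ, (1 - x) / x ^ n ∈ T

/-- `1 - x ∈ x ^ i T` with `i ≠ 0, 1` modulo `p` and `h = 1 - 1 / i`. -/
def HasSlope (p : ℕ) (T : Set K) (x : K) (h : ZMod p) : Prop :=
  ∃ i : ℤ, (1 - x) / x ^ i ∈ T ∧ (i : ZMod p) ≠ 0 ∧ (i : ZMod p) ≠ 1 ∧ h = 1 - (i : ZMod p)⁻¹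

variable [Fact p.Prime]

theorem HasSlope.ne_one {x : K} {h : ZMod p} (hx : HasSlope p T x h) : h ≠ 1 := by
  obtain ⟨i, -, h0, h1, rfl⟩ := hx
  simpa using h0

theorem HasSlope.inv (hT : IsMulSubgroup T) (h1 : (-1 : K) ∈ T) {x : K} (hx : x ≠ 0)
    {h : ZMod p} (hh : HasSlope p T x h) : HasSlope p T x⁻¹ h⁻¹ := by
  obtain ⟨i, hi, hi0, hi1, rfl⟩ := hh
  refine ⟨1 - i, ?_, ?_, ?_, ?_⟩
  · have e : (1 - x⁻¹) / x⁻¹ ^ (1 - i) = -1 * ((1 - x) / x ^ i) := by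
      rw [inv_zpow', neg_sub, zpow_sub_one₀ hx]; field_simp; ring
    rw [e]; exact hT.mul_mem h1 hi
  · push_cast; intro h; exact hi1 (sub_eq_zero.1 h).symm
  · push_cast; simpa using hi0
  · push_cast
    have : (1 - (i : ZMod p)) ≠ 0 := fun h => hi1 (sub_eq_zero.1 h).symm
    have h2 : ((i : ZMod p) - 1) ≠ 0 := sub_ne_zero.2 hi1
    have e1 : 1 - (i : ZMod p)⁻¹ = (i - 1) / i := by field_simp
    have e2 : 1 - (1 - (i : ZMod p))⁻¹ = i / (i - 1) := by
      rw [← neg_sub (i : ZMod p) 1, inv_neg]; field_simp; ring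
    rw [e1, e2, inv_div]

theorem HasSlope.mul (hT : IsMulSubgroup T) (hw : IsWeaklyRigid T) {x z : K}
    (hxz : IndepMod p T x z)
    (h1 : (-1 : K) ∈ T) {h g : ZMod p} (hh : HasSlope p T x h) (hg : HasSlope p T z g) :
    HasSlope p T (x * z) (h * g) := by
  obtain ⟨i, hi, hi0, hi1, rfl⟩ := hh
  obtain ⟨j, hj, hj0, hj1, rfl⟩ := hg
  obtain ⟨hx0, hz0, hind⟩ := hxz
  have hp1 : ¬ (p : ℤ) ∣ 1 := by
    rw [Int.natCast_dvd]; exact (Fact.out : p.Prime).one_lt.ne' ∘ Nat.dvd_one.1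
  have hxz0 := mul_ne_zero hx0 hz0
  have hx1 : 1 - x ≠ 0 := fun h0 => hT.zero_notMem (by rwa [h0, zero_div] at hi)
  have hz1 : 1 - z ≠ 0 := fun h0 => hT.zero_notMem (by rwa [h0, zero_div] at hj)
  have hxzT : x * z ∉ T := fun hm => hp1 (hind 1 1 (by simpa using hm)).1
  obtain ⟨k, hk⟩ := hw _ hxz0 hxzT
  set w := -(x * ((1 - z) / (1 - x))) with hwdef
  have hw0 : w ≠ 0 := neg_ne_zero.2 (mul_ne_zero hx0 (div_ne_zero hz1 hx1))
  -- `w` is congruent to `x ^ (1 - i) * z ^ j`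
  have hwc : w / (x ^ (1 - i) * z ^ j) ∈ T := by
    have := hT.mul_mem h1 (hT.div_mem hj hi)
    have e : w / (x ^ (1 - i) * z ^ j) = -1 * ((1 - z) / z ^ j / ((1 - x) / x ^ i)) := by
      rw [hwdef, zpow_sub₀ hx0, zpow_one]; field_simp
    rwa [e]
  have hwT : w ∉ T := fun hm => by
    have := hT.div_mem hm hwc
    rw [div_div_cancel₀ hw0] at this
    exact hj0 ((ZMod.intCast_zmod_eq_zero_iff_dvd _ _).2 (hind _ _ this).2)
  obtain ⟨m, hm⟩ := hw _ hw0 hwT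
  have hcomb : x ^ (k - i - (1 - i) * m) * z ^ (k - j * m) ∈ T := by
    have := hT.mul_mem (hT.mul_mem (hT.mul_mem hi hm) (hT.zpow_mem hwc m)) (hT.inv_mem hk)
    have hk1 : 1 - x * z ≠ 0 := fun h0 => hT.zero_notMem (by rwa [h0, zero_div] at hk)
    have e0 : 1 - w = (1 - x * z) / (1 - x) := by rw [hwdef]; field_simp; ring
    have e : (1 - x) / x ^ i * ((1 - w) / w ^ m) * (w / (x ^ (1 - i) * z ^ j)) ^ m *
        ((1 - x * z) / (x * z) ^ k)⁻¹ = x ^ (k - i - (1 - i) * m) * z ^ (k - j * m) := by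
      rw [e0, div_zpow, mul_zpow, mul_zpow, ← zpow_mul, ← zpow_mul, zpow_sub₀ hx0, zpow_sub₀ hx0,
        zpow_sub₀ hz0]
      field_simp
    rwa [e] at this
  obtain ⟨h3, h4⟩ := hind _ _ hcomb
  rw [← ZMod.intCast_zmod_eq_zero_iff_dvd] at h3 h4
  push_cast at h3 h4
  set I := (i : ZMod p)
  set J := (j : ZMod p)
  set M := (m : ZMod p)
  have hkJ : (k : ZMod p) = J * M := sub_eq_zero.1 h4
  have hM : M * (I + J - 1) = I := by rw [hkJ] at h3; linear_combination h3
  have hM0 : M ≠ 0 := fun h0 => hi0 (by rw [← hM, h0, zero_mul])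
  refine ⟨k, hk, ?_, ?_, ?_⟩
  · rw [hkJ]; exact mul_ne_zero hj0 hM0
  · rw [hkJ]
    intro h5
    have : (I - 1) * (J - 1) * M = 0 := by linear_combination (-1) * hM + I * h5
    simp [sub_eq_zero, hi1, hj1, hM0] at this
  · rw [hkJ]
    field_simp
    linear_combination (-1) * hM

theorem not_hasSlope_of_indepMod (hT : IsMulSubgroup T) (hw : IsWeaklyRigid T)
    (h1 : (-1 : K) ∈ T) {x z : K} (hxz : IndepMod p T x z) {h k : ZMod p}
    (hx : HasSlope p T x h) (hz : HasSlope p T z k) : False := by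
  have hne : ∀ {x : K} {h : ZMod p}, HasSlope p T x h → h ≠ 0 := by
    rintro x h ⟨i, -, h0, h1, rfl⟩ h2
    apply h1
    exact inv_eq_one.1 (sub_eq_zero.1 h2).symm
  obtain ⟨g, hg⟩ := IsCyclic.exists_generator (α := (ZMod p)ˣ)
  have hlog : ∀ h : ZMod p, h ≠ 0 → ∃ n : ℕ, h = (g : ZMod p) ^ n := by
    intro h hh
    obtain ⟨n, hn⟩ := mem_powers_iff_mem_zpowers.2 (hg (Units.mk0 h hh))
    exact ⟨n, by simpa using (congrArg Units.val hn).symm⟩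
  have main : ∀ s a b : ℕ, a + b ≤ s → ∀ {x z : K}, IndepMod p T x z →
      HasSlope p T x ((g : ZMod p) ^ a) → HasSlope p T z ((g : ZMod p) ^ b) → False := by
    intro s
    induction s with
    | zero =>
      intro a b hab x z _ hx _
      obtain rfl : a = 0 := by omega
      exact hx.ne_one (pow_zero _)
    | succ s ih =>
      intro a b hab x z hxz hx hz
      rcases Nat.eq_zero_or_pos a with rfl | ha
      · exact hx.ne_one (pow_zero _)
      rcases Nat.eq_zero_or_pos b with rfl | hb
      · exact hz.ne_one (pow_zero _)
      have key : ∀ {x z : K} {a b : ℕ}, a ≤ b → IndepMod p T x z →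
          HasSlope p T x ((g : ZMod p) ^ a) → HasSlope p T z ((g : ZMod p) ^ b) →
          HasSlope p T (x⁻¹ * z) ((g : ZMod p) ^ (b - a)) := by
        intro x z a b hab hxz hx hz
        have := (hx.inv hT h1 hxz.1).mul hT hw hxz.inv_left h1 hz
        rwa [pow_sub₀ _ g.ne_zero hab, mul_comm ((g : ZMod p) ^ b)]
      rcases le_total a b with hle | hle
      · exact ih a (b - a) (by omega) hxz.mul_right hx (key hle hxz hx hz)
      · exact ih b (a - b) (by omega) hxz.symm.mul_right hz (key hle hxz.symm hz hx)
  obtain ⟨a, rfl⟩ := hlog h (hne hx)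
  obtain ⟨b, rfl⟩ := hlog k (hne hz)
  exact main _ a b le_rfl hxz hx hz

/-- A weakly rigid subgroup of odd prime exponent is part of a rigid pair, unless the quotient
of the multiplicative group is cyclic. -/
theorem exists_isRigidPair_of_odd (hp : Odd p) (hT : IsMulSubgroup T)
    (hTp : ∀ x : K, x ≠ 0 → x ^ p ∈ T) (hw : IsWeaklyRigid T) :
    ∃ a : K, a ≠ 0 ∧ IsRigidPair T (lineSpan T a) := by
  have hpr : p.Prime := Fact.out
  have h1 : (-1 : K) ∈ T := by simpa [hp.neg_one_pow] using hTp (-1) (by simp)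
  have hslope : ∀ z : K, z ≠ 0 → z ∉ T → ¬ (1 + z ∈ T ∨ (1 + z) / z ∈ T) →
      ∃ h, HasSlope p T (-z) h := by
    intro z hz hzT hn
    rw [not_or] at hn
    have hz' : -z ∉ T := fun h => hzT (by simpa using hT.mul_mem h1 h)
    obtain ⟨i, hi⟩ := hw (-z) (neg_ne_zero.2 hz) hz'
    refine ⟨_, i, hi, fun h0 => hn.1 ?_, fun h0 => hn.2 ?_, rfl⟩
    · rw [ZMod.intCast_zmod_eq_zero_iff_dvd] at h0
      have := hT.mul_mem hi (zpow_mem_of_dvd hT hTp (neg_ne_zero.2 hz) h0)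
      rw [div_mul_cancel₀ _ (zpow_ne_zero _ (neg_ne_zero.2 hz))] at this
      simpa using this
    · have h2 : (p : ℤ) ∣ i - 1 := by
        rw [← ZMod.intCast_zmod_eq_zero_iff_dvd]; push_cast; rw [h0, sub_self]
      have := hT.mul_mem hi (zpow_mem_of_dvd hT hTp (neg_ne_zero.2 hz) h2)
      have e : (1 - -z) / (-z) ^ i * (-z) ^ (i - 1) = -1 * ((1 + z) / z) := by
        have := zpow_ne_zero i (neg_ne_zero.2 hz)
        rw [zpow_sub_one₀ (neg_ne_zero.2 hz)]; field_simp; ring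
      rwa [e, hT.mul_mem_iff_left h1] at this
  by_cases hex : ∃ z : K, z ≠ 0 ∧ z ∉ T ∧ ¬ (1 + z ∈ T ∨ (1 + z) / z ∈ T)
  · obtain ⟨a, ha, haT, han⟩ := hex
    have ha' : -a ∉ T := fun h => haT (by simpa using hT.mul_mem h1 h)
    have hL := isMulSubgroup_lineSpan hT (neg_ne_zero.2 ha)
    have hLT := subset_lineSpan hT (-a)
    refine ⟨-a, neg_ne_zero.2 ha,
      isRigidPair_of_odd hp hT hL hLT hTp fun z hz hzL => ?_⟩
    by_contra hn
    obtain ⟨h, hh⟩ := hslope a ha haT han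
    obtain ⟨k, hk⟩ := hslope z hz (fun h => hzL (hLT h)) hn
    refine not_hasSlope_of_indepMod hT hw h1
      (indepMod_of_notMem_lineSpan hpr hT hTp (neg_ne_zero.2 ha) ha' (neg_ne_zero.2 hz) ?_) hh hk
    exact fun hm => hzL (by simpa using hL.mul_mem (hLT h1) hm)
  · push Not at hex
    have hLT := subset_lineSpan hT (1 : K)
    refine ⟨1, one_ne_zero, isRigidPair_of_odd hp hT (isMulSubgroup_lineSpan hT one_ne_zero)
      hLT hTp fun z hz hzL => ?_⟩
    exact hex z hz fun h => hzL (hLT h)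

end WeakRigidity

section Dyadic

variable {K : Type*} [Field K] {T H : Set K}

theorem isRigidPair_of_mul_stable (hT : IsMulSubgroup T) (hH : IsMulSubgroup H) (hTH : T ⊆ H)
    (h1 : (-1 : K) ∈ H) (hr : IsRigidOutside T H) {e : K} (heH : e ∈ H) (heT : e ∉ T)
    (hmul : ∀ {z}, z ∈ smallSet T H → e * z ∈ smallSet T H)
    (hdiv : ∀ {z}, z ∈ smallSet T H → e⁻¹ * z ∈ smallSet T H)
    (hneg : ∀ {z}, z ∈ smallSet T H → -z ∈ smallSet T H) : IsRigidPair T H := by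
  have he0 := hH.ne_zero heH
  have hR : ∀ {z}, z ≠ 0 → z ∉ H → z ∈ smallSet T H ∨ z⁻¹ ∈ smallSet T H := fun h h' =>
    mem_smallSet_or_inv_mem hH h1 hr h h'
  have hP : ∀ {x y}, x ∈ smallSet T H → y ∈ smallSet T H → 1 - x * y ∈ T := by
    intro x y hx hy
    have hx0 := hx.1
    by_contra hn
    have h2 := (one_sub_mul_mem_or hT hH hTH hr hx hy).resolve_left hn
    have e1 : e * x * (e⁻¹ * y) = x * y := by field_simp
    have h3 := (one_sub_mul_mem_or hT hH hTH hr (hmul hx) (hdiv hy)).resolve_left (by rwa [e1])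
    rw [e1] at h3
    have hne : 1 - x * y ≠ 0 := fun h0 => hT.zero_notMem (by rwa [h0, zero_div] at h2)
    have h4 := hT.div_mem h2 h3
    have e2 : (1 - x * y) / x / ((1 - x * y) / (e * x)) = e := by field_simp
    rw [e2] at h4
    exact heT h4
  refine ⟨hT, hH, hTH, h1, hR, hneg, hP, ?_⟩
  intro x y z hx hy hz hxyz
  by_contra hn
  have h2 := neg_mul_mem_of_notMem hT hR hP hx hy hz hxyz hn
  have e1 : x * (e * y) * z = e * (x * y * z) := by ring
  have h3 := neg_mul_mem_of_notMem hT hR hP hx (hmul hy) hz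
    (by rwa [e1, hH.mul_mem_iff_left heH])
    (fun h => hn (by
      have := hdiv h
      rwa [e1, inv_mul_cancel_left₀ he0] at this))
  have e2 : -(e * y * z) = e * -(y * z) := by ring
  rw [e2, hT.mul_mem_iff_right h2] at h3
  exact heT h3

/-- If `T` contains `-1` and all squares and every element outside `T` is rigid, then `T` is part
of a rigid pair. -/
theorem exists_isRigidPair_of_neg_one_mem (hT : IsMulSubgroup T)
    (hsq : ∀ x : K, x ≠ 0 → x ^ 2 ∈ T) (h1 : (-1 : K) ∈ T) (hr : IsRigidOutside T T) :
    ∃ a : K, a ≠ 0 ∧ IsRigidPair T (lineSpan T a) := by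
  have hnegT : ∀ {x}, -x ∈ T ↔ x ∈ T := fun {x} => by
    rw [← neg_one_mul]; exact hT.mul_mem_iff_left h1
  have hR : ∀ {z}, z ≠ 0 → z ∉ T → z ∈ smallSet T T ∨ z⁻¹ ∈ smallSet T T := fun h h' =>
    mem_smallSet_or_inv_mem hT h1 hr h h'
  have hsqi : ∀ {x y : K}, x ≠ 0 → x * y ∈ T → x⁻¹ * y ∈ T := fun {x y} hx h => by
    have := hT.div_mem h (hsq x hx)
    have e : x * y / x ^ 2 = x⁻¹ * y := by field_simp
    rwa [e] at this
  have hprod : ∀ {x y}, x ∈ smallSet T T → y ∈ smallSet T T → x * y ∉ T →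
      x * y ∈ smallSet T T := by
    intro x y hx hy hxy
    have hx0 := hx.1
    have hy0 := hy.1
    refine ⟨mul_ne_zero hx0 hy0, hxy, ?_⟩
    by_contra hn
    have h2 := (one_sub_mul_mem_or hT hT subset_rfl hr hx hy).resolve_left hn
    have hne : 1 - x * y ≠ 0 := fun h0 => hT.zero_notMem (by rwa [h0, zero_div] at h2)
    rcases hr (-(x * y)) (neg_ne_zero.2 (mul_ne_zero hx0 hy0)) (by rwa [hnegT]) with h | h
    · exact hn (by simpa [sub_eq_add_neg] using h)
    · have := hT.div_mem h2 h
      have e : (1 - x * y) / x / ((1 + -(x * y)) / -(x * y)) = -y := by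
        rw [← sub_eq_add_neg]; field_simp
      rw [e, hnegT] at this
      exact hy.2.1 this
  have hninv : ∀ {x}, x ∈ smallSet T T → x⁻¹ ∉ smallSet T T := by
    intro x hx hx'
    have hx0 := hx.1
    have h2 := hT.ne_zero hx.2.2
    have := hT.div_mem hx.2.2 hx'.2.2
    have h3 := hT.ne_zero hx'.2.2
    have e : (1 - x) / (1 - x⁻¹) = -x := by
      rw [div_eq_iff h3]; field_simp; ring
    rw [e, hnegT] at this
    exact hx.2.1 this
  have hext : ∀ {H : Set K}, T ⊆ H → ∀ {z}, z ∈ smallSet T H → z ∈ smallSet T T :=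
    fun hTH z hz => ⟨hz.1, fun h => hz.2.1 (hTH h), hz.2.2⟩
  have hrH : ∀ {H : Set K}, T ⊆ H → IsRigidOutside T H :=
    fun hTH z hz hzH => hr z hz fun h => hzH (hTH h)
  by_cases hbad : ∃ e ∈ smallSet T T, -e ∉ smallSet T T
  · obtain ⟨e, he, hen⟩ := hbad
    have he0 := he.1
    have hH := isMulSubgroup_lineSpan hT he0
    have hTH := subset_lineSpan hT e
    have heH := self_mem_lineSpan hT he0
    have hei : -e⁻¹ ∈ smallSet T T := by
      rw [← inv_neg]
      exact (hR (neg_ne_zero.2 he0) (by rw [hnegT]; exact he.2.1)).resolve_left hen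
    have hneg1 : (-1 : K) ∈ lineSpan T e := hTH h1
    have hmul : ∀ {z}, z ∈ smallSet T (lineSpan T e) → e * z ∈ smallSet T (lineSpan T e) := by
      intro z hz
      have h2 : e * z ∉ lineSpan T e := by rw [hH.mul_mem_iff_left heH]; exact hz.2.1
      have := hprod he (hext hTH hz) fun h => h2 (hTH h)
      exact ⟨this.1, h2, this.2.2⟩
    have hneg : ∀ {z}, z ∈ smallSet T (lineSpan T e) → -z ∈ smallSet T (lineSpan T e) := by
      intro z hz
      have h2 : -z ∉ lineSpan T e := by
        rw [← neg_one_mul, hH.mul_mem_iff_left hneg1]; exact hz.2.1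
      by_contra hn
      have h3 : -z ∉ smallSet T T := fun h => hn ⟨h.1, h2, h.2.2⟩
      have h4 : -z⁻¹ ∈ smallSet T T := by
        rw [← inv_neg]
        exact (hR (neg_ne_zero.2 hz.1) fun h => h2 (hTH h)).resolve_left h3
      have hz0 := hz.1
      have h5 := hprod he h4 (fun h => hz.2.1 (by
        have := hH.div_mem heH (hTH h)
        have e1 : e / (e * -z⁻¹) = -1 * z := by field_simp
        rwa [e1, hH.mul_mem_iff_left hneg1] at this))
      have h6 := hprod (hext hTH hz) hei (fun h => hz.2.1 (by
        have := hH.mul_mem heH (hTH h)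
        have e1 : e * (z * -e⁻¹) = -1 * z := by field_simp
        rwa [e1, hH.mul_mem_iff_left hneg1] at this))
      refine hninv h5 ?_
      have e1 : (e * -z⁻¹)⁻¹ = z * -e⁻¹ := by
        rw [mul_inv, inv_neg, inv_inv]; ring
      rwa [e1]
    have hdiv : ∀ {z}, z ∈ smallSet T (lineSpan T e) → e⁻¹ * z ∈ smallSet T (lineSpan T e) := by
      intro z hz
      have h2 : e⁻¹ * z ∉ lineSpan T e := by
        rw [hH.mul_mem_iff_left (hH.inv_mem heH)]; exact hz.2.1
      have e1 : -e⁻¹ * -z = e⁻¹ * z := by ring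
      have := hprod hei (hext hTH (hneg hz)) (by rw [e1]; exact fun h => h2 (hTH h))
      rw [e1] at this
      exact ⟨this.1, h2, this.2.2⟩
    exact ⟨e, he0, isRigidPair_of_mul_stable hT hH hTH hneg1 (hrH hTH) heH he.2.1 hmul hdiv hneg⟩
  push Not at hbad
  by_cases hst : ∃ e : K, e ≠ 0 ∧ e ∉ T ∧
      (∀ z, z ∈ smallSet T (lineSpan T e) → e * z ∈ smallSet T (lineSpan T e)) ∧
      (∀ z, z ∈ smallSet T (lineSpan T e) → e⁻¹ * z ∈ smallSet T (lineSpan T e))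
  · obtain ⟨e, he0, heT, hmul, hdiv⟩ := hst
    have hH := isMulSubgroup_lineSpan hT he0
    have hTH := subset_lineSpan hT e
    refine ⟨e, he0, isRigidPair_of_mul_stable hT hH hTH (hTH h1) (hrH hTH)
      (self_mem_lineSpan hT he0) heT (hmul _) (hdiv _) ?_⟩
    intro z hz
    have := hbad z (hext hTH hz)
    exact ⟨this.1, by rw [← neg_one_mul, hH.mul_mem_iff_left (hTH h1)]; exact hz.2.1, this.2.2⟩
  have hfac : ∀ e ∈ smallSet T T, ∃ w ∈ smallSet T T, w⁻¹ * e ∈ smallSet T T := by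
    intro e he
    by_contra hn
    push Not at hn
    have he0 := he.1
    have hH := isMulSubgroup_lineSpan hT he0
    have hTH := subset_lineSpan hT e
    have heH := self_mem_lineSpan hT he0
    refine hst ⟨e, he0, he.2.1, fun z hz => ?_, fun z hz => ?_⟩
    · have h2 : e * z ∉ lineSpan T e := by rw [hH.mul_mem_iff_left heH]; exact hz.2.1
      have := hprod he (hext hTH hz) fun h => h2 (hTH h)
      exact ⟨this.1, h2, this.2.2⟩
    · have h2 : e⁻¹ * z ∉ lineSpan T e := by
        rw [hH.mul_mem_iff_left (hH.inv_mem heH)]; exact hz.2.1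
      have h3 := hn z (hext hTH hz)
      have h4 := (hR (mul_ne_zero (inv_ne_zero he0) hz.1) fun h => h2 (hTH h)).resolve_right
        (by rw [mul_inv, inv_inv, mul_comm]; exact h3)
      exact ⟨h4.1, h2, h4.2.2⟩
  have hL : lineSpan T (1 : K) = T :=
    (subset_lineSpan hT 1).antisymm' (by rintro x ⟨hx, n, hn⟩; simpa using hn)
  have hP : ∀ {x y}, x ∈ smallSet T T → y ∈ smallSet T T → 1 - x * y ∈ T := by
    intro x y hx hy
    by_cases hxy : x * y ∈ T
    · by_contra hn
      have hx0 := hx.1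
      have h2 := (one_sub_mul_mem_or hT hT subset_rfl hr hx hy).resolve_left hn
      have hne : 1 - x * y ≠ 0 := fun h0 => hT.zero_notMem (by rwa [h0, zero_div] at h2)
      obtain ⟨w, hw, hxw⟩ := hfac x hx
      have hw0 := hw.1
      have h3 := hprod hxw hy (fun h => hw.2.1 (by
        have := hT.div_mem hxy h
        have hy0 := hy.1
        have e : x * y / (w⁻¹ * x * y) = w := by field_simp
        rwa [e] at this))
      have e1 : w * (w⁻¹ * x * y) = x * y := by field_simp
      have h4 := (one_sub_mul_mem_or hT hT subset_rfl hr hw h3).resolve_left (by rwa [e1])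
      rw [e1] at h4
      have h5 := hT.div_mem h4 h2
      have e2 : (1 - x * y) / w / ((1 - x * y) / x) = w⁻¹ * x := by field_simp
      rw [e2] at h5
      exact hxw.2.1 h5
    · exact (hprod hx hy hxy).2.2
  refine ⟨1, one_ne_zero, ?_⟩
  rw [hL]
  refine ⟨hT, hT, subset_rfl, h1, hR, fun hz => hbad _ hz, hP, ?_⟩
  intro x y z hx hy hz hxyz
  by_contra hn
  have hx0 := hx.1
  have hyz := hnegT.1 (neg_mul_mem_of_notMem hT hR hP hx hy hz hxyz hn)
  obtain ⟨w, hw, hxw⟩ := hfac x hx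
  have hw0 := hw.1
  have e2 : y * x * z = x * y * z := by ring
  have hxz := hnegT.1 (neg_mul_mem_of_notMem hT hR hP hy hx hz (by rwa [e2]) (by rwa [e2]))
  have h2 : w⁻¹ * x * y ∈ smallSet T T := by
    refine hprod hxw hy fun h => hw.2.1 ?_
    have hxy : x * y ∈ T := by
      have e3 : z * x * y = x * y * z := by ring
      exact hnegT.1 (neg_mul_mem_of_notMem hT hR hP hz hx hy (by rwa [e3]) (by rwa [e3]))
    have := hT.div_mem hxy h
    have hy0 := hy.1
    have e : x * y / (w⁻¹ * x * y) = w := by field_simp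
    rwa [e] at this
  have h3 : w⁻¹ * x * y * z ∈ smallSet T T := by
    refine hprod h2 hz fun h => hxw.2.1 ?_
    rw [mul_assoc (w⁻¹ * x), hT.mul_mem_iff_right hyz] at h
    exact h
  have e4 : w * (w⁻¹ * x * y * z) = x * y * z := by field_simp
  have h4 := hprod hw h3 (by rwa [e4])
  rw [e4] at h4
  exact hn h4

/-- A variant of `exists_isRigidPair_of_neg_one_mem` when `-1` does not lie in `T`. -/
theorem isRigidPair_of_neg_one_notMem (hT : IsMulSubgroup T) (h1 : (-1 : K) ∉ T)
    (hr : ∀ z, z ≠ 0 → z ∉ T → 1 - z ∈ T ∨ (1 - z) / z ∈ T ∨ -(1 - z) / z ∈ T)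
    (hadd : ∀ x ∈ T, ∀ y ∈ T, x + y ≠ 0 → x + y ∈ T ∨ -(x + y) ∈ T)
    (h0 : ∃ x ∈ T, ∃ y ∈ T, 1 + x + y = 0) : IsRigidPair T (lineSpan T (-1)) := by
  have hn0 : (-1 : K) ≠ 0 := by simp
  have hH := isMulSubgroup_lineSpan hT hn0
  have hTH := subset_lineSpan hT (-1 : K)
  have h1H := self_mem_lineSpan hT hn0
  have hneg : ∀ {x}, -x ∈ lineSpan T (-1 : K) ↔ x ∈ lineSpan T (-1 : K) := fun {x} => by
    rw [neg_eq_neg_one_mul x]; exact hH.mul_mem_iff_left h1H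
  have hrig : IsRigidOutside T (lineSpan T (-1 : K)) := by
    intro z hz hzH
    rcases hr (-z) (neg_ne_zero.2 hz) (fun h => hzH (hneg.1 (hTH h))) with h | h | h
    · left; simpa using h
    · exfalso
      set t := (1 - -z) / -z with ht
      have e : z * (1 + t) = -1 := by rw [ht]; field_simp; ring
      have ht0 : 1 + t ≠ 0 := by rintro h0; rw [h0] at e; simp at e
      have : 1 + t ∈ lineSpan T (-1 : K) := by
        rcases hadd 1 hT.one_mem t h ht0 with h | h
        · exact hTH h
        · exact hneg.1 (hTH h)
      exact hzH ((hH.mul_mem_iff_right this).1 (by rwa [e]))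
    · right
      have e : -(1 - -z) / -z = (1 + z) / z := by rw [neg_div_neg_eq, sub_neg_eq_add]
      rwa [e] at h
  have step : ∀ z, z ≠ 0 → z ∉ lineSpan T (-1 : K) → ∀ u ∈ T, ∀ v ∈ T, ∀ w ∈ T,
      u + v + w = 0 → 1 + z * u ∈ T → 1 - z * w ∈ T := by
    intro z hz hzH u hu v hv w hw huvw h2
    have hq := hT.div_mem hv h2
    have h20 := hT.ne_zero h2
    have hv0 := hT.ne_zero hv
    have hw0 := hT.ne_zero hw
    have e : (1 + z * u) * (1 + z * (v / (1 + z * u))) = 1 - z * w := by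
      field_simp; linear_combination z * huvw
    rcases hrig (z * (v / (1 + z * u))) (mul_ne_zero hz (hT.ne_zero hq))
      (fun h => hzH ((hH.mul_mem_iff_right (hTH hq)).1 h)) with h | h
    · rw [← e]; exact hT.mul_mem h2 h
    · have h3 : (1 - z * w) / z ∈ T := by
        have := hT.mul_mem hv h
        have e2 : v * ((1 + z * (v / (1 + z * u))) / (z * (v / (1 + z * u)))) =
          (1 - z * w) / z := by rw [← e]; field_simp
        rwa [e2] at this
      have hne : 1 - z * w ≠ 0 := fun h0 => hT.zero_notMem (by rwa [h0, zero_div] at h3)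
      rcases hrig (-(z * w)) (neg_ne_zero.2 (mul_ne_zero hz hw0))
        (fun h => hzH ((hH.mul_mem_iff_right (hTH hw)).1 (hneg.1 h))) with h | h
      · simpa [sub_eq_add_neg] using h
      · exfalso
        have h4 := hT.div_mem (hT.mul_mem h hw) h3
        have e2 : (1 + -(z * w)) / -(z * w) * w / ((1 - z * w) / z) = -1 := by
          rw [← sub_eq_add_neg]; field_simp
        rw [e2] at h4
        exact h1 h4
  have hnegA : ∀ {z}, z ∈ smallSet T (lineSpan T (-1 : K)) →
      -z ∈ smallSet T (lineSpan T (-1 : K)) := by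
    rintro z ⟨hz0, hzH, hz1⟩
    obtain ⟨x, hx, y, hy, hxy⟩ := h0
    have hzH' : -z ∉ lineSpan T (-1 : K) := fun h => hzH (hneg.1 h)
    have hz0' := neg_ne_zero.2 hz0
    refine ⟨hz0', hzH', ?_⟩
    have s1 := step (-z) hz0' hzH' 1 hT.one_mem y hy x hx (by linear_combination hxy)
      (by simpa [sub_eq_add_neg] using hz1)
    have s2 := step z hz0 hzH x hx 1 hT.one_mem y hy (by linear_combination hxy)
      (by simpa using s1)
    have s3 := step (-z) hz0' hzH' y hy x hx 1 hT.one_mem (by linear_combination hxy)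
      (by simpa [sub_eq_add_neg] using s2)
    simpa using s3
  have hmul : ∀ {z}, z ∈ smallSet T (lineSpan T (-1 : K)) →
      -1 * z ∈ smallSet T (lineSpan T (-1 : K)) := fun hz => by
    rw [neg_one_mul]; exact hnegA hz
  refine isRigidPair_of_mul_stable hT hH hTH h1H hrig h1H h1 hmul ?_ hnegA
  intro z hz
  have e : (-1 : K)⁻¹ = -1 := by norm_num
  rw [e]; exact hmul hz

end Dyadic

section Conjugacy

variable {F M : Type*} [Field F] [Field M] [Algebra F M]

open Polynomial in
theorem exists_mem_and_mul_mem_of_isAlgebraic (O : ValuationSubring F) {x : M}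
    (hx : IsAlgebraic F x) : ∃ y : M,
      (∀ V : ValuationSubring M, O ≤ V.comap (algebraMap F M) → y ∈ V ∧ x * y ∈ V) ∧
      ∀ V : ValuationSubring M, V.comap (algebraMap F M) = O → x ∈ V → y ≠ 0 ∧ y⁻¹ ∈ V := by
  rcases eq_or_ne x 0 with rfl | hx0
  · exact ⟨1, fun V _ => ⟨V.one_mem, by simp⟩,
      fun V _ _ => ⟨one_ne_zero, by simp⟩⟩
  obtain ⟨f, hf0, hf⟩ := hx
  obtain ⟨j, hj, hmax⟩ := f.support.exists_max_image
    (fun i => toLex (O.valuation (f.coeff i), i)) (support_nonempty.2 hf0)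
  have hj0 : f.coeff j ≠ 0 := mem_support_iff.1 hj
  set b : ℕ → F := fun i => f.coeff i / f.coeff j with hb
  have hle : ∀ i, O.valuation (f.coeff i) < O.valuation (f.coeff j) ∨
      O.valuation (f.coeff i) = O.valuation (f.coeff j) ∧ i ≤ j := by
    intro i
    by_cases hi : f.coeff i = 0
    · left; rw [hi, map_zero]; exact zero_lt_iff.2 ((_root_.map_ne_zero _).2 hj0)
    · exact (Prod.Lex.toLex_le_toLex).1 (hmax i (mem_support_iff.2 hi))
  have hvj : 0 < O.valuation (f.coeff j) := zero_lt_iff.2 ((_root_.map_ne_zero _).2 hj0)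
  have hbO : ∀ i, b i ∈ O := fun i => by
    rw [← O.valuation_le_one_iff, hb, map_div₀]
    refine div_le_one_of_le₀ ?_ zero_le
    rcases hle i with h | h
    exacts [h.le, h.1.le]
  have hbm : ∀ i, j < i → O.valuation (b i) < 1 := fun i hi => by
    rw [hb, map_div₀, div_lt_one₀ hvj]
    exact (hle i).resolve_right fun h => absurd h.2 (not_le.2 hi)
  have hbj : b j = 1 := div_self hj0
  set n := f.natDegree
  have hjn : j ≤ n := le_natDegree_of_mem_supp _ hj
  set y : M := ∑ i ∈ Finset.Ico j (n + 1), algebraMap F M (b i) * x ^ (i - j) with hy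
  set w : M := ∑ i ∈ Finset.range j, algebraMap F M (b i) * x ^ i with hw
  have hyw : x ^ j * y + w = 0 := by
    have h1 : ∑ i ∈ Finset.range (n + 1), algebraMap F M (b i) * x ^ i = 0 := by
      have := hf
      rw [aeval_eq_sum_range] at this
      simp_rw [Algebra.smul_def] at this
      rw [hb]
      simp_rw [map_div₀, div_mul_eq_mul_div]
      rw [← Finset.sum_div, this, zero_div]
    rw [← Finset.sum_range_add_sum_Ico _ (show j ≤ n + 1 by omega)] at h1
    rw [hy, hw, Finset.mul_sum, add_comm, ← h1]
    congr 1
    refine Finset.sum_congr rfl fun i hi => ?_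
    rw [mul_left_comm, ← pow_add, Nat.add_sub_cancel' (Finset.mem_Ico.1 hi).1]
  have hyx : y = -∑ i ∈ Finset.range j, algebraMap F M (b i) * x⁻¹ ^ (j - i) := by
    have : y = -w / x ^ j := by
      rw [eq_div_iff (pow_ne_zero _ hx0)]; linear_combination hyw
    rw [this, neg_div, hw, Finset.sum_div]
    congr 1
    refine Finset.sum_congr rfl fun i hi => ?_
    rw [mul_div_assoc, inv_pow, pow_sub₀ _ hx0 (Finset.mem_range.1 hi).le]
    field_simp
  refine ⟨y, fun V hV => ?_, fun V hV hxV => ?_⟩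
  · have hbV : ∀ i, algebraMap F M (b i) ∈ V := fun i => hV (hbO i)
    rcases V.mem_or_inv_mem x with h | h
    · have : y ∈ V := V.toSubring.sum_mem fun i _ => V.mul_mem _ _ (hbV i) (V.toSubring.pow_mem h _)
      exact ⟨this, V.mul_mem _ _ h this⟩
    · refine ⟨?_, ?_⟩
      · rw [hyx]
        exact V.neg_mem _ (V.toSubring.sum_mem fun i _ =>
          V.mul_mem _ _ (hbV i) (V.toSubring.pow_mem h _))
      · rw [hyx, mul_neg, Finset.mul_sum]
        refine V.neg_mem _ (V.toSubring.sum_mem fun i hi => ?_)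
        have e : j - i = j - i - 1 + 1 := by have := Finset.mem_range.1 hi; omega
        rw [e, pow_succ, mul_left_comm, mul_left_comm x, mul_inv_cancel₀ hx0, mul_one]
        exact V.mul_mem _ _ (hbV i) (V.toSubring.pow_mem h _)
  · have hvb : ∀ i, j < i → V.valuation (algebraMap F M (b i)) < 1 := fun i hi => by
      have h1 := hbm i hi
      rw [← not_le] at h1 ⊢
      intro h2
      apply h1
      by_cases h0 : b i = 0
      · rw [h0, map_zero, map_zero] at h2; exact absurd h2 (by simp)
      have h3 : (algebraMap F M (b i))⁻¹ ∈ V := by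
        rw [← V.valuation_le_one_iff, map_inv₀]; exact inv_le_one_of_one_le₀ h2
      rw [← map_inv₀] at h3
      have h4 : (b i)⁻¹ ∈ O := by rw [← hV]; exact h3
      rw [← O.valuation_le_one_iff, map_inv₀] at h4
      exact (inv_le_one₀ (zero_lt_iff.2 ((_root_.map_ne_zero _).2 h0))).1 h4
    have hsum : V.valuation (∑ i ∈ Finset.Ico (j + 1) (n + 1),
        algebraMap F M (b i) * x ^ (i - j)) < 1 := by
      refine V.valuation.map_sum_lt one_ne_zero fun i hi => ?_
      rw [map_mul]
      exact mul_lt_one_of_lt_of_le (hvb i (Finset.mem_Ico.1 hi).1)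
        ((V.valuation_le_one_iff _).2 (V.toSubring.pow_mem hxV _))
    have hv1 : V.valuation y = 1 := by
      rw [hy, Finset.sum_eq_sum_Ico_succ_bot (by omega), hbj, map_one, one_mul, Nat.sub_self,
        pow_zero, V.valuation.map_add_eq_of_lt_left (by rwa [map_one]), map_one]
    have hy0 : y ≠ 0 := fun h0 => by rw [h0, map_zero] at hv1; exact zero_ne_one hv1
    refine ⟨hy0, ?_⟩
    rw [← V.valuation_le_one_iff, map_inv₀, hv1, inv_one]

theorem exists_forall_mem_iff_of_comap_eq [FiniteDimensional F M] [IsGalois F M]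
    (O₁ O₂ : ValuationSubring M)
    (h : O₁.comap (algebraMap F M) = O₂.comap (algebraMap F M)) :
    ∃ σ : M ≃ₐ[F] M, ∀ x, x ∈ O₁ ↔ σ x ∈ O₂ := by
  set O := O₁.comap (algebraMap F M) with hO
  let : Algebra O M := Algebra.compHom M (algebraMap O F)
  have : IsScalarTower O F M := IsScalarTower.of_algebraMap_eq fun _ => rfl
  set B := integralClosure O M
  let := IsIntegralClosure.MulSemiringAction O F M B
  have := IsIntegralClosure.isFractionRing_of_finite_extension O F M B
  have := Algebra.isInvariant_of_isGalois O F M B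
  have hmem : ∀ V : ValuationSubring M, V.comap (algebraMap F M) = O →
      B.toSubring ≤ V.toSubring := by
    intro V hV b hb
    let φ : O →+* V := ((algebraMap F M).comp O.subtype).codRestrict V.toSubring fun a => by
      have := a.2
      simp only [← hV] at this
      exact this
    obtain ⟨f, hf, hf0⟩ := (mem_integralClosure_iff O M).1 hb
    have : IsIntegral V b := by
      refine ⟨f.map φ, hf.map φ, ?_⟩
      rw [Polynomial.eval₂_map]
      exact hf0
    obtain ⟨c, hc⟩ := IsIntegrallyClosed.isIntegral_iff.1 this
    rw [← hc]; exact c.2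
  have hB : ∀ y : M, (∀ V : ValuationSubring M, O ≤ V.comap (algebraMap F M) → y ∈ V) →
      y ∈ B := by
    intro y hy
    have := Subring.eq_iInf_of_isIntegrallyClosedIn (R := B.toSubring)
    change y ∈ B.toSubring
    rw [this]
    simp only [Subring.mem_iInf, Subtype.forall]
    exact fun V hV => hy V fun a ha => hV (B.algebraMap_mem ⟨a, ha⟩)
  let P : (V : ValuationSubring M) → (hV : V.comap (algebraMap F M) = O) → Ideal B := fun V hV =>
    (IsLocalRing.maximalIdeal V).comap (Subring.inclusion (hmem V hV))
  have hP : ∀ V hV (b : B), b ∈ P V hV ↔ V.valuation b < 1 := fun V hV b => by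
    rw [Ideal.mem_comap, ValuationSubring.valuation_lt_one_iff]
    rfl
  have hlt : ∀ V : ValuationSubring M, V.comap (algebraMap F M) = O → ∀ a : F,
      V.valuation (algebraMap F M a) < 1 ↔ a = 0 ∨ a⁻¹ ∉ O := by
    intro V hV a
    by_cases h0 : a = 0
    · simp [h0]
    have : a⁻¹ ∈ O ↔ (algebraMap F M a)⁻¹ ∈ V := by rw [← hV, ← map_inv₀]; rfl
    rw [this, ← V.valuation_le_one_iff, map_inv₀,
      inv_le_one₀ (zero_lt_iff.2 ((map_ne_zero _).2 ((map_ne_zero _).2 h0)))]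
    simp [h0]
  have hunder : (P O₁ rfl).under O = (P O₂ h.symm).under O := by
    ext a
    refine (hP O₁ rfl _).trans (Iff.trans ?_ (hP O₂ h.symm _).symm)
    exact (hlt O₁ rfl a).trans (hlt O₂ h.symm a).symm
  have : SMulCommClass (M ≃ₐ[F] M) O B :=
    ⟨fun g a b => map_smul (galRestrict O F M B g) a b⟩
  have : (P O₁ rfl).IsPrime := inferInstance
  have : (P O₂ h.symm).IsPrime := inferInstance
  obtain ⟨g, hg⟩ := Algebra.IsInvariant.exists_smul_of_under_eq O B (M ≃ₐ[F] M) _ _ hunder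
  have hgb : ∀ b : B, ((g • b : B) : M) = g b := fun b =>
    algebraMap_galRestrict_apply O (L := M) (K := F) g b
  have key : ∀ V W : ValuationSubring M, V.comap (algebraMap F M) = O →
      W.comap (algebraMap F M) = O → ∀ τ : M ≃ₐ[F] M,
      (∀ b ∈ B, V.valuation b < 1 ↔ W.valuation (τ b) < 1) → ∀ x ∈ V, τ x ∈ W := by
    intro V W hV hW τ hτ x hx
    obtain ⟨y, hy, hy1⟩ :=
      exists_mem_and_mul_mem_of_isAlgebraic O (Algebra.IsAlgebraic.isAlgebraic x)
    obtain ⟨hy0, hyV⟩ := hy1 V hV hx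
    have h1 := hB y fun U hU => (hy U hU).1
    have h2 := hB (x * y) fun U hU => (hy U hU).2
    have hτB : ∀ b ∈ B, τ b ∈ W := fun b hb => hmem W hW (by
      have := (galRestrict O F M B τ ⟨b, hb⟩).2
      have e : ((galRestrict O F M B τ ⟨b, hb⟩ : B) : M) = τ b :=
        algebraMap_galRestrict_apply O τ (⟨b, hb⟩ : B)
      rwa [e] at this)
    have h3 : ¬ V.valuation y < 1 := by
      rw [not_lt, ← inv_le_one₀ (zero_lt_iff.2 ((map_ne_zero _).2 hy0)), ← map_inv₀]
      exact (V.valuation_le_one_iff _).2 hyV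
    rw [hτ y h1, not_lt] at h3
    have h4 : (τ y)⁻¹ ∈ W := by
      rw [← W.valuation_le_one_iff, map_inv₀]; exact inv_le_one_of_one_le₀ h3
    have e : τ x = τ (x * y) * (τ y)⁻¹ := by
      rw [map_mul, mul_inv_cancel_right₀]; exact (map_ne_zero _).2 hy0
    rw [e]; exact W.mul_mem _ _ (hτB _ h2) h4
  have hgP : ∀ b ∈ B, O₁.valuation b < 1 ↔ O₂.valuation (g b) < 1 := fun b hb => by
    have h1 := hP O₁ rfl ⟨b, hb⟩
    have h2 := hP O₂ h.symm (g • ⟨b, hb⟩)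
    rw [hgb] at h2
    rw [← h1, ← h2, hg, Ideal.smul_mem_pointwise_smul_iff]
  refine ⟨g, fun x => ⟨key O₁ O₂ rfl h.symm g hgP x, fun hx => ?_⟩⟩
  have := key O₂ O₁ h.symm rfl g.symm (fun b hb => ?_) _ hx
  · rwa [g.symm_apply_apply] at this
  · have h1 : g.symm b ∈ B := by
      have h3 := (galRestrict O F M B g.symm ⟨b, hb⟩).2
      have e : ((galRestrict O F M B g.symm ⟨b, hb⟩ : B) : M) = g.symm b :=
        algebraMap_galRestrict_apply O g.symm (⟨b, hb⟩ : B)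
      rwa [e] at h3
    rw [hgP _ h1, g.apply_symm_apply]

end Conjugacy

section Kummer

variable {F M : Type*} [Field F] [Field M] [Algebra F M]

open Polynomial in
theorem valuation_le_valuation_sum_of_eq_one {p : ℕ} (hp : p.Prime) (V : ValuationSubring M)
    (h1 : ∀ x : F, V.valuation (algebraMap F M x) < 1 → ∃ y, y ^ p = 1 - x) {β : M} {b : F}
    (hβ : β ^ p = algebraMap F M b) (hb : ∀ y : F, y ^ p ≠ b) (hv : V.valuation β = 1)
    (c : ℕ → F) (j : ℕ) (hj : j < p) :
    V.valuation (algebraMap F M (c j)) ≤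
      V.valuation (∑ i ∈ Finset.range p, algebraMap F M (c i) * β ^ i) := by
  obtain ⟨m, hm, hmax⟩ := (Finset.range p).exists_max_image
    (fun i => V.valuation (algebraMap F M (c i))) ⟨j, Finset.mem_range.2 hj⟩
  refine (hmax j (Finset.mem_range.2 hj)).trans ?_
  by_cases hm0 : c m = 0
  · simp [hm0]
  by_contra! hlt
  set O := V.comap (algebraMap F M)
  let φ : O →+* V := ((algebraMap F M).comp O.subtype).codRestrict V.toSubring fun a => a.2
  have : IsLocalHom φ := ⟨fun a ha => by
    obtain ⟨u, hu⟩ := ha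
    have h2 : (algebraMap F M a) * (((u⁻¹ : Vˣ) : V) : M) = 1 := by
      have : (((u : V) * ((u⁻¹ : Vˣ) : V) : V) : M) = 1 := by rw [u.mul_inv]; rfl
      rw [← this, hu]; rfl
    have h3 : (a : F)⁻¹ ∈ O := by
      change algebraMap F M (a : F)⁻¹ ∈ V
      rw [map_inv₀, inv_eq_of_mul_eq_one_right h2]
      exact Subtype.coe_prop _
    refine IsUnit.of_mul_eq_one ⟨_, h3⟩ (Subtype.ext (mul_inv_cancel₀ ?_))
    intro h0
    rw [h0, map_zero, zero_mul] at h2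
    exact zero_ne_one h2⟩
  let ψ := IsLocalRing.ResidueField.map φ
  have hvm : 0 < V.valuation (algebraMap F M (c m)) :=
    zero_lt_iff.2 ((_root_.map_ne_zero _).2 ((_root_.map_ne_zero _).2 hm0))
  have hd : ∀ i ∈ Finset.range p, c i / c m ∈ O := fun i hi => by
    change algebraMap F M _ ∈ V
    rw [← V.valuation_le_one_iff, map_div₀, map_div₀]
    exact div_le_one_of_le₀ (hmax i hi) zero_le
  have hβV : β ∈ V := by rw [← V.valuation_le_one_iff, hv]
  have hbv : V.valuation (algebraMap F M b) = 1 := by rw [← hβ, map_pow, hv, one_pow]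
  have hbO : b ∈ O := by
    change algebraMap F M b ∈ V
    rw [← V.valuation_le_one_iff, hbv]
  let d : ℕ → O := fun i => if h : i ∈ Finset.range p then ⟨c i / c m, hd i h⟩ else 0
  have hdm : d m = 1 := by
    simp only [d, hm, dif_pos]
    exact Subtype.ext (div_self hm0)
  let res := IsLocalRing.residue O
  set g : (IsLocalRing.ResidueField O)[X] := ∑ i ∈ Finset.range p, C (res (d i)) * X ^ i with hg
  have hgdeg : g.degree < p := by
    refine (degree_sum_le _ _).trans_lt ((Finset.sup_lt_iff (by exact WithBot.bot_lt_coe p)).2 ?_)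
    intro i hi
    exact (degree_C_mul_X_pow_le _ _).trans_lt (by exact_mod_cast Finset.mem_range.1 hi)
  have hg0 : g ≠ 0 := fun h0 => by
    have := congrArg (fun q => q.coeff m) h0
    simp only [hg, finsetSum_coeff, coeff_C_mul, coeff_X_pow, coeff_zero] at this
    simp [Finset.mem_range.1 hm, hdm] at this
  have hirr : Irreducible (X ^ p - C (res ⟨b, hbO⟩)) := by
    refine X_pow_sub_C_irreducible_of_prime hp fun r hr => ?_
    obtain ⟨r, rfl⟩ := IsLocalRing.residue_surjective r
    have h2 : (⟨b, hbO⟩ - r ^ p : O) ∈ IsLocalRing.maximalIdeal O := by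
      rw [← IsLocalRing.residue_eq_zero_iff, map_sub, map_pow, hr, sub_self]
    have h3 : V.valuation (algebraMap F M (b - (r : F) ^ p)) < 1 := by
      have h4 : φ (⟨b, hbO⟩ - r ^ p) ∈ IsLocalRing.maximalIdeal V :=
        fun hu => h2 (isUnit_of_map_unit φ _ hu)
      exact (V.valuation_lt_one_iff _).1 h4
    obtain ⟨y, hy⟩ := h1 ((b - (r : F) ^ p) / b) (by rwa [map_div₀, map_div₀, hbv, div_one])
    have hb0 : b ≠ 0 := fun h0 => by simp [h0] at hbv
    have hy0 : y ≠ 0 := by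
      rintro rfl
      rw [zero_pow hp.ne_zero, eq_comm, sub_eq_zero, eq_div_iff hb0, one_mul, eq_comm,
        sub_eq_self] at hy
      rw [hy, sub_zero, hbv] at h3
      exact lt_irrefl _ h3
    refine hb ((r : F) / y) ?_
    rw [div_pow, hy]
    have : (1 - (b - (r : F) ^ p) / b) = r ^ p / b := by field_simp; ring
    rw [this, div_div_cancel₀]
    intro h0
    rw [this, h0, zero_div] at hy
    exact hy0 (pow_eq_zero_iff hp.ne_zero |>.1 hy)
  have hcop : IsCoprime (X ^ p - C (res ⟨b, hbO⟩)) g := by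
    rw [hirr.coprime_iff_not_dvd]
    intro hdvd
    have := degree_le_of_dvd hdvd hg0
    rw [degree_X_pow_sub_C hp.pos] at this
    exact absurd hgdeg (not_lt.2 this)
  obtain ⟨q, r, hqr⟩ := hcop
  have hev := congrArg (eval₂ ψ (IsLocalRing.residue V ⟨β, hβV⟩)) hqr
  have e1 : eval₂ ψ (IsLocalRing.residue V ⟨β, hβV⟩) (X ^ p - C (res ⟨b, hbO⟩)) = 0 := by
    rw [eval₂_sub, eval₂_X_pow, eval₂_C, sub_eq_zero, ← map_pow]
    exact congrArg _ (Subtype.ext hβ)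
  have e2 : eval₂ ψ (IsLocalRing.residue V ⟨β, hβV⟩) g = 0 := by
    rw [hg, eval₂_finsetSum]
    have : ∑ i ∈ Finset.range p, eval₂ ψ (IsLocalRing.residue V ⟨β, hβV⟩)
        (C (res (d i)) * X ^ i) = IsLocalRing.residue V
          (∑ i ∈ Finset.range p, φ (d i) * ⟨β, hβV⟩ ^ i) := by
      rw [map_sum]
      refine Finset.sum_congr rfl fun i _ => ?_
      rw [eval₂_mul, eval₂_C, eval₂_X_pow, map_mul, map_pow]
      rfl
    rw [this, IsLocalRing.residue_eq_zero_iff, V.valuation_lt_one_iff]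
    have e3 : ((∑ i ∈ Finset.range p, φ (d i) * ⟨β, hβV⟩ ^ i : V) : M) =
        (∑ i ∈ Finset.range p, algebraMap F M (c i) * β ^ i) / algebraMap F M (c m) := by
      rw [Finset.sum_div]
      refine (map_sum V.subtype _ _).trans (Finset.sum_congr rfl fun i hi => ?_)
      have : d i = ⟨c i / c m, hd i hi⟩ := by simp only [d, hi, dif_pos]
      rw [this]
      change algebraMap F M (c i / c m) * β ^ i = _
      rw [map_div₀, div_mul_eq_mul_div]
    rw [e3, map_div₀]
    exact (div_lt_one₀ hvm).2 hlt
  rw [eval₂_add, eval₂_mul, eval₂_mul, e1, e2, mul_zero, mul_zero, add_zero, eval₂_one] at hev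
  exact zero_ne_one hev

theorem valuation_le_valuation_sum {p : ℕ} (hp : p.Prime) (V : ValuationSubring M)
    (h1 : ∀ x : F, V.valuation (algebraMap F M x) < 1 → ∃ y, y ^ p = 1 - x) {α : M} {a : F}
    (hα : α ^ p = algebraMap F M a) (ha : ∀ y : F, y ^ p ≠ a)
    (c : ℕ → F) (j : ℕ) (hj : j < p) :
    V.valuation (algebraMap F M (c j) * α ^ j) ≤
      V.valuation (∑ i ∈ Finset.range p, algebraMap F M (c i) * α ^ i) := by
  have ha0 : a ≠ 0 := fun h => ha 0 (by rw [h, zero_pow hp.ne_zero])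
  have ha0' : algebraMap F M a ≠ 0 := (map_ne_zero _).2 ha0
  have hα0 : α ≠ 0 := fun h => ha0' (by rw [← hα, h, zero_pow hp.ne_zero])
  by_cases hex : ∃ u : F, V.valuation (algebraMap F M u * α) = 1
  · obtain ⟨u, hu⟩ := hex
    have hu0 : u ≠ 0 := by rintro rfl; simp at hu
    have hu0' : algebraMap F M u ≠ 0 := (map_ne_zero _).2 hu0
    have := valuation_le_valuation_sum_of_eq_one hp V h1 (β := algebraMap F M u * α)
      (b := u ^ p * a) (by rw [mul_pow, hα, map_mul, map_pow])
      (fun y hy => ha (y / u) (by rw [div_pow, hy]; field_simp)) hu (fun i => c i / u ^ i) j hj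
    have e : ∀ i, algebraMap F M (c i / u ^ i) * (algebraMap F M u * α) ^ i =
        algebraMap F M (c i) * α ^ i := fun i => by
      rw [map_div₀, map_pow, mul_pow]; field_simp
    simp_rw [e] at this
    refine le_trans (le_of_eq ?_) this
    rw [← e j, map_mul, map_pow, hu, one_pow, mul_one]
  · obtain ⟨m, hm, hmax⟩ := (Finset.range p).exists_max_image
      (fun i => V.valuation (algebraMap F M (c i) * α ^ i)) ⟨j, Finset.mem_range.2 hj⟩
    refine (hmax j (Finset.mem_range.2 hj)).trans (le_of_eq ?_)
    by_cases hm0 : c m = 0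
    · have : ∀ i ∈ Finset.range p, algebraMap F M (c i) * α ^ i = 0 := fun i hi => by
        have := hmax i hi
        rwa [hm0, map_zero, zero_mul, map_zero, le_zero_iff, map_eq_zero] at this
      rw [Finset.sum_eq_zero this, hm0, map_zero, zero_mul]
    have hm0' : algebraMap F M (c m) * α ^ m ≠ 0 :=
      mul_ne_zero ((map_ne_zero _).2 hm0) (pow_ne_zero _ hα0)
    rw [← Finset.add_sum_erase _ _ hm]
    refine (V.valuation.map_add_eq_of_lt_left
      (V.valuation.map_sum_lt ((map_ne_zero _).2 hm0') fun i hi => ?_)).symm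
    obtain ⟨him, hi⟩ := Finset.mem_erase.1 hi
    refine lt_of_le_of_ne (hmax i hi) fun heq => hex ?_
    have hpd : ¬ (p : ℤ) ∣ (i : ℤ) - m := fun h => him (by
      have h1 := Int.eq_zero_of_abs_lt_dvd h (by
        rw [abs_lt]
        have := Finset.mem_range.1 hi
        have := Finset.mem_range.1 hm
        constructor <;> omega)
      omega)
    obtain ⟨s, t, hst⟩ := (Nat.prime_iff_prime_int.1 hp).coprime_iff_not_dvd.2 hpd
    refine ⟨(c i / c m) ^ t * a ^ (-s), ?_⟩
    have hw : V.valuation (algebraMap F M (c i / c m) * α ^ ((i : ℤ) - m)) = 1 := by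
      have : algebraMap F M (c i / c m) * α ^ ((i : ℤ) - m) =
          algebraMap F M (c i) * α ^ i / (algebraMap F M (c m) * α ^ m) := by
        rw [zpow_sub₀ hα0, zpow_natCast, zpow_natCast, map_div₀, div_mul_div_comm]
      rw [this, map_div₀, heq, div_self ((map_ne_zero _).2 hm0')]
    have e : algebraMap F M ((c i / c m) ^ t * a ^ (-s)) * α =
        (algebraMap F M (c i / c m) * α ^ ((i : ℤ) - m)) ^ t := by
      rw [mul_zpow, ← zpow_mul, map_mul, map_zpow₀, map_zpow₀, ← hα, mul_assoc, ← zpow_natCast α p,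
        ← zpow_mul, ← zpow_add_one₀ hα0]
      congr 2
      linear_combination (-1) * hst
    rw [e, map_zpow₀, hw, one_zpow]

theorem sum_mem_iff {p : ℕ} (hp : p.Prime) {O : ValuationSubring F} (V : ValuationSubring M)
    (hV : V.comap (algebraMap F M) = O) (h1 : ∀ x ∈ O, x⁻¹ ∉ O → ∃ y, y ^ p = 1 - x)
    {α : M} {a : F} (hα : α ^ p = algebraMap F M a) (ha : ∀ y : F, y ^ p ≠ a) (c : ℕ → F) :
    ∑ i ∈ Finset.range p, algebraMap F M (c i) * α ^ i ∈ V ↔ ∀ i < p, c i ^ p * a ^ i ∈ O := by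
  have h1' : ∀ x : F, V.valuation (algebraMap F M x) < 1 → ∃ y, y ^ p = 1 - x := by
    intro x hx
    by_cases hx0 : x = 0
    · exact ⟨1, by simp [hx0]⟩
    refine h1 x ?_ fun h => ?_
    · rw [← hV]; exact (V.valuation_le_one_iff _).1 hx.le
    · rw [← hV] at h
      have : V.valuation (algebraMap F M x⁻¹) ≤ 1 := (V.valuation_le_one_iff _).2 h
      rw [map_inv₀, map_inv₀, inv_le_one₀ (zero_lt_iff.2 ((map_ne_zero _).2
        ((map_ne_zero _).2 hx0)))] at this
      exact absurd hx (not_lt.2 this)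
  have hpow : ∀ i, c i ^ p * a ^ i ∈ O ↔ algebraMap F M (c i) * α ^ i ∈ V := fun i => by
    have e : algebraMap F M (c i ^ p * a ^ i) = (algebraMap F M (c i) * α ^ i) ^ p := by
      rw [map_mul, map_pow, map_pow, ← hα, mul_pow, ← pow_mul, ← pow_mul, mul_comm p]
    rw [← hV, ValuationSubring.mem_comap, e, ← V.valuation_le_one_iff, ← V.valuation_le_one_iff,
      map_pow]
    exact pow_le_one_iff_of_nonneg zero_le hp.ne_zero
  simp_rw [hpow]
  refine ⟨fun h i hi => ?_, fun h => V.toSubring.sum_mem fun i hi => h i (Finset.mem_range.1 hi)⟩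
  rw [← V.valuation_le_one_iff] at h ⊢
  exact (valuation_le_valuation_sum hp V h1' hα ha c i hi).trans h

end Kummer

section Resolvent

variable {F M : Type*} [Field F] [Field M] [Algebra F M]

theorem exists_sum_mul_apply_ne_zero [Fintype (M ≃ₐ[F] M)] {f : (M ≃ₐ[F] M) → M} (hf : f ≠ 0) :
    ∃ θ : M, ∑ g, f g * g θ ≠ 0 := by
  by_contra! h
  have hinj : Function.Injective fun g : M ≃ₐ[F] M => ((g : M →+* M) : M →* M) := fun g g' e =>
    AlgEquiv.ext fun x => DFunLike.congr_fun e x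
  have hli := (linearIndependent_monoidHom M M).comp _ hinj
  rw [Fintype.linearIndependent_iff] at hli
  exact hf (funext (hli f (funext fun θ => by simpa using h θ)))

theorem exists_ne_zero_forall_apply_eq_mul [Finite (M ≃ₐ[F] M)] (χ : (M ≃ₐ[F] M) →* Fˣ) :
    ∃ α : M, α ≠ 0 ∧ ∀ g : M ≃ₐ[F] M, g α = algebraMap F M (χ g) * α := by
  have := Fintype.ofFinite (M ≃ₐ[F] M)
  obtain ⟨θ, hθ⟩ := exists_sum_mul_apply_ne_zero
    (f := fun g : M ≃ₐ[F] M => algebraMap F M ((χ g)⁻¹ : Fˣ)) fun e => by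
      have := congr_fun e 1
      simp at this
  refine ⟨_, hθ, fun g => ?_⟩
  rw [map_sum, Finset.mul_sum]
  refine Fintype.sum_bijective (g * ·) (Group.mulLeft_bijective g) _ _ fun h => ?_
  rw [map_mul, AlgEquiv.commutes, ← mul_assoc, ← map_mul, map_mul χ, mul_inv, Units.val_mul,
    Units.mul_inv_cancel_left, AlgEquiv.mul_apply]

end Resolvent

section PGroup

theorem Subgroup.exists_ker_ge_of_isPGroup {p : ℕ} [Fact p.Prime] {G F : Type*} [Group G] [Finite G]
    [Field F] (hG : IsPGroup p G) {H : Subgroup G} (hH : H ≠ ⊤) {ζ : F}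
    (hζ : IsPrimitiveRoot ζ p) :
    ∃ χ : G →* Fˣ, χ ≠ 1 ∧ H ≤ χ.ker ∧ ∀ g, χ g ^ p = 1 := by
  obtain ⟨N, hN, hHN⟩ := (eq_top_or_exists_le_coatom H).resolve_left hH
  have := hG.isNilpotent
  have hnorm : N.Normal :=
    Subgroup.NormalizerCondition.normal_of_coatom N Group.normalizerCondition_of_isNilpotent hN
  have hQ : IsPGroup p (G ⧸ N) := hG.to_quotient N
  have hcard : Nat.card (G ⧸ N) = p := by
    obtain ⟨n, hn⟩ := IsPGroup.iff_card.1 hQ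
    have hn0 : n ≠ 0 := by
      rintro rfl
      rw [pow_zero, ← Subgroup.index_eq_card, Subgroup.index_eq_one] at hn
      exact hN.1 hn
    obtain ⟨C, hC⟩ := Sylow.exists_subgroup_card_pow_prime (G := G ⧸ N) p (n := 1)
      (by rw [hn]; exact pow_dvd_pow p (Nat.one_le_iff_ne_zero.2 hn0))
    rw [pow_one] at hC
    have hle : N ≤ C.comap (QuotientGroup.mk' N) := fun x hx => by
      rw [Subgroup.mem_comap, QuotientGroup.mk'_apply, (QuotientGroup.eq_one_iff x).2 hx]
      exact C.one_mem
    have hC1 : C ≠ ⊥ := by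
      rintro rfl
      rw [Subgroup.card_bot] at hC
      exact (Fact.out : p.Prime).one_lt.ne hC
    have hlt : N < C.comap (QuotientGroup.mk' N) := by
      refine lt_of_le_of_ne hle fun e => hC1 ?_
      rw [eq_bot_iff]
      intro q hq
      obtain ⟨x, rfl⟩ := QuotientGroup.mk'_surjective N q
      have : x ∈ N := by rw [e]; exact hq
      exact (QuotientGroup.eq_one_iff x).2 this
    have htop := hN.2 _ hlt
    have : C = ⊤ := by
      rw [eq_top_iff]
      intro q _
      obtain ⟨x, rfl⟩ := QuotientGroup.mk'_surjective N q
      have : x ∈ C.comap (QuotientGroup.mk' N) := by rw [htop]; trivial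
      exact this
    rwa [this, Subgroup.card_top] at hC
  have hp0 : p ≠ 0 := (Fact.out : p.Prime).ne_zero
  have : NeZero p := ⟨hp0⟩
  obtain ⟨u, rfl⟩ := hζ.isUnit hp0
  have hu : IsPrimitiveRoot u p := IsPrimitiveRoot.coe_units_iff.1 hζ
  have hcu : Nat.card (Subgroup.zpowers u) = p := by
    rw [Nat.card_zpowers]; exact hu.eq_orderOf.symm
  let e := mulEquivOfPrimeCardEq hcard hcu
  have hker : ∀ g, (e (QuotientGroup.mk' N g) : Fˣ) = 1 ↔ g ∈ N := fun g => by
    rw [OneMemClass.coe_eq_one, EmbeddingLike.map_eq_one_iff]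
    exact QuotientGroup.eq_one_iff g
  refine ⟨(Subgroup.zpowers u).subtype.comp (e.toMonoidHom.comp (QuotientGroup.mk' N)),
    fun h => hN.1 ?_, fun g hg => (hker g).2 (hHN hg), fun g => ?_⟩
  · rw [eq_top_iff]
    exact fun g _ => (hker g).1 (DFunLike.congr_fun h g)
  · have h1 : (e (QuotientGroup.mk' N g)) ^ p = 1 := by rw [← hcu]; exact pow_card_eq_one'
    exact congr_arg Subtype.val h1

end PGroup

section Uniqueness

variable {F M : Type*} [Field F] [Field M] [Algebra F M]

open Polynomial in
theorem exists_eq_sum_of_mem_adjoin_of_pow_eq {p : ℕ} (hp : 0 < p) {α : M} {a : F}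
    (hα : α ^ p = algebraMap F M a) {x : M} (hx : x ∈ IntermediateField.adjoin F {α}) :
    ∃ c : ℕ → F, x = ∑ i ∈ Finset.range p, algebraMap F M (c i) * α ^ i := by
  have hm : (X ^ p - C a).Monic := monic_X_pow_sub_C a hp.ne'
  have h0 : aeval α (X ^ p - C a) = 0 := by simp [hα]
  have hαint : IsIntegral F α := ⟨_, hm, h0⟩
  have hx2 : x ∈ (IntermediateField.adjoin F {α}).toSubalgebra := hx
  rw [IntermediateField.adjoin_simple_toSubalgebra_of_isAlgebraic hαint.isAlgebraic,
    Algebra.adjoin_singleton_eq_range_aeval] at hx2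
  obtain ⟨q, rfl⟩ := hx2
  refine ⟨(q %ₘ (X ^ p - C a)).coeff, ?_⟩
  have h1 := modByMonic_add_div q (X ^ p - C a)
  have h2 : aeval α q = aeval α (q %ₘ (X ^ p - C a)) := by
    conv_lhs => rw [← h1]
    rw [map_add, map_mul, h0, zero_mul, add_zero]
  have hdeg : (q %ₘ (X ^ p - C a)).natDegree < p := by
    have := natDegree_modByMonic_lt q hm (fun h => by
      have := congr_arg natDegree h
      rw [natDegree_X_pow_sub_C, natDegree_one] at this
      exact hp.ne' this)
    rwa [natDegree_X_pow_sub_C] at this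
  change aeval α q = _
  rw [h2, aeval_def, eval₂_eq_sum_range' _ hdeg]

theorem ValuationSubring.eq_of_comap_eq_of_isPGroup [FiniteDimensional F M] [IsGalois F M] {p : ℕ}
    [hp : Fact p.Prime] (hG : IsPGroup p (M ≃ₐ[F] M)) {ζ : F} (hζ : IsPrimitiveRoot ζ p)
    {O : ValuationSubring F} (h1 : ∀ x ∈ O, x⁻¹ ∉ O → ∃ y, y ^ p = 1 - x)
    {O₁ O₂ : ValuationSubring M} (hO₁ : O₁.comap (algebraMap F M) = O)
    (hO₂ : O₂.comap (algebraMap F M) = O) : O₁ = O₂ := by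
  let D : Subgroup (M ≃ₐ[F] M) :=
    { carrier := {g | ∀ x, x ∈ O₁ ↔ g x ∈ O₁}
      one_mem' := fun x => Iff.rfl
      mul_mem' := fun {g h} hg hh x => (hh x).trans (hg (h x))
      inv_mem' := fun {g} hg x => by
        rw [hg (g⁻¹ x), ← AlgEquiv.mul_apply, mul_inv_cancel, AlgEquiv.one_apply] }
  have hD : D = ⊤ := by
    by_contra hD
    obtain ⟨χ, hχ, hDχ, hχp⟩ := Subgroup.exists_ker_ge_of_isPGroup hG hD hζ
    obtain ⟨α, hα0, hα⟩ := exists_ne_zero_forall_apply_eq_mul χ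
    have hfix : ∀ g : M ≃ₐ[F] M, g (α ^ p) = α ^ p := fun g => by
      rw [map_pow, hα, mul_pow, ← map_pow, ← Units.val_pow_eq_pow_val, hχp]; simp
    obtain ⟨a, ha⟩ := (IsGalois.mem_range_algebraMap_iff_fixed (F := F) (α ^ p)).2 hfix
    have hnp : ∀ y : F, y ^ p ≠ a := by
      rintro y rfl
      have hy0 : algebraMap F M y ≠ 0 := by
        intro h0
        rw [map_pow, h0, zero_pow hp.out.ne_zero] at ha
        exact hα0 (pow_eq_zero_iff hp.out.ne_zero |>.1 ha.symm)
      have : (α / algebraMap F M y) ^ p = 1 := by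
        rw [div_pow, ← ha, map_pow]; exact div_self (pow_ne_zero _ hy0)
      obtain ⟨i, -, hi⟩ :=
        (hζ.map_of_injective (algebraMap F M).injective).eq_pow_of_pow_eq_one this
      have hαF : α = algebraMap F M (ζ ^ i * y) := by
        rw [map_mul, map_pow, hi, div_mul_cancel₀ _ hy0]
      refine hχ (MonoidHom.ext fun g => Units.ext ((algebraMap F M).injective ?_))
      have := hα g
      rw [hαF, AlgEquiv.commutes, ← hαF] at this
      simpa using (mul_right_cancel₀ hα0 ((one_mul α).trans this)).symm
    obtain ⟨σ, hσ⟩ : ∃ σ, χ σ ≠ 1 := by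
      by_contra! h
      exact hχ (MonoidHom.ext h)
    let E := IntermediateField.adjoin F {α}
    have hσO : (O₁.comap (σ : M →+* M)).comap (algebraMap F M) = O := by
      rw [← hO₁]
      ext x
      change σ (algebraMap F M x) ∈ O₁ ↔ algebraMap F M x ∈ O₁
      rw [AlgEquiv.commutes]
    obtain ⟨τ, hτ⟩ := exists_forall_mem_iff_of_comap_eq (F := E) O₁ (O₁.comap (σ : M →+* M)) (by
      ext ⟨x, hx⟩
      obtain ⟨c, rfl⟩ := exists_eq_sum_of_mem_adjoin_of_pow_eq hp.out.pos ha.symm hx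
      exact (sum_mem_iff hp.out O₁ hO₁ h1 ha.symm hnp c).trans
        (sum_mem_iff hp.out (O₁.comap (σ : M →+* M)) hσO h1 ha.symm hnp c).symm)
    let τ' : M ≃ₐ[F] M := τ.restrictScalars F
    have hτα : τ' α = α := τ.commutes ⟨α, IntermediateField.mem_adjoin_simple_self F α⟩
    have h3 : σ * τ' ∈ D := fun x => hτ x
    have h4 : χ (σ * τ') = 1 := hDχ h3
    have h5 : χ τ' = 1 := by
      refine Units.ext ((algebraMap F M).injective ?_)
      have := hα τ'
      rw [hτα] at this
      simpa using (mul_right_cancel₀ hα0 ((one_mul α).trans this)).symm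
    rw [map_mul, h5, mul_one] at h4
    exact hσ h4
  obtain ⟨g, hg⟩ := exists_forall_mem_iff_of_comap_eq O₁ O₂ (hO₁.trans hO₂.symm)
  ext x
  have hgD : g⁻¹ ∈ D := by rw [hD]; trivial
  rw [hgD x, hg, ← AlgEquiv.mul_apply, mul_inv_cancel, AlgEquiv.one_apply]

end Uniqueness

section PHenselian

theorem ValuationSubring.exists_comap_eq {F M : Type*} [Field F] [Field M] (f : F →+* M)
    (O : ValuationSubring F) : ∃ V : ValuationSubring M, V.comap f = O := by
  obtain ⟨V, hle, hloc⟩ := LocalSubring.exists_le_valuationSubring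
    (LocalSubring.range (f.comp O.subtype))
  have hmem : ∀ x ∈ O, f x ∈ (LocalSubring.range (f.comp O.subtype)).toSubring :=
    fun x hx => ⟨⟨x, hx⟩, rfl⟩
  refine ⟨V, ?_⟩
  ext x
  refine ⟨fun hx => ?_, fun hx => hle (hmem x hx)⟩
  by_contra hxO
  have hx0 : x ≠ 0 := by rintro rfl; exact hxO O.zero_mem
  have hinv := (O.mem_or_inv_mem x).resolve_left hxO
  have hunit : IsUnit (Subring.inclusion hle ⟨f x⁻¹, hmem _ hinv⟩) := by
    refine IsUnit.of_mul_eq_one (⟨f x, hx⟩ : V.toLocalSubring.toSubring) (Subtype.ext ?_)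
    change f x⁻¹ * f x = 1
    rw [← map_mul, inv_mul_cancel₀ hx0, map_one]
  obtain ⟨⟨_, y, rfl⟩, hy⟩ := (hloc.map_nonunit _ hunit).exists_right_inv
  have hy1 : f x⁻¹ * f y = 1 := congr_arg Subtype.val hy
  rw [← map_mul, ← map_one f] at hy1
  have : x = y := by
    have := f.injective hy1
    field_simp at this
    exact this.symm
  exact hxO (this ▸ y.2)

theorem isPGroup_gal_iff {p : ℕ} {K Ω : Type*} [Field K] [Field Ω] [Algebra K Ω] [Normal K Ω]
    (L : IntermediateField K Ω) [Normal K L] :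
    IsPGroup p (L ≃ₐ[K] L) ↔ ∀ σ : Ω ≃ₐ[K] Ω, ∃ k : ℕ, ∀ x ∈ L, (σ ^ p ^ k) x = x := by
  have key : ∀ (σ : Ω ≃ₐ[K] Ω) (k : ℕ), AlgEquiv.restrictNormalHom L σ ^ p ^ k = 1 ↔
      ∀ x ∈ L, (σ ^ p ^ k) x = x := fun σ k => by
    rw [← map_pow]
    refine ⟨fun h x hx => ?_, fun h => AlgEquiv.ext fun x => Subtype.ext ?_⟩
    · rw [← AlgEquiv.restrictNormalHom_apply L _ ⟨x, hx⟩, h]; rfl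
    · rw [AlgEquiv.restrictNormalHom_apply]; exact h x x.2
  refine ⟨fun h σ => ?_, fun h g => ?_⟩
  · obtain ⟨k, hk⟩ := h (AlgEquiv.restrictNormalHom L σ)
    exact ⟨k, (key σ k).1 hk⟩
  · obtain ⟨σ, rfl⟩ := AlgEquiv.restrictNormalHom_surjective Ω g
    obtain ⟨k, hk⟩ := h σ
    exact ⟨k, (key σ k).2 hk⟩

theorem exists_le_of_mem_maxPExt {p : ℕ} [Fact p.Prime] {K Ω : Type*} [Field K] [Field Ω]
    [Algebra K Ω] [Normal K Ω] {x : Ω} (hx : x ∈ maxPExt p K Ω) :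
    ∃ L : IntermediateField K Ω, L ≤ maxPExt p K Ω ∧ x ∈ L ∧ FiniteDimensional K L ∧
      IsGalois K L ∧ IsPGroup p (L ≃ₐ[K] L) := by
  let S := {L : IntermediateField K Ω //
      FiniteDimensional K ↥L ∧ IsGalois K ↥L ∧ ∃ n : ℕ, Module.finrank K ↥L = p ^ n}
  have hS : ∀ L : S, IsPGroup p (L.1 ≃ₐ[K] L.1) := fun ⟨L, h1, h2, n, hn⟩ =>
    IsPGroup.of_card (n := n) (by rw [IsGalois.card_aut_eq_finrank, hn])
  have : Nonempty S := ⟨⊥, inferInstance, inferInstance, 0, by simp⟩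
  have hdir : Directed (· ≤ ·) (fun L : S => L.1) := by
    rintro L₁ L₂
    have := L₁.2.1; have := L₁.2.2.1; have := L₂.2.1; have := L₂.2.2.1
    have hG : IsPGroup p (↥(L₁.1 ⊔ L₂.1) ≃ₐ[K] ↥(L₁.1 ⊔ L₂.1)) := by
      rw [isPGroup_gal_iff]
      intro σ
      obtain ⟨k₁, hk₁⟩ := (isPGroup_gal_iff L₁.1).1 (hS L₁) σ
      obtain ⟨k₂, hk₂⟩ := (isPGroup_gal_iff L₂.1).1 (hS L₂) (σ ^ p ^ k₁)
      refine ⟨k₁ + k₂, ?_⟩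
      rw [pow_add, pow_mul]
      let E := IntermediateField.fixedField (Subgroup.zpowers ((σ ^ p ^ k₁) ^ p ^ k₂))
      have hE : ∀ x, x ∈ E ↔ ((σ ^ p ^ k₁) ^ p ^ k₂) x = x := fun x => by
        refine ⟨fun h => h ⟨_, Subgroup.mem_zpowers _⟩, fun h ⟨τ, hτ⟩ => ?_⟩
        have : Subgroup.zpowers ((σ ^ p ^ k₁) ^ p ^ k₂) ≤
          MulAction.stabilizer (Ω ≃ₐ[K] Ω) x := Subgroup.zpowers_le.2 h
        exact this hτ
      have : L₁.1 ⊔ L₂.1 ≤ E := sup_le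
        (fun x hx => (hE x).2 (by
          have hfix : ∀ n : ℕ, ((σ ^ p ^ k₁) ^ n) x = x := fun n => by
            induction n with
            | zero => rfl
            | succ n ih => rw [pow_succ, AlgEquiv.mul_apply, hk₁ x hx, ih]
          exact hfix _))
        (fun x hx => (hE x).2 (hk₂ x hx))
      exact fun x hx => (hE x).1 (this hx)
    obtain ⟨n, hn⟩ := IsPGroup.iff_card.1 hG
    refine ⟨⟨L₁.1 ⊔ L₂.1, inferInstance, inferInstance, n, ?_⟩, le_sup_left, le_sup_right⟩
    rw [← IsGalois.card_aut_eq_finrank, hn]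
  have hx2 : x ∈ ((⨆ L : S, L.1 : IntermediateField K Ω) : Set Ω) := hx
  rw [IntermediateField.coe_iSup_of_directed hdir, Set.mem_iUnion] at hx2
  obtain ⟨L, hL⟩ := hx2
  exact ⟨L.1, le_iSup (fun L : S => L.1) L, hL, L.2.1, L.2.2.1, hS L⟩

theorem isPHenselian_of_one_sub_mem {p : ℕ} [Fact p.Prime] {K : Type*} [Field K] {ζ : K}
    (hζ : IsPrimitiveRoot ζ p) {O : ValuationSubring K}
    (h1 : ∀ x ∈ O, x⁻¹ ∉ O → ∃ y, y ^ p = 1 - x) : IsPHenselian p O := by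
  obtain ⟨V, hV⟩ := O.exists_comap_eq (algebraMap K ↥(maxPExt p K (AlgebraicClosure K)))
  refine ⟨V, hV, fun W hW => ?_⟩
  ext ⟨x, hx⟩
  obtain ⟨L, hL, hxL, hfin, hgal, hG⟩ := exists_le_of_mem_maxPExt hx
  let i := IntermediateField.inclusion hL
  have hi : ∀ U : ValuationSubring ↥(maxPExt p K (AlgebraicClosure K)),
      U.comap (algebraMap K ↥(maxPExt p K (AlgebraicClosure K))) = O →
      (U.comap (i : L →+* ↥(maxPExt p K (AlgebraicClosure K)))).comap (algebraMap K L) = O := by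
    intro U hU
    rw [← hU]
    rfl
  have := ValuationSubring.eq_of_comap_eq_of_isPGroup hG hζ h1 (hi W hW) (hi V hV)
  exact (SetLike.ext_iff.1 this) ⟨x, hxL⟩

end PHenselian

theorem mem_metaAbExt_of_mem {p : ℕ} {E : Type*} [Field E]
    {x : AlgebraicClosure E} (hx : x ∈ elemAbExt p E (AlgebraicClosure E)) :
    x ∈ metaAbExt p E :=
  (elemAbExt p (elemAbExt p E (AlgebraicClosure E)) (AlgebraicClosure E)).algebraMap_mem ⟨x, hx⟩

section ElementaryAbelian

variable {E : Type*} [Field E] {p : ℕ} [hp : Fact p.Prime] {ζ : E}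

theorem mem_elemAbExt_of_pow_eq {Ω : Type*} [Field Ω] [Algebra E Ω] (hζ : IsPrimitiveRoot ζ p)
    {x : Ω} {a : E} (hx : x ^ p = algebraMap E Ω a) : x ∈ elemAbExt p E Ω := by
  have hζΩ := hζ.map_of_injective (algebraMap E Ω).injective
  by_cases hx0 : x = 0
  · rw [hx0]; exact zero_mem _
  have hne : NeZero p := ⟨hp.out.ne_zero⟩
  have hpE : (p : E) ≠ 0 := hζ.neZero'.out
  have ha : a ≠ 0 := by
    rintro rfl
    rw [map_zero] at hx
    exact hx0 (pow_eq_zero_iff hp.out.ne_zero |>.1 hx)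
  let L := IntermediateField.adjoin E {x}
  have hroot : ∀ y : Ω, y ^ p = algebraMap E Ω a → ∃ i : ℕ, y = algebraMap E Ω ζ ^ i * x := by
    intro y hy
    obtain ⟨i, -, hi⟩ := hζΩ.eq_pow_of_pow_eq_one (ξ := y / x) (by
      rw [div_pow, hx, hy, div_self ((map_ne_zero _).2 ha)])
    exact ⟨i, by rw [hi, div_mul_cancel₀ _ hx0]⟩
  have hζL : ∀ i : ℕ, algebraMap E Ω ζ ^ i ∈ L := fun i => pow_mem (L.algebraMap_mem ζ) i
  have hxL : x ∈ L := IntermediateField.mem_adjoin_simple_self E x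
  have hsplit : ((Polynomial.X ^ p - Polynomial.C a).map (algebraMap E L)).Splits := by
    rw [Polynomial.map_sub, Polynomial.map_pow, Polynomial.map_C, Polynomial.map_X]
    exact X_pow_sub_C_splits_of_isPrimitiveRoot (hζ.map_of_injective (algebraMap E L).injective)
      (α := ⟨x, hxL⟩) (Subtype.ext hx)
  have hsf : (Polynomial.X ^ p - Polynomial.C a).IsSplittingField E L := by
    refine (IntermediateField.isSplittingField_iff).2 ⟨hsplit, le_antisymm ?_ ?_⟩
    · refine IntermediateField.adjoin.mono _ _ _ ?_
      rintro _ rfl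
      rw [Polynomial.mem_rootSet]
      exact ⟨(Polynomial.monic_X_pow_sub_C a hp.out.ne_zero).ne_zero, by simp [hx]⟩
    · rw [IntermediateField.adjoin_le_iff]
      intro y hy
      have := (Polynomial.mem_rootSet.1 hy).2
      obtain ⟨i, rfl⟩ := hroot y (by simpa [sub_eq_zero] using this)
      exact mul_mem (hζL i) hxL
  have hgal : IsGalois E L := IsGalois.of_separable_splitting_field
    (Polynomial.separable_X_pow_sub_C a hpE ha)
  have hαint : IsIntegral E x := ⟨_, Polynomial.monic_X_pow_sub_C a hp.out.ne_zero, by simp [hx]⟩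
  have hact : ∀ σ : L ≃ₐ[E] L, ∃ i : ℕ, σ ⟨x, hxL⟩ = algebraMap E L (ζ ^ i) * ⟨x, hxL⟩ := by
    intro σ
    obtain ⟨i, hi⟩ := hroot (σ ⟨x, hxL⟩) (by
      have : σ (⟨x, hxL⟩ ^ p) = algebraMap E L a := by
        rw [show (⟨x, hxL⟩ : L) ^ p = algebraMap E L a from Subtype.ext hx, AlgEquiv.commutes]
      rw [map_pow] at this
      exact congr_arg Subtype.val this)
    exact ⟨i, Subtype.ext (hi.trans (by rw [← map_pow]; rfl))⟩
  have hext : ∀ σ τ : L ≃ₐ[E] L, σ ⟨x, hxL⟩ = τ ⟨x, hxL⟩ → σ = τ := fun σ τ h => by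
    have : (σ : L →ₐ[E] L) = τ := (IntermediateField.adjoin.powerBasis hαint).algHom_ext (by
      rw [IntermediateField.adjoin.powerBasis_gen]; exact h)
    exact AlgEquiv.ext fun y => DFunLike.congr_fun this y
  refine le_iSup (fun L : {L : IntermediateField E Ω // IsGalois E ↥L ∧
      (∀ σ τ : ↥L ≃ₐ[E] ↥L, σ * τ = τ * σ) ∧ ∀ σ : ↥L ≃ₐ[E] ↥L, σ ^ p = 1} => L.1)
      ⟨L, hgal, fun σ τ => ?_, fun σ => ?_⟩ hxL
  · obtain ⟨i, hi⟩ := hact σ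
    obtain ⟨j, hj⟩ := hact τ
    refine hext _ _ ?_
    rw [AlgEquiv.mul_apply, AlgEquiv.mul_apply, hi, hj, map_mul, map_mul, AlgEquiv.commutes,
      AlgEquiv.commutes, hi, hj, mul_left_comm]
  · obtain ⟨i, hi⟩ := hact σ
    refine hext _ _ ?_
    have : ∀ n : ℕ, (σ ^ n) ⟨x, hxL⟩ = algebraMap E L (ζ ^ i) ^ n * ⟨x, hxL⟩ := fun n => by
      induction n with
      | zero => simp
      | succ n ih => rw [pow_succ, AlgEquiv.mul_apply, hi, map_mul, AlgEquiv.commutes, ih]; ring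
    rw [this, ← map_pow, ← pow_mul, mul_comm i, pow_mul, hζ.pow_eq_one, one_pow, map_one, one_mul]
    rfl

theorem adjoin_setOf_pow_mem_eq_top {L : Type*} [Field L] [Algebra E L] [FiniteDimensional E L]
    [IsGalois E L] (hζ : IsPrimitiveRoot ζ p) (hcomm : ∀ σ τ : L ≃ₐ[E] L, σ * τ = τ * σ)
    (hexp : ∀ σ : L ≃ₐ[E] L, σ ^ p = 1) :
    IntermediateField.adjoin E {x : L | ∃ a, x ^ p = algebraMap E L a} = ⊤ := by
  have hne : NeZero p := ⟨hp.out.ne_zero⟩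
  let A := IntermediateField.adjoin E {x : L | ∃ a, x ^ p = algebraMap E L a}
  suffices A.fixingSubgroup = ⊥ by
    rw [← IsGalois.fixedField_fixingSubgroup (IntermediateField.adjoin E _)]
    change IntermediateField.fixedField A.fixingSubgroup = ⊤
    rw [this, IntermediateField.fixedField_bot]
  rw [eq_bot_iff]
  intro g hg
  rw [Subgroup.mem_bot]
  by_contra hg1
  let _ : CommGroup (L ≃ₐ[E] L) := { (inferInstance : Group (L ≃ₐ[E] L)) with mul_comm := hcomm }
  have henough : HasEnoughRootsOfUnity E p := ⟨⟨ζ, hζ⟩, inferInstance⟩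
  have : HasEnoughRootsOfUnity E (Monoid.exponent (L ≃ₐ[E] L)) :=
    HasEnoughRootsOfUnity.of_dvd E (Monoid.exponent_dvd_of_forall_pow_eq_one hexp)
  obtain ⟨χ, hχ⟩ := CommGroup.exists_apply_ne_one_of_hasEnoughRootsOfUnity (L ≃ₐ[E] L) E hg1
  obtain ⟨α, hα0, hα⟩ := exists_ne_zero_forall_apply_eq_mul χ
  have hfix : ∀ g : L ≃ₐ[E] L, g (α ^ p) = α ^ p := fun g => by
    rw [map_pow, hα, mul_pow, ← map_pow, ← Units.val_pow_eq_pow_val, ← map_pow, hexp]; simp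
  obtain ⟨a, ha⟩ := (IsGalois.mem_range_algebraMap_iff_fixed (F := E) (α ^ p)).2 hfix
  have hαA : α ∈ A := IntermediateField.subset_adjoin _ _ ⟨a, ha.symm⟩
  have h1 : g α = α := (IntermediateField.mem_fixingSubgroup_iff _ _).1 hg α hαA
  rw [hα] at h1
  refine hχ (Units.ext ((algebraMap E L).injective ?_))
  simpa using mul_right_cancel₀ hα0 (h1.trans (one_mul α).symm)

theorem elemAbExt_le_adjoin {Ω : Type*} [Field Ω] [Algebra E Ω] (hζ : IsPrimitiveRoot ζ p) :
    elemAbExt p E Ω ≤ IntermediateField.adjoin E {x : Ω | ∃ a, x ^ p = algebraMap E Ω a} := by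
  refine iSup_le ?_
  rintro ⟨L, hgal, hcomm, hexp⟩ x hx
  change x ∈ L at hx
  let N := FiniteGaloisIntermediateField.adjoin E {(⟨x, hx⟩ : L)}
  have hxN : (⟨x, hx⟩ : L) ∈ N.toIntermediateField :=
    FiniteGaloisIntermediateField.subset_adjoin _ _ rfl
  have hsurj := AlgEquiv.restrictNormalHom_surjective (F := E) (K₁ := N) L
  have htop := adjoin_setOf_pow_mem_eq_top (L := N) hζ
    (fun σ τ => by
      obtain ⟨σ, rfl⟩ := hsurj σ
      obtain ⟨τ, rfl⟩ := hsurj τ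
      rw [← map_mul, hcomm, map_mul])
    (fun σ => by
      obtain ⟨σ, rfl⟩ := hsurj σ
      rw [← map_pow, hexp, map_one])
  let φ : N →ₐ[E] Ω := L.val.comp N.toIntermediateField.val
  have hmem : (⟨⟨x, hx⟩, hxN⟩ : N) ∈
      IntermediateField.adjoin E {x : N | ∃ a, x ^ p = algebraMap E N a} := by rw [htop]; trivial
  have h2 : x ∈ (IntermediateField.adjoin E {x : N | ∃ a, x ^ p = algebraMap E N a}).map φ :=
    ⟨_, hmem, rfl⟩
  rw [IntermediateField.adjoin_map] at h2
  refine IntermediateField.adjoin.mono _ _ _ ?_ h2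
  rintro _ ⟨y, ⟨a, ha⟩, rfl⟩
  exact ⟨a, by rw [← map_pow, ha, AlgHom.commutes]⟩

instance isGalois_elemAbExt (r : ℕ) (E Ω : Type*) [Field E] [Field Ω] [Algebra E Ω] :
    IsGalois E (elemAbExt r E Ω) := by
  have h1 : ∀ L : {L : IntermediateField E Ω // IsGalois E ↥L ∧
      (∀ σ τ : ↥L ≃ₐ[E] ↥L, σ * τ = τ * σ) ∧ ∀ σ : ↥L ≃ₐ[E] ↥L, σ ^ r = 1}, IsGalois E L.1 :=
    fun L => L.2.1
  have h2 : Normal E (elemAbExt r E Ω) := IntermediateField.normal_iSup E Ω _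
  have h3 : Algebra.IsSeparable E (elemAbExt r E Ω) := IntermediateField.isSeparable_iSup E Ω
  exact ⟨⟩

theorem mem_metaAbExt_of_pow_mem (hζ : IsPrimitiveRoot ζ p) {x : AlgebraicClosure E}
    (hx : x ^ p ∈ elemAbExt p E (AlgebraicClosure E)) : x ∈ metaAbExt p E :=
  mem_elemAbExt_of_pow_eq (E := elemAbExt p E (AlgebraicClosure E))
    (hζ.map_of_injective (algebraMap E (elemAbExt p E (AlgebraicClosure E))).injective)
    (a := ⟨x ^ p, hx⟩) rfl

theorem isGalois_metaAbExt (hζ : IsPrimitiveRoot ζ p) : IsGalois E (metaAbExt p E) := by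
  let E' := elemAbExt p E (AlgebraicClosure E)
  let E'' := elemAbExt p E' (AlgebraicClosure E)
  have hsep : Algebra.IsSeparable E (metaAbExt p E) :=
    Algebra.IsSeparable.trans E E' E''
  have hζ' := hζ.map_of_injective (algebraMap E E').injective
  have hnorm : Normal E (metaAbExt p E) := by
    rw [IntermediateField.normal_iff_forall_map_le']
    rintro σ _ ⟨x, hx, rfl⟩
    have hx' : x ∈ E'' := hx
    refine IntermediateField.adjoin_induction (F := E') (p := fun x _ => σ x ∈ metaAbExt p E)
      ?_ ?_ ?_ ?_ ?_ (elemAbExt_le_adjoin hζ' hx')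
    · rintro x ⟨a, ha⟩
      refine mem_metaAbExt_of_pow_mem hζ ?_
      have := (IntermediateField.normal_iff_forall_map_le' (K := E')).1 inferInstance σ
      rw [← map_pow, ha]
      exact this ⟨a, a.2, rfl⟩
    · intro a
      have := (IntermediateField.normal_iff_forall_map_le' (K := E')).1 inferInstance σ
      exact mem_metaAbExt_of_mem (this ⟨a, a.2, rfl⟩)
    · intro x y _ _ hx hy
      rw [map_add]; exact add_mem hx hy
    · intro x _ hx
      rw [map_inv₀]; exact inv_mem hx
    · intro x y _ _ hx hy
      rw [map_mul]; exact mul_mem hx hy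
  exact ⟨⟩

end ElementaryAbelian

section SemidirectProduct

theorem exists_monoidHom_ofAdd_one_eq {p : ℕ} {A : Type*} [CommGroup A] {z : A} (hz : z ^ p = 1) :
    ∃ χ : Multiplicative (ZMod p) →* A, χ (Multiplicative.ofAdd 1) = z := by
  let f : {f : ℤ →+ Additive A // f p = 0} := ⟨zmultiplesHom (Additive A) (Additive.ofMul z), by
    rw [zmultiplesHom_apply, natCast_zsmul, ← ofMul_pow, hz, ofMul_one]⟩
  refine ⟨AddMonoidHom.toMultiplicativeLeft (ZMod.lift p f), ?_⟩
  have := ZMod.lift_coe p f 1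
  rw [Int.cast_one] at this
  change Additive.toMul (ZMod.lift p f 1) = z
  rw [this]
  simp [f]

theorem exists_generators_of_semidirectProduct {p : ℕ} [hp : Fact p.Prime] {G : Type*} [Group G]
    {θ : Multiplicative (ZMod (p ^ 2)) →* MulAut (Multiplicative (ZMod (p ^ 2)))}
    (e : G ≃* SemidirectProduct (Multiplicative (ZMod (p ^ 2)))
      (Multiplicative (ZMod (p ^ 2))) θ) :
    ∃ (x y : G) (k : ℕ) (π : G →* Multiplicative (ZMod (p ^ 2))) (ε : G →* Multiplicative (ZMod p)),
      y * x = x ^ (1 + p * k) * y ∧ (∀ g, ∃ m n : ℕ, g = x ^ m * y ^ n) ∧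
      π x = 1 ∧ π y = Multiplicative.ofAdd 1 ∧ ε x = Multiplicative.ofAdd 1 ∧ ε y = 1 := by
  have hne : NeZero (p ^ 2) := ⟨pow_ne_zero 2 hp.out.ne_zero⟩
  have hofAdd : ∀ a : ZMod (p ^ 2), Multiplicative.ofAdd a = Multiplicative.ofAdd 1 ^ a.val :=
    fun a => by
      rw [← ofAdd_nsmul, nsmul_eq_mul, ZMod.natCast_val, ZMod.cast_id, mul_one]
  let u : Multiplicative (ZMod (p ^ 2)) → ZMod (p ^ 2) := fun h =>
    Multiplicative.toAdd (θ h (Multiplicative.ofAdd 1))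
  have hu : ∀ h a, θ h (Multiplicative.ofAdd a) = Multiplicative.ofAdd (a * u h) := fun h a => by
    rw [hofAdd a, map_pow]
    change (Multiplicative.ofAdd (u h)) ^ a.val = _
    rw [← ofAdd_nsmul, nsmul_eq_mul, ZMod.natCast_val, ZMod.cast_id]
  have hupow : ∀ h (n : ℕ), (θ h ^ n) (Multiplicative.ofAdd 1) = Multiplicative.ofAdd (u h ^ n) :=
    fun h n => by
      induction n with
      | zero => rw [pow_zero, pow_zero, MulAut.one_apply]
      | succ n ih => rw [pow_succ' (θ h), MulAut.mul_apply, ih, hu, pow_succ (u h)]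
  let c := ZMod.castHom (dvd_pow_self p two_ne_zero) (ZMod p)
  have huc : ∀ h, c (u h) = 1 := fun h => by
    have h1 : h ^ p ^ 2 = 1 := by
      rw [← toAdd_eq_zero, toAdd_pow, nsmul_eq_mul, ZMod.natCast_self, zero_mul]
    have h2 := hupow h (p ^ 2)
    rw [← map_pow, h1, map_one, MulAut.one_apply] at h2
    have h3 : u h ^ p ^ 2 = 1 := (Multiplicative.ofAdd.injective h2).symm
    have h4 := congr_arg c h3
    rwa [map_pow, map_one, ZMod.pow_card_pow] at h4
  obtain ⟨k, hk⟩ : ∃ k, (u (Multiplicative.ofAdd 1)).val = 1 + p * k := by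
    have h1 := huc (Multiplicative.ofAdd 1)
    rw [← ZMod.natCast_zmod_val (u (Multiplicative.ofAdd 1)), map_natCast] at h1
    replace h1 := (ZMod.natCast_eq_natCast_iff' _ 1 p).1 (h1.trans Nat.cast_one.symm)
    refine ⟨(u (Multiplicative.ofAdd 1)).val / p, ?_⟩
    rw [Nat.mod_eq_of_lt hp.out.one_lt] at h1
    rw [← h1, Nat.mod_add_div]
  let ε₀ : SemidirectProduct _ _ θ →* Multiplicative (ZMod p) :=
    SemidirectProduct.lift (AddMonoidHom.toMultiplicative c.toAddMonoidHom) 1 fun h => by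
      refine MonoidHom.ext fun a => ?_
      change Multiplicative.ofAdd (c (Multiplicative.toAdd (θ h (Multiplicative.ofAdd
        (Multiplicative.toAdd a))))) = _
      rw [hu, toAdd_ofAdd, map_mul, huc, mul_one, MonoidHom.one_apply, map_one]
      rfl
  refine ⟨e.symm (SemidirectProduct.inl (Multiplicative.ofAdd 1)),
    e.symm (SemidirectProduct.inr (Multiplicative.ofAdd 1)), k,
    SemidirectProduct.rightHom.comp e.toMonoidHom, ε₀.comp e.toMonoidHom, ?_, fun g => ?_,
    ?_, ?_, ?_, ?_⟩
  · rw [← map_mul, ← map_pow, ← map_mul]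
    congr 1
    have := SemidirectProduct.inl_aut (φ := θ) (Multiplicative.ofAdd 1) (Multiplicative.ofAdd 1)
    rw [show θ (Multiplicative.ofAdd 1) (Multiplicative.ofAdd 1) =
      Multiplicative.ofAdd 1 ^ (1 + p * k) by rw [← hk, ← hofAdd]; rfl, map_pow] at this
    rw [this]
    simp [mul_assoc]
  · refine ⟨(Multiplicative.toAdd (e g).left).val, (Multiplicative.toAdd (e g).right).val, ?_⟩
    rw [← map_pow e.symm, ← map_pow e.symm, ← map_mul e.symm, ← map_pow SemidirectProduct.inl,
      ← map_pow SemidirectProduct.inr, ← hofAdd, ← hofAdd, ofAdd_toAdd,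
      ofAdd_toAdd, SemidirectProduct.inl_left_mul_inr_right, e.symm_apply_apply]
  · simp
  · simp
  · simp [ε₀, c]
  · simp [ε₀]

end SemidirectProduct

/-- Automorphisms `x`, `y` of `M` over `K` with `y * x = x ^ (1 + p * k) * y` and fixed field `K`,
such that `M` contains the `p`-th roots of the elements of `K` and of those of every `K⟮α⟯` with
`α ^ p` in `K`. -/
structure IsMetaGenerating (p : ℕ) {K M : Type*} [Field K] [Field M] [Algebra K M] (ζ : K)
    (x y : M ≃ₐ[K] M) (k : ℕ) : Prop where
  isPrimitiveRoot : IsPrimitiveRoot ζ p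
  comm : y * x = x ^ (1 + p * k) * y
  exists_eq_of_fixed : ∀ z : M, x z = z → y z = z → ∃ c, algebraMap K M c = z
  exists_left : ∃ α ≠ 0, x α = algebraMap K M ζ * α ∧ y α = α
  exists_right : ∃ α ≠ 0, x α = α ∧ y α = algebraMap K M ζ * α
  exists_root : ∀ a : K, ∃ α : M, α ^ p = algebraMap K M a
  exists_root_adjoin : ∀ (α : M) (a : K), α ^ p = algebraMap K M a →
    ∀ γ ∈ IntermediateField.adjoin K {α}, ∃ δ, δ ^ p = γ

namespace IsMetaGenerating

variable {p : ℕ} [hp : Fact p.Prime] {K M : Type*} [Field K] [Field M] [Algebra K M] {ζ : K}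
  {x y : M ≃ₐ[K] M} {k : ℕ}

theorem exists_eq_mul_of_pow_eq (h : IsMetaGenerating p ζ x y k) {u v : M} (hv : v ≠ 0)
    (huv : u ^ p = v ^ p) : ∃ ω : K, ω ^ p = 1 ∧ u = algebraMap K M ω * v := by
  have : NeZero p := ⟨hp.out.ne_zero⟩
  obtain ⟨i, -, hi⟩ := (h.isPrimitiveRoot.map_of_injective
    (algebraMap K M).injective).eq_pow_of_pow_eq_one (ξ := u / v) (by
      rw [div_pow, huv, div_self (pow_ne_zero _ hv)])
  refine ⟨ζ ^ i, ?_, ?_⟩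
  · rw [← pow_mul, mul_comm, pow_mul, h.isPrimitiveRoot.pow_eq_one, one_pow]
  · rw [map_pow, hi, div_mul_cancel₀ _ hv]

theorem exists_apply_eq_mul (h : IsMetaGenerating p ζ x y k) {α : M} {a : K} (hα0 : α ≠ 0)
    (hα : α ^ p = algebraMap K M a) (g : M ≃ₐ[K] M) :
    ∃ ω : K, ω ^ p = 1 ∧ g α = algebraMap K M ω * α :=
  h.exists_eq_mul_of_pow_eq hα0 (by rw [← map_pow, hα, AlgEquiv.commutes])

theorem isPrimitiveRoot_of_ne_one {ω : K} (h1 : ω ^ p = 1) (h2 : ω ≠ 1) :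
    IsPrimitiveRoot ω p := by
  rw [IsPrimitiveRoot.iff_orderOf]
  exact orderOf_eq_prime_iff.2 ⟨h1, h2⟩

theorem exists_zpow_eq {ω ω' : K} (hω : IsPrimitiveRoot ω p) (h1 : ω' ^ p = 1) :
    ∃ j : ℕ, ω' = ω ^ j := by
  have : NeZero p := ⟨hp.out.ne_zero⟩
  obtain ⟨i, -, hi⟩ := hω.eq_pow_of_pow_eq_one h1
  exact ⟨i, hi.symm⟩

/-- The element whose `p`-th root produces a Heisenberg extension attached to `α ^ p` and
`1 - α ^ p`. -/
def steinberg (p : ℕ) (ω : K) (α : M) : M :=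
  ∏ i ∈ Finset.range p, (1 - algebraMap K M ω ^ i * α) ^ i

theorem steinberg_mem_adjoin (p : ℕ) (ω : K) (α : M) :
    steinberg p ω α ∈ IntermediateField.adjoin K {α} := by
  have hα := IntermediateField.mem_adjoin_simple_self K α
  refine prod_mem fun i _ => pow_mem (sub_mem (one_mem _) (mul_mem (pow_mem ?_ _) hα)) _
  exact algebraMap_mem _ _

theorem prod_one_sub_pow_mul {ω : K} (hω : IsPrimitiveRoot ω p) (α : M) :
    ∏ i ∈ Finset.range p, (1 - algebraMap K M ω ^ i * α) = 1 - α ^ p := by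
  have : NeZero p := ⟨hp.out.ne_zero⟩
  have hω' := hω.map_of_injective (algebraMap K M).injective
  have h1 := hω'.pow_sub_pow_eq_prod_sub_mul 1 α hp.out.pos
  rw [one_pow] at h1
  rw [h1]
  refine Finset.prod_bij (fun i _ => algebraMap K M ω ^ i) (fun i _ => ?_) (fun i hi j hj e => ?_)
    (fun z hz => ?_) fun _ _ => rfl
  · rw [Polynomial.mem_nthRootsFinset hp.out.pos, ← pow_mul, mul_comm, pow_mul, hω'.pow_eq_one,
      one_pow]
  · exact hω'.pow_inj (Finset.mem_range.1 hi) (Finset.mem_range.1 hj) e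
  · rw [Polynomial.mem_nthRootsFinset hp.out.pos] at hz
    obtain ⟨i, hi, e⟩ := hω'.eq_pow_of_pow_eq_one hz
    exact ⟨i, Finset.mem_range.2 hi, e⟩

theorem steinberg_ne_zero {ω : K} (hω : IsPrimitiveRoot ω p) {α : M} (hα : 1 - α ^ p ≠ 0) :
    steinberg p ω α ≠ 0 := by
  rw [← prod_one_sub_pow_mul hω, Finset.prod_ne_zero_iff] at hα
  exact Finset.prod_ne_zero_iff.2 fun i hi => pow_ne_zero _ (hα i hi)

theorem apply_steinberg_mul {ω : K} (hω : IsPrimitiveRoot ω p) {α : M} {g : M ≃ₐ[K] M}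
    (hg : g α = algebraMap K M ω * α) :
    g (steinberg p ω α) * (1 - α ^ p) = steinberg p ω α * (1 - α) ^ p := by
  have hω' : algebraMap K M ω ^ p = 1 := by rw [← map_pow, hω.pow_eq_one, map_one]
  have h1 : g (steinberg p ω α) =
      ∏ i ∈ Finset.range p, (1 - algebraMap K M ω ^ (i + 1) * α) ^ i := by
    rw [steinberg, map_prod]
    refine Finset.prod_congr rfl fun i _ => ?_
    rw [map_pow, map_sub, map_one, map_mul, map_pow, AlgEquiv.commutes, hg, ← mul_assoc, pow_succ]
  have h2 : 1 - α ^ p = ∏ i ∈ Finset.range p, (1 - algebraMap K M ω ^ (i + 1) * α) := by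
    have e1 := prod_one_sub_pow_mul hω (algebraMap K M ω * α)
    rw [mul_pow, hω', one_mul] at e1
    rw [← e1]
    exact Finset.prod_congr rfl fun i _ => by rw [pow_succ, mul_assoc]
  have h3 := Finset.prod_range_succ (fun i => (1 - algebraMap K M ω ^ i * α) ^ i) p
  rw [Finset.prod_range_succ', pow_zero, mul_one, hω', one_mul] at h3
  rw [h1, h2, ← Finset.prod_mul_distrib, steinberg, ← h3]
  exact Finset.prod_congr rfl fun i _ => (pow_succ _ _).symm

omit hp in
theorem apply_steinberg_of_fixed {ω : K} {α : M} {g : M ≃ₐ[K] M} (hg : g α = α) :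
    g (steinberg p ω α) = steinberg p ω α := by
  rw [steinberg, map_prod]
  refine Finset.prod_congr rfl fun i _ => ?_
  rw [map_pow, map_sub, map_one, map_mul, map_pow, AlgEquiv.commutes, hg]

omit hp in
theorem exists_pow_eq_of_fixed (h : IsMetaGenerating p ζ x y k) {z : M} {c : K} (hx : x z = z)
    (hy : y z = z) (hz : z ^ p = algebraMap K M c) : ∃ d, d ^ p = c := by
  obtain ⟨d, rfl⟩ := h.exists_eq_of_fixed z hx hy
  exact ⟨d, (algebraMap K M).injective (by rw [map_pow, hz])⟩

theorem pow_apply_eq_self {g : M ≃ₐ[K] M} {z : M} (hg : g z = z) (n : ℕ) : (g ^ n) z = z := by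
  induction n with
  | zero => rfl
  | succ n ih => rw [pow_succ, AlgEquiv.mul_apply, hg, ih]

theorem pow_apply_eq_mul {g : M ≃ₐ[K] M} {z : M} {c : K} (hg : g z = algebraMap K M c * z)
    (n : ℕ) : (g ^ n) z = algebraMap K M (c ^ n) * z := by
  induction n with
  | zero => simp
  | succ n ih =>
    rw [pow_succ, AlgEquiv.mul_apply, hg, map_mul, AlgEquiv.commutes, ih, ← mul_assoc, ← map_mul,
      pow_succ']

omit hp in
theorem pow_one_add_mul_apply {g : M ≃ₐ[K] M} {z : M} (hg : (g ^ p) z = z) (n : ℕ) :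
    (g ^ (1 + p * n)) z = g z := by
  rw [pow_add, pow_one, pow_mul, AlgEquiv.mul_apply, pow_apply_eq_self hg]

/-- If `x` moves a `p`-th root `α` of `a` and `p` is odd, then `x ^ p` fixes the `p`-th root of the
Steinberg element of `α`. -/
theorem pow_apply_eq_self_of_odd (hodd : Odd p) {g : M ≃ₐ[K] M} {ω c d : K}
    (hω : IsPrimitiveRoot ω p) (hc : c ^ p = 1) (hd : d ^ p = 1) {α β δ : M} (hβ0 : β ≠ 0)
    (hαβ : β ^ p = 1 - α ^ p) (hα : g α = algebraMap K M ω * α) (hβ : g β = algebraMap K M c * β)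
    (hδ : g δ * β = algebraMap K M d * (δ * (1 - α))) : (g ^ p) δ = δ := by
  have key : ∀ n : ℕ, (g ^ n) δ * ∏ i ∈ Finset.range n, (algebraMap K M c ^ i * β) =
      algebraMap K M d ^ n * δ * ∏ i ∈ Finset.range n, (1 - algebraMap K M ω ^ i * α) := by
    intro n
    induction n with
    | zero => simp
    | succ n ih =>
      have e := congrArg g ih
      simp only [map_mul, map_prod, map_pow, map_sub, map_one, AlgEquiv.commutes, hα, hβ] at e
      rw [pow_succ', AlgEquiv.mul_apply, Finset.prod_range_succ', Finset.prod_range_succ', pow_zero,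
        pow_zero, one_mul, one_mul]
      have e1 : ∏ i ∈ Finset.range n, (algebraMap K M c ^ (i + 1) * β) =
          ∏ i ∈ Finset.range n, (algebraMap K M c ^ i * (algebraMap K M c * β)) :=
        Finset.prod_congr rfl fun i _ => by ring
      have e2 : ∏ i ∈ Finset.range n, (1 - algebraMap K M ω ^ (i + 1) * α) =
          ∏ i ∈ Finset.range n, (1 - algebraMap K M ω ^ i * (algebraMap K M ω * α)) :=
        Finset.prod_congr rfl fun i _ => by ring
      rw [e1, e2, ← mul_assoc, e, pow_succ]
      linear_combination (algebraMap K M d ^ n *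
        ∏ i ∈ Finset.range n, (1 - algebraMap K M ω ^ i * (algebraMap K M ω * α))) * hδ
  have h1 := key p
  rw [prod_one_sub_pow_mul hω, Finset.prod_mul_distrib, Finset.prod_const, Finset.card_range,
    ← hαβ, Finset.prod_pow_eq_pow_sum, Finset.sum_range_id] at h1
  obtain ⟨m, hm⟩ := hodd
  have h2 : p * (p - 1) / 2 = p * m := by
    have : p - 1 = 2 * m := by omega
    rw [this, mul_left_comm, Nat.mul_div_cancel_left _ two_pos]
  rw [h2, pow_mul, ← map_pow, hc, map_one, one_pow, one_mul, ← map_pow, hd, map_one, one_mul] at h1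
  exact mul_right_cancel₀ (pow_ne_zero p hβ0) h1

theorem isWeaklyRigid_of_odd (h : IsMetaGenerating p ζ x y k) (hodd : Odd p) :
    IsWeaklyRigid {z : K | z ≠ 0 ∧ ∃ w, w ^ p = z} := by
  intro a ha0 haT
  have ha : ¬ ∃ w, w ^ p = a := fun hw => haT ⟨ha0, hw⟩
  have hb0 : 1 - a ≠ 0 := fun e => ha ⟨1, by rw [one_pow]; exact sub_eq_zero.1 e⟩
  obtain ⟨α, hα⟩ := h.exists_root a
  obtain ⟨β, hβ⟩ := h.exists_root (1 - a)
  have hp0 := hp.out.ne_zero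
  have hα0 : α ≠ 0 := by
    rintro rfl
    rw [zero_pow hp0] at hα
    exact ha0 ((map_eq_zero _).1 hα.symm)
  have hβ0 : β ≠ 0 := by
    rintro rfl
    rw [zero_pow hp0] at hβ
    exact hb0 ((map_eq_zero _).1 hβ.symm)
  have hαβ : β ^ p = 1 - α ^ p := by rw [hα, hβ, map_sub, map_one]
  by_contra hno
  push Not at hno
  have hdiv : ∀ n : ℕ, x β * α ^ n = β * x (α ^ n) → y β * α ^ n = β * y (α ^ n) → False := by
    intro n h1 h2
    have hαn := pow_ne_zero n hα0
    have hfix : ∀ g : M ≃ₐ[K] M, g β * α ^ n = β * g (α ^ n) → g (β / α ^ n) = β / α ^ n := by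
      intro g hg
      rw [map_div₀, div_eq_div_iff ((map_ne_zero g).2 hαn) hαn, hg]
    obtain ⟨d, hd⟩ := h.exists_pow_eq_of_fixed (c := (1 - a) / a ^ n) (hfix x h1) (hfix y h2) (by
      rw [div_pow, ← pow_mul, mul_comm n, pow_mul, hα, hβ, map_div₀, map_pow])
    exact hno n ⟨div_ne_zero hb0 (zpow_ne_zero _ ha0), d, by rw [hd, zpow_natCast]⟩
  have hsym : ∀ ω : K, IsPrimitiveRoot ω p → ∃ δ : M, δ ≠ 0 ∧
      (∀ g : M ≃ₐ[K] M, g α = algebraMap K M ω * α → ∃ d : K, d ^ p = 1 ∧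
        g δ * β = algebraMap K M d * (δ * (1 - α))) ∧
      ∀ g : M ≃ₐ[K] M, g α = α → ∃ d : K, d ^ p = 1 ∧ g δ = algebraMap K M d * δ := by
    intro ω hω
    obtain ⟨δ, hδ⟩ := h.exists_root_adjoin α a hα _ (steinberg_mem_adjoin p ω α)
    have hβp : 1 - α ^ p ≠ 0 := hαβ ▸ pow_ne_zero p hβ0
    have hγ := steinberg_ne_zero hω hβp
    have hδ0 : δ ≠ 0 := by
      rintro rfl
      rw [zero_pow hp0] at hδ
      exact hγ hδ.symm
    have hα1 : 1 - α ≠ 0 := by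
      intro e
      rw [← sub_eq_zero.1 e, one_pow, sub_self] at hβp
      exact hβp rfl
    refine ⟨δ, hδ0, fun g hg => h.exists_eq_mul_of_pow_eq (mul_ne_zero hδ0 hα1) ?_, fun g hg =>
      h.exists_eq_mul_of_pow_eq hδ0 ?_⟩
    · rw [mul_pow, mul_pow, ← map_pow, hδ, hαβ, apply_steinberg_mul hω hg]
    · rw [← map_pow, hδ, apply_steinberg_of_fixed hg]
  obtain ⟨ω, hω1, hxα⟩ := h.exists_apply_eq_mul hα0 hα x
  obtain ⟨c, hc1, hxβ⟩ := h.exists_apply_eq_mul hβ0 hβ x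
  have hxβp : (x ^ p) β = β := by rw [pow_apply_eq_mul hxβ, hc1, map_one, one_mul]
  by_cases hω : ω = 1
  · rw [hω, map_one, one_mul] at hxα
    obtain ⟨ω', hω'1, hyα⟩ := h.exists_apply_eq_mul hα0 hα y
    have hω' : ω' ≠ 1 := by
      rintro rfl
      rw [map_one, one_mul] at hyα
      exact ha (h.exists_pow_eq_of_fixed hxα hyα hα)
    have hprim := isPrimitiveRoot_of_ne_one hω'1 hω'
    obtain ⟨c', hc'1, hyβ⟩ := h.exists_apply_eq_mul hβ0 hβ y
    have hc : c ≠ 1 := by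
      rintro rfl
      rw [map_one, one_mul] at hxβ
      obtain ⟨j, rfl⟩ := exists_zpow_eq hprim hc'1
      refine hdiv j ?_ ?_
      · rw [hxβ, map_pow, hxα]
      · rw [hyβ, map_pow, map_pow, hyα, mul_pow]
        ring
    obtain ⟨δ, hδ0, hδ1, hδ2⟩ := hsym ω' hprim
    obtain ⟨d, hd1, hyδ⟩ := hδ1 y hyα
    obtain ⟨e, he1, hxδ⟩ := hδ2 x hxα
    have hxδp : (x ^ p) δ = δ := by rw [pow_apply_eq_mul hxδ, he1, map_one, one_mul]
    have hxαp : (x ^ p) α = α := pow_apply_eq_self hxα p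
    have h1 : y (x δ) = (x ^ (1 + p * k)) (y δ) := by
      rw [← AlgEquiv.mul_apply, h.comm, AlgEquiv.mul_apply]
    have h2 := congrArg (x ^ (1 + p * k)) hyδ
    simp only [map_mul, map_sub, map_one, AlgEquiv.commutes] at h2
    rw [← h1, pow_one_add_mul_apply hxδp, pow_one_add_mul_apply hxαp, pow_one_add_mul_apply hxβp,
      hxα, hxβ, hxδ, map_mul, AlgEquiv.commutes] at h2
    have he0 : algebraMap K M e ≠ 0 := by
      intro e0
      rw [(map_eq_zero _).1 e0, zero_pow hp0] at he1
      exact zero_ne_one he1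
    have h3 : algebraMap K M c * (algebraMap K M e * (y δ * β)) =
        1 * (algebraMap K M e * (y δ * β)) := by
      linear_combination h2 - algebraMap K M e * hyδ
    have h4 := mul_right_cancel₀ (mul_ne_zero he0 (mul_ne_zero ((map_ne_zero y).2 hδ0) hβ0)) h3
    exact hc ((algebraMap K M).injective (h4.trans (map_one _).symm))
  · have hprim := isPrimitiveRoot_of_ne_one hω1 hω
    obtain ⟨j, rfl⟩ := exists_zpow_eq hprim hc1
    obtain ⟨w, hw1, hyα⟩ := h.exists_apply_eq_mul hα0 hα y
    obtain ⟨s, rfl⟩ := exists_zpow_eq hprim hw1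
    obtain ⟨δ, hδ0, hδ1, hδ2⟩ := hsym ω hprim
    obtain ⟨d, hd1, hxδ⟩ := hδ1 x hxα
    have hxδp := pow_apply_eq_self_of_odd hodd hprim hc1 hd1 hβ0 hαβ hxα hxβ hxδ
    set y' := y * x ^ ((p - 1) * s) with hy'
    have hcomm : y' * x = x ^ (1 + p * k) * y' := by
      rw [hy', mul_assoc, ← pow_succ, pow_succ', ← mul_assoc, h.comm, mul_assoc]
    have hy'α : y' α = α := by
      rw [hy', AlgEquiv.mul_apply, pow_apply_eq_mul hxα, map_mul, AlgEquiv.commutes, hyα,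
        ← mul_assoc, ← map_mul, ← pow_add]
      have : (p - 1) * s + s = p * s := by
        rw [← Nat.succ_mul, Nat.succ_eq_add_one, Nat.sub_add_cancel hp.out.one_le]
      rw [this, pow_mul, hω1, one_pow, map_one, one_mul]
    obtain ⟨l, hl1, hy'β⟩ := h.exists_apply_eq_mul hβ0 hβ y'
    obtain ⟨f, hf1, hy'δ⟩ := hδ2 y' hy'α
    have hl : l ≠ 1 := by
      rintro rfl
      rw [map_one, one_mul] at hy'β
      have hz : ∀ z : M, y' z = z → x z = z → y z = z := by
        intro z h1 h2
        rwa [hy', AlgEquiv.mul_apply, pow_apply_eq_self h2] at h1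
      have hαj := pow_ne_zero j hα0
      have hx' : x (β / α ^ j) = β / α ^ j := by
        rw [map_div₀, map_pow, hxα, hxβ, mul_pow, map_pow, mul_div_mul_left]
        exact pow_ne_zero _ ((map_ne_zero _).2 (hprim.ne_zero hp0))
      have hyz : y (β / α ^ j) = β / α ^ j := hz _ (by rw [map_div₀, map_pow, hy'α, hy'β]) hx'
      rw [map_div₀, div_eq_div_iff ((map_ne_zero x).2 hαj) hαj] at hx'
      rw [map_div₀, div_eq_div_iff ((map_ne_zero y).2 hαj) hαj] at hyz
      exact hdiv j hx' hyz
    have h1 : y' (x δ) = (x ^ (1 + p * k)) (y' δ) := by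
      rw [← AlgEquiv.mul_apply, hcomm, AlgEquiv.mul_apply]
    rw [hy'δ, map_mul, AlgEquiv.commutes, pow_one_add_mul_apply hxδp] at h1
    have h2 := congrArg y' hxδ
    simp only [map_mul, map_sub, map_one, AlgEquiv.commutes] at h2
    rw [h1, hy'α, hy'β, hy'δ] at h2
    have hf0 : algebraMap K M f ≠ 0 := by
      intro e0
      rw [(map_eq_zero _).1 e0, zero_pow hp0] at hf1
      exact zero_ne_one hf1
    have h3 : algebraMap K M l * (algebraMap K M f * (x δ * β)) =
        1 * (algebraMap K M f * (x δ * β)) := by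
      linear_combination h2 - algebraMap K M f * hxδ
    have h4 := mul_right_cancel₀ (mul_ne_zero hf0 (mul_ne_zero ((map_ne_zero x).2 hδ0) hβ0)) h3
    exact hl ((algebraMap K M).injective (h4.trans (map_one _).symm))

end IsMetaGenerating

theorem isMulSubgroup_setOf_pow {K : Type*} [Field K] (p : ℕ) :
    IsMulSubgroup {z : K | z ≠ 0 ∧ ∃ w, w ^ p = z} where
  one_mem := ⟨one_ne_zero, 1, one_pow p⟩
  mul_mem := by
    rintro _ _ ⟨hx, u, rfl⟩ ⟨hy, v, rfl⟩
    exact ⟨mul_ne_zero hx hy, u * v, mul_pow u v p⟩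
  inv_mem := by
    rintro _ ⟨hx, u, rfl⟩
    exact ⟨inv_ne_zero hx, u⁻¹, inv_pow u p⟩
  zero_notMem h := h.1 rfl

namespace IsMetaGenerating

section Two

variable {K M : Type*} [Field K] [Field M] [Algebra K M] {ζ : K} {x y : M ≃ₐ[K] M} {k : ℕ}

theorem neg_one_ne_one (h : IsMetaGenerating 2 ζ x y k) : (-1 : K) ≠ 1 := by
  have := h.isPrimitiveRoot.eq_neg_one_of_two_right
  exact this ▸ h.isPrimitiveRoot.ne_one one_lt_two

theorem neg_ne_self (h : IsMetaGenerating 2 ζ x y k) {z : M} (hz : z ≠ 0) : -z ≠ z := by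
  intro e
  refine h.neg_one_ne_one ((algebraMap K M).injective (mul_right_cancel₀ hz ?_))
  rw [map_neg, map_one, neg_mul, one_mul, e]

theorem apply_eq_or_eq_neg {z : M} {c : K} (hz : z ^ 2 = algebraMap K M c) (g : M ≃ₐ[K] M) :
    g z = z ∨ g z = -z :=
  sq_eq_sq_iff_eq_or_eq_neg.1 (by rw [← map_pow, hz, AlgEquiv.commutes])

/-- The classical description of the dihedral extension attached to a norm equation
`b = m ^ 2 - a * n ^ 2`. -/
theorem apply_eq_neg_of_norm (h : IsMetaGenerating 2 ζ x y k) {a b m n : K}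
    (hb : b = m ^ 2 - a * n ^ 2) (ha1 : ¬ ∃ w, w ^ 2 = a) (hb1 : ¬ ∃ w, w ^ 2 = b)
    (hab1 : ¬ ∃ w, w ^ 2 = a * b) {α β : M} (hα : α ^ 2 = algebraMap K M a)
    (hβ : β ^ 2 = algebraMap K M b) : x α = -α ∧ x β = -β ∧ Odd k := by
  have hαβ : (α * β) ^ 2 = algebraMap K M (a * b) := by rw [mul_pow, hα, hβ, map_mul]
  have hβ0 : β ≠ 0 := by
    rintro rfl
    exact hb1 ⟨0, (algebraMap K M).injective (by rw [map_pow, map_zero, hβ])⟩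
  have hωω : (algebraMap K M m + algebraMap K M n * α) *
      (algebraMap K M m - algebraMap K M n * α) = β ^ 2 := by
    rw [hβ, hb, map_sub, map_mul, map_pow, map_pow, ← hα]
    ring
  obtain ⟨δ, hδ⟩ := h.exists_root_adjoin α a hα (algebraMap K M m + algebraMap K M n * α)
    (add_mem (algebraMap_mem _ _)
      (mul_mem (algebraMap_mem _ _) (IntermediateField.mem_adjoin_simple_self K α)))
  have hδ0 : δ ≠ 0 := by
    rintro rfl
    rw [← hδ, zero_pow two_ne_zero, zero_mul] at hωω
    exact hβ0 (pow_eq_zero_iff two_ne_zero |>.1 hωω.symm)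
  have hmove : ∀ g : M ≃ₐ[K] M, g α = -α →
      ∃ c : K, c ^ 2 = 1 ∧ g δ * δ = algebraMap K M c * β := by
    intro g hg
    refine h.exists_eq_mul_of_pow_eq hβ0 ?_
    rw [mul_pow, ← map_pow, hδ, map_add, map_mul, AlgEquiv.commutes, AlgEquiv.commutes, hg, ← hωω]
    ring
  have hfix : ∀ g : M ≃ₐ[K] M, g α = α → ∃ c : K, c ^ 2 = 1 ∧ g δ = algebraMap K M c * δ := by
    intro g hg
    refine h.exists_eq_mul_of_pow_eq hδ0 ?_
    rw [← map_pow, hδ, map_add, map_mul, AlgEquiv.commutes, AlgEquiv.commutes, hg]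
  have hxxβ : (x ^ 2) β = β := by
    rw [pow_two, AlgEquiv.mul_apply]
    rcases apply_eq_or_eq_neg hβ x with e | e
    · rw [e, e]
    · rw [e, map_neg, e, neg_neg]
  rcases apply_eq_or_eq_neg hα x with hxα | hxα
  · exfalso
    have hyα : y α = -α := (apply_eq_or_eq_neg hα y).resolve_left fun e =>
      ha1 (h.exists_pow_eq_of_fixed hxα e hα)
    have hxβ : x β = -β := (apply_eq_or_eq_neg hβ x).resolve_left fun e => by
      rcases apply_eq_or_eq_neg hβ y with e' | e'
      · exact hb1 (h.exists_pow_eq_of_fixed e e' hβ)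
      · exact hab1 (h.exists_pow_eq_of_fixed (by rw [map_mul, hxα, e])
          (by rw [map_mul, hyα, e', neg_mul_neg]) hαβ)
    obtain ⟨e, he, hxδ⟩ := hfix x hxα
    obtain ⟨c, hc, hyδ⟩ := hmove y hyα
    have hxxδ : (x ^ 2) δ = δ := by rw [pow_apply_eq_mul hxδ, he, map_one, one_mul]
    have h1 : y (x δ) = (x ^ (1 + 2 * k)) (y δ) := by
      rw [← AlgEquiv.mul_apply, h.comm, AlgEquiv.mul_apply]
    have h2 := congrArg (x ^ (1 + 2 * k)) hyδ
    rw [map_mul, ← h1, map_mul, AlgEquiv.commutes, pow_one_add_mul_apply hxxδ,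
      pow_one_add_mul_apply hxxβ, hxβ, hxδ, map_mul, AlgEquiv.commutes] at h2
    have he' : algebraMap K M e ^ 2 = 1 := by rw [← map_pow, he, map_one]
    refine h.neg_ne_self (mul_ne_zero ((map_ne_zero y).2 hδ0) hδ0) ?_
    linear_combination -h2 - hyδ + y δ * δ * he'
  · obtain ⟨c, hc, hxδ⟩ := hmove x hxα
    obtain ⟨s, hs, hxβ⟩ := h.exists_apply_eq_mul hβ0 hβ x
    have hxδ0 := (map_ne_zero x).2 hδ0
    have hxxδ : (x ^ 2) δ = algebraMap K M s * δ := by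
      have e := congrArg x hxδ
      rw [map_mul, map_mul, AlgEquiv.commutes, hxβ] at e
      rw [pow_two, AlgEquiv.mul_apply]
      refine mul_right_cancel₀ hxδ0 ?_
      linear_combination e - algebraMap K M s * hxδ
    obtain ⟨y', hy'α, hcomm, hy'⟩ : ∃ y' : M ≃ₐ[K] M, y' α = α ∧ y' * x = x ^ (1 + 2 * k) * y' ∧
        ∀ z, x z = z → y' z = z → y z = z := by
      rcases apply_eq_or_eq_neg hα y with e | e
      · exact ⟨y, e, h.comm, fun z _ hz => hz⟩
      · refine ⟨y * x, ?_, ?_, fun z hz hz' => ?_⟩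
        · rw [AlgEquiv.mul_apply, hxα, map_neg, e, neg_neg]
        · rw [← mul_assoc, ← h.comm]
        · rwa [AlgEquiv.mul_apply, hz] at hz'
    have hy'β : y' β = -β := (apply_eq_or_eq_neg hβ y').resolve_left fun e => by
      rcases apply_eq_or_eq_neg hβ x with e' | e'
      · exact hb1 (h.exists_pow_eq_of_fixed e' (hy' _ e' e) hβ)
      · have e1 : x (α * β) = α * β := by rw [map_mul, hxα, e', neg_mul_neg]
        exact hab1 (h.exists_pow_eq_of_fixed e1 (hy' _ e1 (by rw [map_mul, hy'α, e])) hαβ)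
    obtain ⟨f, hf, hy'δ⟩ := hfix y' hy'α
    have hsk : algebraMap K M (s ^ k) = -1 := by
      have h1 : y' (x δ) = (x ^ (1 + 2 * k)) (y' δ) := by
        rw [← AlgEquiv.mul_apply, hcomm, AlgEquiv.mul_apply]
      rw [hy'δ, map_mul, AlgEquiv.commutes, pow_add, pow_one, pow_mul, AlgEquiv.mul_apply,
        pow_apply_eq_mul hxxδ, map_mul, AlgEquiv.commutes] at h1
      have h2 := congrArg y' hxδ
      rw [map_mul, h1, hy'δ, map_mul, AlgEquiv.commutes, hy'β] at h2
      have hf' : algebraMap K M f ^ 2 = 1 := by rw [← map_pow, hf, map_one]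
      refine mul_right_cancel₀ (mul_ne_zero hxδ0 hδ0) ?_
      linear_combination h2 + hxδ - algebraMap K M (s ^ k) * x δ * δ * hf'
    have hsk' : s ^ k = -1 := (algebraMap K M).injective (by rw [hsk, map_neg, map_one])
    have hs1 : s = -1 := (sq_eq_one_iff.1 hs).resolve_left fun e => by
      rw [e, one_pow] at hsk'
      exact h.neg_one_ne_one hsk'.symm
    refine ⟨hxα, by rw [hxβ, hs1, map_neg, map_one, neg_one_mul], ?_⟩
    rw [← Nat.not_even_iff_odd]
    intro hk
    rw [hs1, hk.neg_one_pow] at hsk'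
    exact h.neg_one_ne_one hsk'.symm

theorem even_of_neg_one_eq_sq (h : IsMetaGenerating 2 ζ x y k) {i : K} (hi : i ^ 2 = -1) :
    Even k := by
  have hζ := h.isPrimitiveRoot.eq_neg_one_of_two_right
  obtain ⟨α, hα0, hxα, hyα⟩ := h.exists_left
  rw [hζ, map_neg, map_one, neg_one_mul] at hxα
  obtain ⟨a, ha⟩ := h.exists_eq_of_fixed (α ^ 2) (by rw [map_pow, hxα, neg_sq])
    (by rw [map_pow, hyα])
  obtain ⟨δ, hδ⟩ := h.exists_root_adjoin α a ha.symm α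
    (IntermediateField.mem_adjoin_simple_self K α)
  have hδ0 : δ ≠ 0 := by
    rintro rfl
    exact hα0 (hδ.symm.trans (zero_pow two_ne_zero))
  have hi' : algebraMap K M i ^ 2 = -1 := by rw [← map_pow, hi, map_neg, map_one]
  have hi0 : algebraMap K M i ≠ 0 := by
    intro e
    rw [e, zero_pow two_ne_zero, eq_comm, neg_eq_zero] at hi'
    exact one_ne_zero hi'
  obtain ⟨c, hc, hxδ⟩ := h.exists_eq_mul_of_pow_eq (u := x δ) (v := algebraMap K M i * δ)
    (mul_ne_zero hi0 hδ0) (by rw [mul_pow, hi', ← map_pow, hδ, hxα, neg_one_mul])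
  obtain ⟨f, hf, hyδ⟩ := h.exists_eq_mul_of_pow_eq (u := y δ) (v := δ) hδ0
    (by rw [← map_pow, hδ, hyα])
  rw [← mul_assoc, ← map_mul] at hxδ
  have hxxδ : (x ^ 2) δ = algebraMap K M (-1) * δ := by
    rw [pow_apply_eq_mul hxδ, mul_pow, hc, hi, one_mul]
  have h1 : y (x δ) = (x ^ (1 + 2 * k)) (y δ) := by
    rw [← AlgEquiv.mul_apply, h.comm, AlgEquiv.mul_apply]
  rw [hyδ, map_mul, AlgEquiv.commutes, pow_add, pow_one, pow_mul, AlgEquiv.mul_apply,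
    pow_apply_eq_mul hxxδ, map_mul, AlgEquiv.commutes, hxδ, map_mul, AlgEquiv.commutes, hyδ] at h1
  by_contra hk
  rw [Nat.not_even_iff_odd] at hk
  rw [hk.neg_one_pow, map_neg, map_one] at h1
  have hne : algebraMap K M (c * i) * (algebraMap K M f * δ) ≠ 0 := by
    rw [← hyδ, ← AlgEquiv.commutes y, ← map_mul, ← hxδ]
    exact (map_ne_zero _).2 ((map_ne_zero _).2 hδ0)
  refine h.neg_ne_self hne ?_
  linear_combination -h1

theorem isRigidOutside_of_neg_one_mem (h : IsMetaGenerating 2 ζ x y k) {i : K}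
    (hi : i ^ 2 = -1) :
    IsRigidOutside {z : K | z ≠ 0 ∧ ∃ w, w ^ 2 = z} {z : K | z ≠ 0 ∧ ∃ w, w ^ 2 = z} := by
  intro z hz0 hz
  have hz1 : ¬ ∃ w, w ^ 2 = z := fun e => hz ⟨hz0, e⟩
  have hb0 : 1 + z ≠ 0 := fun e => hz1 ⟨i, by rw [hi]; linear_combination -e⟩
  have hi0 : i ≠ 0 := by
    rintro rfl
    rw [zero_pow two_ne_zero, eq_comm, neg_eq_zero] at hi
    exact one_ne_zero hi
  by_contra! hcon
  obtain ⟨α, hα⟩ := h.exists_root (-z)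
  obtain ⟨β, hβ⟩ := h.exists_root (1 + z)
  refine Nat.not_even_iff_odd.2 (h.apply_eq_neg_of_norm (a := -z) (b := 1 + z) (m := 1) (n := 1)
    (by ring) ?_ (fun e => hcon.1 ⟨hb0, e⟩) ?_ hα hβ).2.2 (h.even_of_neg_one_eq_sq hi)
  · rintro ⟨w, hw⟩
    exact hz1 ⟨i * w, by rw [mul_pow, hi, hw]; ring⟩
  · rintro ⟨w, hw⟩
    refine hcon.2 ⟨div_ne_zero hb0 hz0, i * w / z, ?_⟩
    rw [div_pow, mul_pow, hi, hw]
    field_simp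

theorem apply_sqrt_neg_one (h : IsMetaGenerating 2 ζ x y k) (hi : ¬ ∃ w : K, w ^ 2 = -1) {i : M}
    (hi2 : i ^ 2 = -1) : x i = i ∧ y i = -i := by
  have hζ := h.isPrimitiveRoot.eq_neg_one_of_two_right
  have hi' : i ^ 2 = algebraMap K M (-1) := by rw [hi2, map_neg, map_one]
  suffices hxi : x i = i from
    ⟨hxi, (apply_eq_or_eq_neg hi' y).resolve_left fun e =>
      hi (h.exists_pow_eq_of_fixed hxi e hi')⟩
  obtain ⟨α, hα0, hxα, hyα⟩ := h.exists_left
  obtain ⟨β, hβ0, hxβ, hyβ⟩ := h.exists_right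
  rw [hζ, map_neg, map_one, neg_one_mul] at hxα hyβ
  obtain ⟨a, ha⟩ := h.exists_eq_of_fixed (α ^ 2) (by rw [map_pow, hxα, neg_sq])
    (by rw [map_pow, hyα])
  obtain ⟨b, hb⟩ := h.exists_eq_of_fixed (β ^ 2) (by rw [map_pow, hxβ])
    (by rw [map_pow, hyβ, neg_sq])
  have ha1 : ¬ ∃ w, w ^ 2 = a := by
    rintro ⟨w, rfl⟩
    rw [map_pow, eq_comm, sq_eq_sq_iff_eq_or_eq_neg] at ha
    rcases ha with rfl | rfl
    · rw [AlgEquiv.commutes] at hxα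
      exact h.neg_ne_self hα0 hxα.symm
    · rw [map_neg, AlgEquiv.commutes] at hxα
      exact h.neg_ne_self hα0 hxα.symm
  have hb1 : ¬ ∃ w, w ^ 2 = b := by
    rintro ⟨w, rfl⟩
    rw [map_pow, eq_comm, sq_eq_sq_iff_eq_or_eq_neg] at hb
    rcases hb with rfl | rfl
    · rw [AlgEquiv.commutes] at hyβ
      exact h.neg_ne_self hβ0 hyβ.symm
    · rw [map_neg, AlgEquiv.commutes] at hyβ
      exact h.neg_ne_self hβ0 hyβ.symm
  obtain ⟨z, hz1, hz2⟩ : ∃ z : K, (¬ ∃ w, w ^ 2 = z) ∧ ¬ ∃ w, w ^ 2 = -z := by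
    by_contra! hcon
    obtain ⟨u, hu⟩ := hcon a (fun w hw => ha1 ⟨w, hw⟩)
    obtain ⟨v, hv⟩ := hcon b (fun w hw => hb1 ⟨w, hw⟩)
    have e : (α * β) ^ 2 = algebraMap K M (u * v) ^ 2 := by
      rw [mul_pow, ← ha, ← hb, ← map_mul, ← map_pow, mul_pow, hu, hv, neg_mul_neg]
    rw [sq_eq_sq_iff_eq_or_eq_neg] at e
    have e1 : x (α * β) = α * β := by
      rcases e with e | e
      · rw [e, AlgEquiv.commutes]
      · rw [e, map_neg, AlgEquiv.commutes]
    rw [map_mul, hxα, hxβ, neg_mul] at e1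
    exact h.neg_ne_self (mul_ne_zero hα0 hβ0) e1
  obtain ⟨u, hu⟩ := h.exists_root z
  have hz0 : z ≠ 0 := by
    rintro rfl
    exact hz1 ⟨0, zero_pow two_ne_zero⟩
  have hu0 : u ≠ 0 := by
    rintro rfl
    rw [zero_pow two_ne_zero] at hu
    exact hz0 ((map_eq_zero _).1 hu.symm)
  obtain ⟨e1, e2, -⟩ := h.apply_eq_neg_of_norm (a := z) (b := -z) (m := 0) (n := 1) (α := u)
    (β := i * u) (by ring) hz1 hz2 (by
      rintro ⟨w, hw⟩
      refine hi ⟨w / z, ?_⟩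
      rw [div_pow, hw]
      field_simp) hu (by rw [mul_pow, hi2, hu, map_neg, neg_one_mul])
  rw [map_mul, e1, mul_neg, neg_inj] at e2
  exact mul_right_cancel₀ hu0 e2

theorem one_sub_mem_of_neg_one_notMem (h : IsMetaGenerating 2 ζ x y k)
    (hi : ¬ ∃ w : K, w ^ 2 = -1) {z : K} (hz0 : z ≠ 0) (hz1 : ¬ ∃ w, w ^ 2 = z) :
    (∃ w, w ^ 2 = 1 - z) ∨ (∃ w, w ^ 2 = (1 - z) / z) ∨ ∃ w, w ^ 2 = -(1 - z) / z := by
  by_contra! hcon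
  obtain ⟨h1, h2, h3⟩ := hcon
  obtain ⟨i, hi2⟩ := h.exists_root (-1)
  rw [map_neg, map_one] at hi2
  obtain ⟨hxi, hyi⟩ := h.apply_sqrt_neg_one hi hi2
  obtain ⟨u, hu⟩ := h.exists_root z
  obtain ⟨v, hv⟩ := h.exists_root (1 - z)
  have hu0 : u ≠ 0 := by
    rintro rfl
    rw [zero_pow two_ne_zero] at hu
    exact hz0 ((map_eq_zero _).1 hu.symm)
  obtain ⟨hxu, hxv, -⟩ := h.apply_eq_neg_of_norm (a := z) (b := 1 - z) (m := 1) (n := 1)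
    (by ring) hz1 (fun ⟨w, hw⟩ => h1 w hw) (fun ⟨w, hw⟩ => h2 (w / z) (by
      rw [div_pow, hw]
      field_simp)) hu hv
  have hx : x (v / u) = v / u := by rw [map_div₀, hxu, hxv, neg_div_neg_eq]
  have hvu : (v / u) ^ 2 = algebraMap K M ((1 - z) / z) := by rw [div_pow, hu, hv, map_div₀]
  rcases apply_eq_or_eq_neg hvu y with hy | hy
  · obtain ⟨w, hw⟩ := h.exists_pow_eq_of_fixed hx hy hvu
    exact h2 w hw
  · obtain ⟨w, hw⟩ := h.exists_pow_eq_of_fixed (z := i * (v / u)) (c := -(1 - z) / z)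
      (by rw [map_mul, hxi, hx]) (by rw [map_mul, hyi, hy, neg_mul_neg])
      (by rw [mul_pow, hi2, hvu, neg_div, map_neg, neg_one_mul])
    exact h3 w hw

theorem add_mem_of_neg_one_notMem (h : IsMetaGenerating 2 ζ x y k)
    (hi : ¬ ∃ w : K, w ^ 2 = -1) (s t : K) :
    (∃ w, w ^ 2 = s ^ 2 + t ^ 2) ∨ ∃ w, w ^ 2 = -(s ^ 2 + t ^ 2) := by
  by_contra! hcon
  obtain ⟨i, hi2⟩ := h.exists_root (-1)
  obtain ⟨β, hβ⟩ := h.exists_root (s ^ 2 + t ^ 2)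
  have h1 := (h.apply_eq_neg_of_norm (a := -1) (b := s ^ 2 + t ^ 2) (m := s) (n := t) (by ring) hi
    (fun ⟨w, hw⟩ => hcon.1 w hw) (fun ⟨w, hw⟩ => hcon.2 w (by rw [hw, neg_one_mul])) hi2 hβ).1
  rw [map_neg, map_one] at hi2
  rw [(h.apply_sqrt_neg_one hi hi2).1] at h1
  refine h.neg_ne_self ?_ h1.symm
  rintro rfl
  rw [zero_pow two_ne_zero, eq_comm, neg_eq_zero] at hi2
  exact one_ne_zero hi2

theorem exists_one_add_add_eq_zero (h : IsMetaGenerating 2 ζ x y k)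
    (hi : ¬ ∃ w : K, w ^ 2 = -1) {e : M} (he0 : e ≠ 0) (hxe : x e = e) (hxye : x (y e) = y e)
    (hyye : y (y e) = -e) : ∃ s t : K, s ≠ 0 ∧ t ≠ 0 ∧ 1 + s ^ 2 + t ^ 2 = 0 := by
  obtain ⟨i, hi2⟩ := h.exists_root (-1)
  rw [map_neg, map_one] at hi2
  obtain ⟨hxi, hyi⟩ := h.apply_sqrt_neg_one hi hi2
  have hi0 : i ≠ 0 := by
    rintro rfl
    rw [zero_pow two_ne_zero, eq_comm, neg_eq_zero] at hi2
    exact one_ne_zero hi2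
  have h2 : (2 : M) ≠ 0 := by
    intro e2
    refine h.neg_ne_self (one_ne_zero (α := M)) ?_
    linear_combination -e2
  obtain ⟨s, hs⟩ := h.exists_eq_of_fixed (e * y e / i)
    (by rw [map_div₀, map_mul, hxe, hxye, hxi])
    (by rw [map_div₀, map_mul, hyye, hyi]; field_simp)
  obtain ⟨A, hA⟩ := h.exists_eq_of_fixed ((e ^ 2 + y e ^ 2) / 2)
    (by rw [map_div₀, map_add, map_pow, map_pow, hxe, hxye, map_ofNat])
    (by rw [map_div₀, map_add, map_pow, map_pow, hyye, map_ofNat, neg_sq, add_comm])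
  obtain ⟨B, hB⟩ := h.exists_eq_of_fixed ((e ^ 2 - y e ^ 2) / (2 * i))
    (by rw [map_div₀, map_sub, map_mul, map_pow, map_pow, hxe, hxye, map_ofNat, hxi])
    (by
      rw [map_div₀, map_sub, map_mul, map_pow, map_pow, hyye, map_ofNat, hyi]
      field_simp
      ring)
  have hs0 : s ≠ 0 := by
    rintro rfl
    rw [map_zero, eq_comm, div_eq_zero_iff, mul_eq_zero] at hs
    rcases hs with (hs | hs) | hs
    · exact he0 hs
    · exact he0 ((map_eq_zero y).1 hs)
    · exact hi0 hs
  have hsum : s ^ 2 + A ^ 2 + B ^ 2 = 0 := by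
    apply (algebraMap K M).injective
    rw [map_add, map_add, map_pow, map_pow, map_pow, hs, hA, hB, map_zero, div_pow, div_pow,
      div_pow, mul_pow, mul_pow, hi2]
    field_simp
    ring
  refine ⟨A / s, B / s, div_ne_zero ?_ hs0, div_ne_zero ?_ hs0, ?_⟩
  · rintro rfl
    refine hi ⟨B / s, ?_⟩
    rw [div_pow, div_eq_iff (pow_ne_zero 2 hs0)]
    linear_combination hsum
  · rintro rfl
    refine hi ⟨A / s, ?_⟩
    rw [div_pow, div_eq_iff (pow_ne_zero 2 hs0)]
    linear_combination hsum
  · rw [div_pow, div_pow]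
    field_simp
    linear_combination hsum

end Two

theorem exists_isRigidPair {p : ℕ} [hp : Fact p.Prime] {K M : Type*} [Field K] [Field M]
    [Algebra K M] {ζ : K} {x y : M ≃ₐ[K] M} {k : ℕ} (h : IsMetaGenerating p ζ x y k)
    (he : p = 2 → ∃ e ≠ 0, x e = e ∧ x (y e) = y e ∧ y (y e) = -e) :
    ∃ a ≠ 0, IsRigidPair {z : K | z ≠ 0 ∧ ∃ w, w ^ p = z}
      (lineSpan {z : K | z ≠ 0 ∧ ∃ w, w ^ p = z} a) := by
  have hT := isMulSubgroup_setOf_pow (K := K) p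
  have hTp : ∀ z : K, z ≠ 0 → z ^ p ∈ {z : K | z ≠ 0 ∧ ∃ w, w ^ p = z} := fun z hz =>
    ⟨pow_ne_zero p hz, z, rfl⟩
  rcases hp.out.eq_two_or_odd' with rfl | hodd
  · by_cases hi : ∃ i : K, i ^ 2 = -1
    · obtain ⟨i, hi⟩ := hi
      exact exists_isRigidPair_of_neg_one_mem hT hTp ⟨neg_ne_zero.2 one_ne_zero, i, hi⟩
        (h.isRigidOutside_of_neg_one_mem hi)
    · obtain ⟨e, he0, hxe, hxye, hyye⟩ := he rfl
      refine ⟨-1, neg_ne_zero.2 one_ne_zero, isRigidPair_of_neg_one_notMem hT (fun e => hi e.2)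
        (fun z hz0 hz => ?_) ?_ ?_⟩
      · have hz1 : ¬ ∃ w, w ^ 2 = z := fun e => hz ⟨hz0, e⟩
        have hz2 : 1 - z ≠ 0 := fun e => hz1 ⟨1, by rw [one_pow]; exact sub_eq_zero.1 e⟩
        exact (h.one_sub_mem_of_neg_one_notMem hi hz0 hz1).imp (fun e => ⟨hz2, e⟩)
          (Or.imp (fun e => ⟨div_ne_zero hz2 hz0, e⟩)
            fun e => ⟨div_ne_zero (neg_ne_zero.2 hz2) hz0, e⟩)
      · rintro _ ⟨-, s, rfl⟩ _ ⟨-, t, rfl⟩ hst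
        exact (h.add_mem_of_neg_one_notMem hi s t).imp (fun e => ⟨hst, e⟩)
          fun e => ⟨neg_ne_zero.2 hst, e⟩
      · obtain ⟨s, t, hs, ht, hst⟩ := h.exists_one_add_add_eq_zero hi he0 hxe hxye hyye
        exact ⟨s ^ 2, hTp s hs, t ^ 2, hTp t ht, hst⟩
  · exact exists_isRigidPair_of_odd hodd hT hTp (h.isWeaklyRigid_of_odd hodd)

end IsMetaGenerating

theorem apply_sum_mul_apply {F M A : Type*} [Field F] [Field M] [Algebra F M] [Group A]
    [Fintype (M ≃ₐ[F] M)] (π : (M ≃ₐ[F] M) →* A) (f : A → ℤ) (θ : M) (h : M ≃ₐ[F] M) :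
    h (∑ g, (f (π g) : M) * g θ) = ∑ g, (f ((π h)⁻¹ * π g) : M) * g θ := by
  rw [map_sum]
  refine Fintype.sum_bijective (h * ·) (Group.mulLeft_bijective h) _ _ fun g => ?_
  rw [map_mul, map_intCast, map_mul π, inv_mul_cancel_left, AlgEquiv.mul_apply]

theorem exists_apply_apply_eq_neg {F M : Type*} [Field F] [Field M] [Algebra F M]
    [Finite (M ≃ₐ[F] M)] (π : (M ≃ₐ[F] M) →* Multiplicative (ZMod (2 ^ 2))) {x y : M ≃ₐ[F] M}
    (hx : π x = 1) (hy : π y = Multiplicative.ofAdd 1) :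
    ∃ e ≠ 0, x e = e ∧ x (y e) = y e ∧ y (y e) = -e := by
  have := Fintype.ofFinite (M ≃ₐ[F] M)
  let f : Multiplicative (ZMod (2 ^ 2)) → ℤ := fun n =>
    if n = 1 then 1 else if n = Multiplicative.ofAdd 2 then -1 else 0
  have hf : ∀ n, f ((Multiplicative.ofAdd 1)⁻¹ * ((Multiplicative.ofAdd 1)⁻¹ * n)) = -f n := by
    decide
  obtain ⟨θ, hθ⟩ := exists_sum_mul_apply_ne_zero (f := fun g : M ≃ₐ[F] M => (f (π g) : M))
    fun e => by
      have := congr_fun e 1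
      simp [f] at this
  have hye := apply_sum_mul_apply π f θ y
  refine ⟨_, hθ, ?_, ?_, ?_⟩
  · rw [apply_sum_mul_apply π f θ x, hx, inv_one]
    simp only [one_mul]
  · rw [hye, apply_sum_mul_apply π (fun n => f ((π y)⁻¹ * n)) θ x, hx, inv_one]
    simp only [one_mul]
  · rw [hye, apply_sum_mul_apply π (fun n => f ((π y)⁻¹ * n)) θ y, ← Finset.sum_neg_distrib]
    refine Finset.sum_congr rfl fun g _ => ?_
    rw [hy, hf, Int.cast_neg, neg_mul]

theorem exists_metaAbExt_pow_eq {E : Type*} [Field E] {p : ℕ} [hp : Fact p.Prime] {ζ : E}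
    (hζ : IsPrimitiveRoot ζ p) {γ : metaAbExt p E}
    (hγ : (γ : AlgebraicClosure E) ∈ elemAbExt p E (AlgebraicClosure E)) : ∃ δ, δ ^ p = γ := by
  obtain ⟨δ, hδ⟩ := IsAlgClosed.exists_pow_nat_eq (γ : AlgebraicClosure E) hp.out.pos
  exact ⟨⟨δ, mem_metaAbExt_of_pow_mem hζ (hδ ▸ hγ)⟩, Subtype.ext hδ⟩

theorem exists_isMetaGenerating {K : Type*} [Field K] {p : ℕ} [hp : Fact p.Prime] {ζ : K}
    (hζ : IsPrimitiveRoot ζ p)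
    {θ : Multiplicative (ZMod (p ^ 2)) →* MulAut (Multiplicative (ZMod (p ^ 2)))}
    (e : (metaAbExt p K ≃ₐ[K] metaAbExt p K) ≃* SemidirectProduct (Multiplicative (ZMod (p ^ 2)))
      (Multiplicative (ZMod (p ^ 2))) θ) :
    ∃ (x y : metaAbExt p K ≃ₐ[K] metaAbExt p K) (k : ℕ), IsMetaGenerating p ζ x y k ∧
      (p = 2 → ∃ e ≠ 0, x e = e ∧ x (y e) = y e ∧ y (y e) = -e) := by
  have hgal := isGalois_metaAbExt hζ
  have hne : NeZero (p ^ 2) := ⟨pow_ne_zero 2 hp.out.ne_zero⟩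
  have hfinSD : Finite (SemidirectProduct (Multiplicative (ZMod (p ^ 2)))
      (Multiplicative (ZMod (p ^ 2))) θ) := Finite.of_equiv _ SemidirectProduct.equivProd.symm
  have hfin : Finite (metaAbExt p K ≃ₐ[K] metaAbExt p K) := Finite.of_equiv _ e.toEquiv.symm
  obtain ⟨x, y, k, π, ε, hcomm, hgen, hπx, hπy, hεx, hεy⟩ :=
    exists_generators_of_semidirectProduct e
  refine ⟨x, y, k, ⟨hζ, hcomm, fun z hx hy => ?_, ?_, ?_, fun a => ?_, fun α a hα γ hγ => ?_⟩, ?_⟩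
  · refine (InfiniteGalois.mem_range_algebraMap_iff_fixed z).2 fun g => ?_
    obtain ⟨m, n, rfl⟩ := hgen g
    rw [AlgEquiv.mul_apply, IsMetaGenerating.pow_apply_eq_self hy,
      IsMetaGenerating.pow_apply_eq_self hx]
  · obtain ⟨χ, hχ⟩ := exists_monoidHom_ofAdd_one_eq (p := p) (z := (hζ.isUnit hp.out.ne_zero).unit)
      (Units.ext (by simpa using hζ.pow_eq_one))
    obtain ⟨α, hα0, hα⟩ := exists_ne_zero_forall_apply_eq_mul (χ.comp ε)
    refine ⟨α, hα0, ?_, ?_⟩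
    · rw [hα, MonoidHom.comp_apply, hεx, hχ]
      rfl
    · rw [hα, MonoidHom.comp_apply, hεy, map_one, Units.val_one, map_one, one_mul]
  · obtain ⟨χ, hχ⟩ := exists_monoidHom_ofAdd_one_eq (p := p ^ 2)
      (z := (hζ.isUnit hp.out.ne_zero).unit)
      (Units.ext (by rw [pow_two, pow_mul]; simp [hζ.pow_eq_one]))
    obtain ⟨α, hα0, hα⟩ := exists_ne_zero_forall_apply_eq_mul (χ.comp π)
    refine ⟨α, hα0, ?_, ?_⟩
    · rw [hα, MonoidHom.comp_apply, hπx, map_one, Units.val_one, map_one, one_mul]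
    · rw [hα, MonoidHom.comp_apply, hπy, hχ]
      rfl
  · exact exists_metaAbExt_pow_eq hζ ((elemAbExt p K (AlgebraicClosure K)).algebraMap_mem a)
  · refine exists_metaAbExt_pow_eq hζ ?_
    have h1 : (γ : AlgebraicClosure K) ∈
        (IntermediateField.adjoin K {α}).map (metaAbExt p K).val := ⟨γ, hγ, rfl⟩
    rw [IntermediateField.adjoin_map, Set.image_singleton] at h1
    refine IntermediateField.adjoin_le_iff.2 ?_ h1
    rintro _ rfl
    exact mem_elemAbExt_of_pow_eq hζ (a := a) (by
      rw [← map_pow, hα]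
      rfl)
  · rintro rfl
    exact exists_apply_apply_eq_neg π hπx hπy

section ResidueExtension

open Polynomial IntermediateField

theorem adjoin_root_of_irreducible {k Ω : Type*} [Field k] [Field Ω] [Algebra k Ω] {n : ℕ}
    (hn0 : n ≠ 0) (hn : (n : k) ≠ 0) {a : k} (ha : a ≠ 0) (hirr : Irreducible (X ^ n - C a)) {α : Ω}
    (hα : α ^ n = algebraMap k Ω a) :
    FiniteDimensional k k⟮α⟯ ∧ Algebra.IsSeparable k k⟮α⟯ ∧ Module.finrank k k⟮α⟯ = n := by
  have hm : (X ^ n - C a).Monic := monic_X_pow_sub_C a hn0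
  have h0 : aeval α (X ^ n - C a) = 0 := by simp [hα]
  have hαint : IsIntegral k α := ⟨_, hm, h0⟩
  have hmin := minpoly.eq_of_irreducible_of_monic hirr h0 hm
  refine ⟨adjoin.finiteDimensional hαint, ?_, ?_⟩
  · rw [isSeparable_adjoin_simple_iff_isSeparable, IsSeparable, ← hmin]
    exact separable_X_pow_sub_C a hn ha
  · rw [adjoin.finrank hαint, ← hmin, natDegree_X_pow_sub_C]

theorem exists_separable_extension_of_odd {k : Type*} [Field k] {p : ℕ} (hp : p.Prime)
    (hp2 : p ≠ 2) (hpk : (p : k) ≠ 0) {a : k} (ha : ∀ w, w ^ p ≠ a) :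
    ∃ L : IntermediateField k (AlgebraicClosure k), FiniteDimensional k L ∧
      Algebra.IsSeparable k L ∧ p ^ 2 ∣ Module.finrank k L := by
  have hp0 := pow_ne_zero 2 hp.ne_zero
  have ha0 : a ≠ 0 := by
    rintro rfl
    exact ha 0 (zero_pow hp.ne_zero)
  obtain ⟨α, hα⟩ := IsAlgClosed.exists_pow_nat_eq (algebraMap k (AlgebraicClosure k) a)
    (Nat.pos_of_ne_zero hp0)
  obtain ⟨h1, h2, h3⟩ :=
    adjoin_root_of_irreducible hp0 (by rw [Nat.cast_pow]; exact pow_ne_zero 2 hpk)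
    ha0 ((X_pow_sub_C_irreducible_iff_of_prime_pow hp hp2 two_ne_zero).2 ha) hα
  exact ⟨_, h1, h2, h3.symm.dvd⟩

theorem exists_separable_extension_of_norm {k : Type*} [Field k] (h2 : (2 : k) ≠ 0) {d m n : k}
    (hd : ∀ w, w ^ 2 ≠ d) (hmn : ∀ w, w ^ 2 ≠ m ^ 2 - d * n ^ 2) :
    ∃ L : IntermediateField k (AlgebraicClosure k), FiniteDimensional k L ∧
      Algebra.IsSeparable k L ∧ 2 ^ 2 ∣ Module.finrank k L := by
  let Ω := AlgebraicClosure k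
  have hd0 : d ≠ 0 := by
    rintro rfl
    exact hd 0 (zero_pow two_ne_zero)
  obtain ⟨α, hα⟩ := IsAlgClosed.exists_pow_nat_eq (algebraMap k Ω d) two_pos
  obtain ⟨hfin, hsep, hrank⟩ := adjoin_root_of_irreducible two_ne_zero (by simpa using h2) hd0
    (X_pow_sub_C_irreducible_of_prime Nat.prime_two hd) hα
  let F := k⟮α⟯
  let αF : F := ⟨α, mem_adjoin_simple_self k α⟩
  have hαF : αF ^ 2 = algebraMap k F d := Subtype.ext hα
  have hind : ∀ s t : k, algebraMap k F s + algebraMap k F t * αF = 0 → s = 0 ∧ t = 0 := by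
    intro s t h
    have ht : t = 0 := by
      by_contra ht
      have ht' : algebraMap k F t ≠ 0 := (_root_.map_ne_zero _).2 ht
      refine hd (s / t) ((algebraMap k F).injective ?_)
      rw [map_pow, map_div₀, ← hαF, div_pow, div_eq_iff (pow_ne_zero 2 ht')]
      linear_combination (algebraMap k F s - algebraMap k F t * αF) * h
    refine ⟨?_, ht⟩
    rwa [ht, map_zero, zero_mul, add_zero, map_eq_zero] at h
  let r : F := algebraMap k F m + algebraMap k F n * αF
  have hr : ∀ w : F, w ^ 2 ≠ r := by
    intro w hw
    obtain ⟨c, hc⟩ := exists_eq_sum_of_mem_adjoin_of_pow_eq two_pos hα w.2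
    have hw' : w = algebraMap k F (c 0) + algebraMap k F (c 1) * αF := by
      refine Subtype.ext (hc.trans ((Finset.sum_range_succ _ 1).trans ?_))
      rw [Finset.sum_range_one, pow_zero, mul_one, pow_one]
      rfl
    obtain ⟨e1, e2⟩ := hind (c 0 ^ 2 + d * c 1 ^ 2 - m) (2 * c 0 * c 1 - n) (by
      rw [hw'] at hw
      simp only [map_sub, map_add, map_mul, map_pow, map_ofNat]
      linear_combination hw - algebraMap k F (c 1) ^ 2 * hαF)
    refine hmn (c 0 ^ 2 - d * c 1 ^ 2) ?_
    linear_combination (c 0 ^ 2 + d * c 1 ^ 2 + m) * e1 - d * (2 * c 0 * c 1 + n) * e2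
  have hr0 : r ≠ 0 := fun h => hr 0 (by rw [h, zero_pow two_ne_zero])
  obtain ⟨δ, hδ⟩ := IsAlgClosed.exists_pow_nat_eq (algebraMap F Ω r) two_pos
  have h2F : ((2 : ℕ) : F) ≠ 0 := by
    rw [← map_natCast (algebraMap k F)]
    exact (_root_.map_ne_zero _).2 (by simpa using h2)
  obtain ⟨hfin', hsep', hrank'⟩ := adjoin_root_of_irreducible two_ne_zero h2F hr0
    (X_pow_sub_C_irreducible_of_prime Nat.prime_two hr) hδ
  refine ⟨F⟮δ⟯.restrictScalars k, FiniteDimensional.trans k F F⟮δ⟯,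
    Algebra.IsSeparable.trans k F F⟮δ⟯, ?_⟩
  have := Module.finrank_mul_finrank k F F⟮δ⟯
  rw [hrank, hrank'] at this
  exact (dvd_of_eq this)

end ResidueExtension

namespace ValuationSubring

open IsLocalRing

variable {K : Type*} [Field K] (O : ValuationSubring K)

theorem exists_pow_eq_of_residue {p : ℕ} (hp0 : p ≠ 0)
    (h1 : ∀ x ∈ O, x⁻¹ ∉ O → ∃ y, y ^ p = 1 - x) {u : O} (hu : IsUnit u) {v : ResidueField O}
    (hv : v ^ p = residue O u) : ∃ w : K, w ^ p = u := by
  obtain ⟨v, rfl⟩ := residue_surjective v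
  have hvu : IsUnit v := by
    rw [← residue_ne_zero_iff_isUnit] at hu ⊢
    rintro e
    rw [e, zero_pow hp0] at hv
    exact hu hv.symm
  obtain ⟨v, rfl⟩ := hvu
  have hv0 : ((v : O) : K) ≠ 0 := fun e => v.ne_zero (Subtype.ext e)
  obtain ⟨y, hy⟩ : ∃ y : K, y ^ p = u / ((v : O) : K) ^ p := by
    set t : O := 1 - u * (↑v⁻¹ : O) ^ p with ht
    have htK : (t : K) = 1 - u / ((v : O) : K) ^ p := by
      have hvi : ((↑v⁻¹ : O) : K) = ((v : O) : K)⁻¹ := by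
        rw [eq_comm, inv_eq_iff_eq_inv, ← one_div, eq_div_iff]
        · exact congrArg Subtype.val v.mul_inv
        · exact fun e => v⁻¹.ne_zero (Subtype.ext e)
      rw [ht, div_eq_mul_inv, ← inv_pow, ← hvi]
      rfl
    have htm : residue O t = 0 := by
      rw [ht, map_sub, map_mul, map_pow, map_one, ← hv, ← mul_pow, ← map_mul, v.mul_inv, map_one,
        one_pow, sub_self]
    rcases eq_or_ne t 0 with h0 | h0
    · refine ⟨1, ?_⟩
      rw [h0] at htK
      rw [one_pow]
      exact sub_eq_zero.1 htK.symm
    · obtain ⟨y, hy⟩ := h1 t t.2 fun hinv => by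
        have h0' : (t : K) ≠ 0 := fun e => h0 (Subtype.ext e)
        have : IsUnit t := IsUnit.of_mul_eq_one ⟨_, hinv⟩ (Subtype.ext (mul_inv_cancel₀ h0'))
        exact (residue_ne_zero_iff_isUnit t).2 this htm
      exact ⟨y, by rw [hy, htK, sub_sub_cancel]⟩
  exact ⟨y * (v : O), by rw [mul_pow, hy, div_mul_cancel₀ _ (pow_ne_zero p hv0)]⟩

theorem exists_residue_sq_eq_neg_one {s t : K} (hst : 1 + s ^ 2 + t ^ 2 = 0) (hs : s ∉ O)
    (hts : t / s ∈ O) : ∃ q : ResidueField O, q ^ 2 = -1 := by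
  have hs0 : s ≠ 0 := fun e => hs (e ▸ O.zero_mem)
  have hsi : s⁻¹ ∈ O := (O.mem_or_inv_mem s).resolve_left hs
  have h0 : residue O ⟨s⁻¹, hsi⟩ = 0 := by
    by_contra hne
    obtain ⟨u, hu⟩ := (residue_ne_zero_iff_isUnit _).1 hne
    have e : s⁻¹ * ((↑u⁻¹ : O) : K) = 1 := by
      have := congrArg Subtype.val u.mul_inv
      rw [hu] at this
      exact this
    exact hs ((inv_mul_eq_one₀ hs0).1 e ▸ (↑u⁻¹ : O).2)
  refine ⟨residue O ⟨t / s, hts⟩, ?_⟩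
  have e : (⟨t / s, hts⟩ : O) ^ 2 = -1 - (⟨s⁻¹, hsi⟩ : O) ^ 2 := Subtype.ext (by
    change (t / s) ^ 2 = -1 - s⁻¹ ^ 2
    rw [div_pow, inv_pow]
    field_simp
    linear_combination hst)
  rw [← map_pow, e, map_sub, map_pow, h0, map_neg, map_one, zero_pow two_ne_zero, sub_zero]

theorem exists_residue_sq_add_sq_eq_neg_one {s t : K} (hst : 1 + s ^ 2 + t ^ 2 = 0) :
    ∃ q r : ResidueField O, q ^ 2 + r ^ 2 = -1 := by
  suffices h : (s ∈ O ∧ t ∈ O) ∨ ∃ q : ResidueField O, q ^ 2 = -1 by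
    rcases h with ⟨hs, ht⟩ | ⟨q, hq⟩
    · refine ⟨residue O ⟨s, hs⟩, residue O ⟨t, ht⟩, ?_⟩
      rw [← map_pow, ← map_pow, ← map_add, ← map_one (residue O), ← map_neg]
      refine congrArg _ (Subtype.ext ?_)
      change s ^ 2 + t ^ 2 = -1
      linear_combination hst
    · exact ⟨q, 0, by rw [hq, zero_pow two_ne_zero, add_zero]⟩
  by_cases hts : t / s ∈ O
  · by_cases hs : s ∈ O
    · refine Or.inl ⟨hs, ?_⟩
      rcases eq_or_ne s 0 with rfl | hs0
      · rcases O.mem_or_inv_mem t with h | h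
        · exact h
        · have : t = -t⁻¹ := by
            have ht0 : t ≠ 0 := by
              rintro rfl
              simp at hst
            field_simp
            linear_combination hst
          rw [this]
          exact O.neg_mem _ h
      · have := O.mul_mem _ _ hts hs
        rwa [div_mul_cancel₀ _ hs0] at this
    · exact Or.inr (O.exists_residue_sq_eq_neg_one hst hs hts)
  · have hst' : s / t ∈ O := by
      have := (O.mem_or_inv_mem (t / s)).resolve_left hts
      rwa [inv_div] at this
    have ht0 : t ≠ 0 := by
      rintro rfl
      rw [zero_div] at hts
      exact hts O.zero_mem
    by_cases ht : t ∈ O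
    · have := O.mul_mem _ _ hst' ht
      rw [div_mul_cancel₀ _ ht0] at this
      exact Or.inl ⟨this, ht⟩
    · exact Or.inr (O.exists_residue_sq_eq_neg_one (by linear_combination hst) ht hst')

end ValuationSubring

namespace IsMetaGenerating

variable {p : ℕ} [hp : Fact p.Prime] {K M : Type*} [Field K] [Field M] [Algebra K M] {ζ : K}
  {x y : M ≃ₐ[K] M} {k : ℕ}

theorem exists_forall_zpow_eq (h : IsMetaGenerating p ζ x y k) {a b : K} {α β : M} (hα0 : α ≠ 0)
    (hα : α ^ p = algebraMap K M a) (hβ0 : β ≠ 0) (hβ : β ^ p = algebraMap K M b)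
    (hb : b ∈ lineSpan {z : K | z ≠ 0 ∧ ∃ w, w ^ p = z} a) :
    ∃ m : ℤ, ∀ (g : M ≃ₐ[K] M) (c d : K), g α = algebraMap K M c * α →
      g β = algebraMap K M d * β → c ^ m = d := by
  obtain ⟨-, m, hbm, w, hw⟩ := hb
  have hw0 : w ≠ 0 := by
    rintro rfl
    rw [zero_pow hp.out.ne_zero] at hw
    exact hbm hw.symm
  have hwM : algebraMap K M w ≠ 0 := (map_ne_zero _).2 hw0
  have hαm : α ^ m ≠ 0 := zpow_ne_zero m hα0
  obtain ⟨ω, -, hω⟩ := h.exists_eq_mul_of_pow_eq (u := β) (mul_ne_zero hwM hαm) (by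
    have ha0 : algebraMap K M a ≠ 0 := hα ▸ pow_ne_zero p hα0
    rw [mul_pow, ← map_pow, hw, ← zpow_natCast (α ^ m), ← zpow_mul, mul_comm m, zpow_mul,
      zpow_natCast, hα, hβ, map_div₀, map_zpow₀, div_mul_cancel₀ _ (zpow_ne_zero m ha0)])
  refine ⟨m, fun g c d hc hd => (algebraMap K M).injective (mul_right_cancel₀ hβ0 ?_)⟩
  rw [← hd, hω, map_mul, map_mul, map_zpow₀, AlgEquiv.commutes, AlgEquiv.commutes,
    map_zpow₀ g, hc, mul_zpow]
  ring

theorem exists_notMem_lineSpan (h : IsMetaGenerating p ζ x y k) {a : K} (ha : a ≠ 0) :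
    ∃ z ≠ 0, z ∉ lineSpan {z : K | z ≠ 0 ∧ ∃ w, w ^ p = z} a := by
  by_contra! hall
  have hζ := h.isPrimitiveRoot
  have hζM : algebraMap K M ζ ^ p = 1 := by rw [← map_pow, hζ.pow_eq_one, map_one]
  obtain ⟨α, hα⟩ := h.exists_root a
  have hα0 : α ≠ 0 := by
    rintro rfl
    rw [zero_pow hp.out.ne_zero] at hα
    exact ha ((map_eq_zero _).1 hα.symm)
  obtain ⟨c, hc, hxα⟩ := h.exists_apply_eq_mul hα0 hα x
  obtain ⟨d, hd, hyα⟩ := h.exists_apply_eq_mul hα0 hα y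
  obtain ⟨β, hβ0, hxβ, hyβ⟩ := h.exists_left
  obtain ⟨γ, hγ0, hxγ, hyγ⟩ := h.exists_right
  obtain ⟨b, hb⟩ := h.exists_eq_of_fixed (β ^ p)
    (by rw [map_pow, hxβ, mul_pow, hζM, one_mul]) (by rw [map_pow, hyβ])
  obtain ⟨e, he⟩ := h.exists_eq_of_fixed (γ ^ p)
    (by rw [map_pow, hxγ]) (by rw [map_pow, hyγ, mul_pow, hζM, one_mul])
  have hb0 : b ≠ 0 := by
    rintro rfl
    rw [map_zero] at hb
    exact pow_ne_zero p hβ0 hb.symm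
  have he0 : e ≠ 0 := by
    rintro rfl
    rw [map_zero] at he
    exact pow_ne_zero p hγ0 he.symm
  obtain ⟨m, hm⟩ := h.exists_forall_zpow_eq hα0 hα hβ0 hb.symm (hall b hb0)
  obtain ⟨n, hn⟩ := h.exists_forall_zpow_eq hα0 hα hγ0 he.symm (hall e he0)
  have h1 := hm x c ζ hxα hxβ
  have h2 := hn x c 1 hxα (by rw [hxγ, map_one, one_mul])
  have h3 := hn y d ζ hyα hyγ
  have hζ1 := hζ.ne_one hp.out.one_lt
  have hc1 : c ≠ 1 := by
    rintro rfl
    rw [one_zpow] at h1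
    exact hζ1 h1.symm
  obtain ⟨q, rfl⟩ := ((isPrimitiveRoot_of_ne_one hc hc1).zpow_eq_one_iff_dvd n).1 h2
  rw [zpow_mul, zpow_natCast, hd, one_zpow] at h3
  exact hζ1 h3.symm

end IsMetaGenerating

theorem Subgroup.exists_forall_zpow_of_index_eq {A : Type*} [CommGroup A] {N : Subgroup A} {p : ℕ}
    [Fact p.Prime] (hN : N.index = p) : ∃ a : A, ∀ z, ∃ n : ℤ, z / a ^ n ∈ N := by
  have := isCyclic_of_prime_card (α := A ⧸ N) (p := p) hN
  obtain ⟨g, hg⟩ := IsCyclic.exists_generator (α := A ⧸ N)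
  obtain ⟨a, rfl⟩ := QuotientGroup.mk_surjective g
  refine ⟨a, fun z => ?_⟩
  obtain ⟨n, hn⟩ := Subgroup.mem_zpowers_iff.1 (hg z)
  refine ⟨n, ?_⟩
  rw [← QuotientGroup.eq_one_iff, QuotientGroup.mk_div, QuotientGroup.mk_zpow, hn, div_self']

section TamelyBranching

open IsLocalRing

variable {p : ℕ} [hp : Fact p.Prime] {K : Type*} [Field K]

omit hp in
theorem mem_of_mem_range_sup_unitGroup {O : ValuationSubring K} {H : Set K}
    (hH : IsMulSubgroup H) (hpH : ∀ z : K, z ≠ 0 → z ^ p ∈ H)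
    (hunit : ∀ z : K, z ≠ 0 → z ∈ O → z⁻¹ ∈ O → z ∈ H) {u : Kˣ}
    (hu : u ∈ (powMonoidHom p : Kˣ →* Kˣ).range ⊔ O.unitGroup) : (u : K) ∈ H := by
  obtain ⟨_, ⟨v, rfl⟩, w, hw, rfl⟩ := Subgroup.mem_sup.1 hu
  rw [Units.val_mul]
  rw [ValuationSubring.mem_unitGroup_iff] at hw
  refine hH.mul_mem ?_ (hunit w w.ne_zero ?_ ?_)
  · rw [powMonoidHom_apply, Units.val_pow_eq_pow_val]
    exact hpH v v.ne_zero
  · rw [← O.valuation_le_one_iff, hw]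
  · rw [← O.valuation_le_one_iff, map_inv₀, hw, inv_one]

theorem exists_separable_extension_residueField {O : ValuationSubring K}
    (hpk : (p : ResidueField O) ≠ 0) (h1 : ∀ x ∈ O, x⁻¹ ∉ O → ∃ y, y ^ p = 1 - x)
    (h2 : p = 2 → (¬ ∃ w : K, w ^ 2 = -1) → ∃ s t : K, 1 + s ^ 2 + t ^ 2 = 0) {u : K} (hu0 : u ≠ 0)
    (hu : u ∈ O) (hu' : u⁻¹ ∈ O) (hup : ¬ ∃ w, w ^ p = u) :
    ∃ L : IntermediateField (ResidueField O) (AlgebraicClosure (ResidueField O)),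
      FiniteDimensional (ResidueField O) L ∧ Algebra.IsSeparable (ResidueField O) L ∧
        p ^ 2 ∣ Module.finrank (ResidueField O) L := by
  have hunit : IsUnit (⟨u, hu⟩ : O) :=
    IsUnit.of_mul_eq_one ⟨u⁻¹, hu'⟩ (Subtype.ext (mul_inv_cancel₀ hu0))
  have hures : ∀ v : ResidueField O, v ^ p ≠ residue O ⟨u, hu⟩ := fun v hv =>
    hup (O.exists_pow_eq_of_residue hp.out.ne_zero h1 hunit hv)
  rcases eq_or_ne p 2 with rfl | hp2
  · have hk2 : (2 : ResidueField O) ≠ 0 := by simpa using hpk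
    by_cases hi : ∃ i : ResidueField O, i ^ 2 = -1
    · obtain ⟨i, hi⟩ := hi
      refine exists_separable_extension_of_norm hk2 (m := 0) (n := 1) hures fun w hw =>
        hures (i * w) ?_
      rw [mul_pow, hi, hw]
      ring
    · push Not at hi
      have hiK : ¬ ∃ w : K, w ^ 2 = -1 := by
        rintro ⟨w, hw⟩
        have hw0 : w ≠ 0 := by
          rintro rfl
          simp at hw
        have hwO : w ∈ O := by
          rcases O.mem_or_inv_mem w with h | h
          · exact h
          · have : w = -w⁻¹ := by
              field_simp
              exact hw
            rw [this]
            exact O.neg_mem _ h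
        refine hi (residue O ⟨w, hwO⟩) ?_
        rw [← map_pow, ← map_one (residue O), ← map_neg]
        exact congrArg _ (Subtype.ext hw)
      obtain ⟨s, t, hst⟩ := h2 rfl hiK
      obtain ⟨q, r, hqr⟩ := O.exists_residue_sq_add_sq_eq_neg_one hst
      refine exists_separable_extension_of_norm hk2 (d := -1) (m := q) (n := r) hi fun w hw =>
        hi w ?_
      rw [hw]
      linear_combination hqr
  · exact exists_separable_extension_of_odd hp.out hp2 hpk hures

theorem IsMetaGenerating.isTamelyBranching {M : Type*} [Field M] [Algebra K M] {ζ : K}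
    {x y : M ≃ₐ[K] M} {k : ℕ} (h : IsMetaGenerating p ζ x y k)
    (he : p = 2 → ∃ e ≠ 0, x e = e ∧ x (y e) = y e ∧ y (y e) = -e) {O : ValuationSubring K}
    {a : K} (ha : a ≠ 0) (hpO : (p : K)⁻¹ ∈ O) (h1 : ∀ x ∈ O, x⁻¹ ∉ O → ∃ y, y ^ p = 1 - x)
    (hunit : ∀ z : K, z ≠ 0 → z ∈ O → z⁻¹ ∈ O →
      z ∈ lineSpan {z : K | z ≠ 0 ∧ ∃ w, w ^ p = z} a) : IsTamelyBranching p O := by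
  set T := {z : K | z ≠ 0 ∧ ∃ w, w ^ p = z} with hTdef
  have hT : IsMulSubgroup T := isMulSubgroup_setOf_pow p
  have hTp : ∀ z : K, z ≠ 0 → z ^ p ∈ T := fun z hz => ⟨pow_ne_zero p hz, z, rfl⟩
  have hp0 : (p : K) ≠ 0 := h.isPrimitiveRoot.neZero'.out
  have hpk : (p : ResidueField O) ≠ 0 := by
    have hpu : IsUnit (p : O) :=
      IsUnit.of_mul_eq_one ⟨_, hpO⟩ (Subtype.ext (by
        change ((p : O) : K) * (p : K)⁻¹ = 1
        rw [show ((p : O) : K) = p from map_natCast O.subtype p, mul_inv_cancel₀ hp0]))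
    have := (residue_ne_zero_iff_isUnit _).2 hpu
    rwa [map_natCast] at this
  refine ⟨fun e => hpk ?_, fun htop => ?_, fun hindex => ?_⟩
  · exact (ringChar.spec _ p).2 e.dvd
  · obtain ⟨z, hz0, hz⟩ := h.exists_notMem_lineSpan ha
    refine hz (mem_of_mem_range_sup_unitGroup (u := Units.mk0 z hz0) (O := O) (p := p)
      (isMulSubgroup_lineSpan hT ha) (fun z hz => subset_lineSpan hT _ (hTp z hz)) hunit ?_)
    rw [htop]
    trivial
  · obtain ⟨u, hu0, hu, hu', huT⟩ : ∃ u : K, u ≠ 0 ∧ u ∈ O ∧ u⁻¹ ∈ O ∧ u ∉ T := by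
      by_contra! hcon
      obtain ⟨g, hg⟩ := Subgroup.exists_forall_zpow_of_index_eq hindex
      obtain ⟨z, hz0, hz⟩ := h.exists_notMem_lineSpan g.ne_zero
      obtain ⟨n, hn⟩ := hg (Units.mk0 z hz0)
      have := mem_of_mem_range_sup_unitGroup hT hTp hcon hn
      exact hz ⟨hz0, n, by
        rwa [Units.val_div_eq_div_val, Units.val_zpow_eq_zpow_val, Units.val_mk0] at this⟩
    refine exists_separable_extension_residueField hpk h1 ?_ hu0 hu hu' fun e => huT ⟨hu0, e⟩
    rintro rfl hi
    obtain ⟨e, he0, hxe, hxye, hyye⟩ := he rfl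
    obtain ⟨s, t, -, -, hst⟩ := h.exists_one_add_add_eq_zero hi he0 hxe hxye hyye
    exact ⟨s, t, hst⟩

end TamelyBranching

/-- Let `p` be a prime and `K` a field containing a primitive `p`-th root of
unity. If `Gal(K''/K)` is isomorphic to a semidirect product `(ℤ/p²ℤ) ⋊_θ (ℤ/p²ℤ)`, then `K`
admits a `p`-henselian valuation tamely branching at `p`. -/
theorem statement_4 (p : ℕ) (hp : p.Prime) (K : Type) [Field K]
    (hζ : ∃ ζ : K, IsPrimitiveRoot ζ p)
    (h : ∃ θ : Multiplicative (ZMod (p ^ 2)) →* MulAut (Multiplicative (ZMod (p ^ 2))),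
      Nonempty ((↥(metaAbExt p K) ≃ₐ[K] ↥(metaAbExt p K)) ≃*
        SemidirectProduct (Multiplicative (ZMod (p ^ 2)))
          (Multiplicative (ZMod (p ^ 2))) θ)) :
    ∃ O : ValuationSubring K, IsPHenselian p O ∧ IsTamelyBranching p O := by
  have : Fact p.Prime := ⟨hp⟩
  obtain ⟨ζ, hζ⟩ := hζ
  obtain ⟨θ, ⟨e⟩⟩ := h
  obtain ⟨x, y, k, hxy, he⟩ := exists_isMetaGenerating hζ e
  obtain ⟨a, ha, hR⟩ := hxy.exists_isRigidPair he
  have h1 : ∀ x ∈ hR.valuationSubring, x⁻¹ ∉ hR.valuationSubring → ∃ y, y ^ p = 1 - x :=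
    fun x hx hx' => (hR.one_sub_mem hx hx').2
  refine ⟨hR.valuationSubring, isPHenselian_of_one_sub_mem hζ h1,
    hxy.isTamelyBranching he ha ?_ h1 fun z hz0 hz hz' => hR.mem_right_of_unit hz0 hz hz'⟩
  exact hR.inv_prime_mem hp hζ.neZero'.out (fun _ hz => hz.2) fun z hz =>
    hR.le ⟨pow_ne_zero p hz, z, rfl⟩
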